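/- Assume additionally m ≥ 2 and r ≠ [m, 2], and let s, s′ be distinct rational numbers in I_1(r;n) ∪ I_2(r;n) such that u_s is conjugate in Heck(r;n) to u_{s′} or to u_{s′}^{−1}. Then u_{s̃} is conjugate in Heck(r̃;n) = ⟨a, b | u_{r̃}^n⟩ to u_{s̃′} or to u_{s̃′}^{−1} (as unoriented loops, α_{s̃} and α_{s̃′} represent the same conjugacy class in Heck(r̃;n)). -/

import Mathlib

/- Formalization of statements from "Homotopically equivalent simple loops on
2-bridge spheres in Heckoid orbifolds for 2-bridge links (II)" by Lee-Sakuma.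

We work in the free group `F` on two generators `a = gen 0`, `b = gen 1`.
For a rational `s` (in lowest terms `q/p`, with `0 ≤ s ≤ 1`), `uWord s` is the
word `u_s = a b^{ε₁} a^{ε₂} ⋯ b^{ε_{2p-1}}` with `ε_i = (-1)^⌊i·s⌋`.
`CS s` is (a linear representative of) the cyclic sequence of lengths of
maximal constant-sign runs of exponents of `u_s`; since `u_s` begins with a
positive letter and (for `0 < s ≤ 1`) ends with a negative letter, the linear
run-length sequence represents the cyclic one.  `CyclicContains L T` says the
cyclic sequence represented by `L` contains `T` as a block of consecutive
terms.  `cfQ [m₁,…,m_k]` is the continued fraction `1/(m₁+1/(m₂+⋯+1/m_k))`.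
`memI1 M n s` / `memI2 M n s` express `s ∈ I₁(r;n)` / `s ∈ I₂(r;n)` where
`r = cfQ M`, and `memI1hat` / `memI2hat` express `s ∈ I₁(r)` / `s ∈ I₂(r)`.
The Heckoid group `Heck(r;n) = ⟨a,b | u_r^n⟩` is the quotient of `F` by the
normal closure `heckN r n` of `u_r^n`, with quotient map `heckQ r n`. -/

namespace Heckoid

abbrev F : Type := FreeGroup (Fin 2)

/-- The generators: `gen 0 = a`, `gen 1 = b` (and `gen i` depends on parity). -/
def gen (i : ℕ) : F := FreeGroup.of ⟨i % 2, Nat.mod_lt _ (by norm_num)⟩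

/-- The word `u_s = a b^{ε₁} a^{ε₂} b^{ε₃} ⋯ a^{ε_{2p-2}} b^{ε_{2p-1}}`,
where `s = q/p` in lowest terms and `ε_i = (-1)^⌊iq/p⌋`. -/
def uWord (s : ℚ) : F :=
  ((List.range (2 * s.den)).map
    (fun i => gen i ^ ((-1 : ℤ) ^ (⌊(i : ℚ) * s⌋.toNat)))).prod

/-- The sequence of exponent signs `ε₀, ε₁, …, ε_{2p-1}` of `u_s`. -/
def signList (s : ℚ) : List ℤ :=
  (List.range (2 * s.den)).map (fun i => (-1 : ℤ) ^ (⌊(i : ℚ) * s⌋.toNat))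

/-- Lengths of the maximal runs of equal consecutive entries. -/
def runLengths {α : Type} [BEq α] (l : List α) : List ℕ :=
  (l.splitBy (· == ·)).map List.length

/-- `CS s = CS(u_s)`: the cyclic sequence of lengths of maximal constant-sign
runs of `u_s`, represented by a list. -/
def CS (s : ℚ) : List ℕ := runLengths (signList s)

/-- The cyclic sequence represented by `L` contains `T` as a block of
consecutive terms. -/
def CyclicContains (L T : List ℕ) : Prop := ∃ k, T <+: L.rotate k

/-- The continued fraction `[m₁, m₂, …, m_k] = 1/(m₁+1/(m₂+⋯+1/m_k))`. -/
def cfQ : List ℕ → ℚ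
  | [] => 0
  | a :: l => 1 / ((a : ℚ) + cfQ l)

/-- `d⟨T, T'⟩`: `d` consecutive repetitions of the concatenation of `T` and `T'`. -/
def rep2 (d : ℕ) (T T' : List ℕ) : List ℕ := (List.replicate d (T ++ T')).flatten

/-- `s ∈ I₁(r;n)` where `r = cfQ M`:  `[0, [m₁,…,m_{k-1},m_k-1,2]]` for `k` even,
`[0, [m₁,…,m_k,2n-2])` for `k` odd. -/
def memI1 (M : List ℕ) (n : ℕ) (s : ℚ) : Prop :=
  if Even M.length then 0 ≤ s ∧ s ≤ cfQ (M.dropLast ++ [M.getLast! - 1, 2])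
  else 0 ≤ s ∧ s < cfQ (M ++ [2 * n - 2])

/-- `s ∈ I₂(r;n)` where `r = cfQ M`: `([m₁,…,m_k,2n-2], 1]` for `k` even,
`[[m₁,…,m_{k-1},m_k-1,2], 1]` for `k` odd. -/
def memI2 (M : List ℕ) (n : ℕ) (s : ℚ) : Prop :=
  if Even M.length then cfQ (M ++ [2 * n - 2]) < s ∧ s ≤ 1
  else cfQ (M.dropLast ++ [M.getLast! - 1, 2]) ≤ s ∧ s ≤ 1

/-- `s ∈ I₁(r)` where `r = cfQ M`. -/
def memI1hat (M : List ℕ) (s : ℚ) : Prop :=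
  if Even M.length then 0 ≤ s ∧ s ≤ cfQ (M.dropLast ++ [M.getLast! - 1])
  else 0 ≤ s ∧ s ≤ cfQ M.dropLast

/-- `s ∈ I₂(r)` where `r = cfQ M`. -/
def memI2hat (M : List ℕ) (s : ℚ) : Prop :=
  if Even M.length then cfQ M.dropLast ≤ s ∧ s ≤ 1
  else cfQ (M.dropLast ++ [M.getLast! - 1]) ≤ s ∧ s ≤ 1

/-- The normal closure of `u_r^n`, so that `Heck(r;n) = F ⧸ heckN r n`. -/
abbrev heckN (r : ℚ) (n : ℕ) : Subgroup F := Subgroup.normalClosure {uWord r ^ n}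

/-- The quotient map `F → Heck(r;n) = ⟨a, b | u_r^n⟩`. -/
def heckQ (r : ℚ) (n : ℕ) : F →* F ⧸ heckN r n := QuotientGroup.mk' (heckN r n)

/-- The derived continued-fraction list: `[l₁,1,l₃,…,l_t] ↦ [l₃,…,l_t]` and
`[l₁,l₂,…,l_t] ↦ [l₂-1,l₃,…,l_t]` when `l₂ ≥ 2`. -/
def deriveCF : List ℕ → List ℕ
  | _ :: 1 :: rest => rest
  | _ :: l₂ :: rest => (l₂ - 1) :: rest
  | _ => []

/-- `L` is the continued fraction expansion of `s` (all entries positive,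
last entry `≥ 2`). -/
def IsCFExp (s : ℚ) (L : List ℕ) : Prop :=
  L ≠ [] ∧ (∀ x ∈ L, 0 < x) ∧ 2 ≤ L.getLast! ∧ s = cfQ L

end Heckoid

namespace Heckoid
open Equiv

lemma perm_apply_inv {D : Type} (π : Perm D) (d : D) : π (π⁻¹ d) = d := π.apply_symm_apply d
lemma perm_inv_apply {D : Type} (π : Perm D) (d : D) : π⁻¹ (π d) = d := π.symm_apply_apply d

section Genus
variable {D : Type} [Fintype D] [DecidableEq D]

/-- The number of classes of an equivalence relation. -/
noncomputable def numClasses (S : Setoid D) : ℕ := Nat.card (Quotient S)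

/-- The equivalence relation obtained from `S` by merging the classes of `a` and `b`. -/
noncomputable def mergeSetoid (S : Setoid D) (a b : D) : Setoid D :=
  Setoid.ker (fun x => open Classical in if S x b then (Quotient.mk S a) else Quotient.mk S x)

lemma numClasses_anti {S T : Setoid D} (h : S ≤ T) : numClasses T ≤ numClasses S := by
  unfold numClasses
  refine Nat.card_le_card_of_surjective (Quotient.map' (s₁ := S) (s₂ := T) id (fun a b hab => h hab)) ?_
  intro q
  induction q using Quotient.inductionOn with
  | h x => exact ⟨Quotient.mk S x, rfl⟩

lemma numClasses_lt {S T : Setoid D} (h : S ≤ T) {a b : D} (hT : T a b) (hS : ¬ S a b) :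
    numClasses T + 1 ≤ numClasses S := by
  by_contra hlt
  have heq : Nat.card (Quotient S) = Nat.card (Quotient T) := by
    have := numClasses_anti h
    unfold numClasses at *
    omega
  have hsurj : Function.Surjective (Quotient.map' (s₁ := S) (s₂ := T) id (fun a b hab => h hab)) := by
    intro q
    induction q using Quotient.inductionOn with
    | h x => exact ⟨Quotient.mk S x, rfl⟩
  have hbij := (Nat.bijective_iff_surjective_and_card _).2 ⟨hsurj, heq⟩
  apply hS
  have : Quotient.mk S a = Quotient.mk S b := by
    apply hbij.1
    exact Quotient.sound hT
  exact Quotient.exact this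

lemma le_mergeSetoid (S : Setoid D) (a b : D) : S ≤ mergeSetoid S a b := by
  intro x y hxy
  rw [mergeSetoid, Setoid.ker_def]
  have h1 : S x b ↔ S y b := ⟨fun h => S.trans (S.symm hxy) h, fun h => S.trans hxy h⟩
  by_cases h : S x b
  · rw [if_pos h, if_pos (h1.1 h)]
  · rw [if_neg h, if_neg (fun h' => h (h1.2 h'))]
    exact Quotient.sound hxy

lemma mergeSetoid_rel (S : Setoid D) (a b : D) : mergeSetoid S a b a b := by
  rw [mergeSetoid, Setoid.ker_def]
  rw [if_pos (S.refl b)]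
  by_cases h : S a b
  · rw [if_pos h]
  · rw [if_neg h]

lemma numClasses_le_merge {S T : Setoid D} {a b : D} (h : T ≤ mergeSetoid S a b) :
    numClasses S ≤ numClasses T + 1 := by
  classical
  refine le_trans ?_ (Nat.add_le_add_right (numClasses_anti h) 1)
  unfold numClasses
  have : Nat.card (Option (Quotient (mergeSetoid S a b))) = Nat.card (Quotient (mergeSetoid S a b)) + 1 :=
    Finite.card_option
  rw [← this]
  let f : Quotient S → Option (Quotient (mergeSetoid S a b)) := fun q =>
    if q = Quotient.mk S b then none
    else some (Quotient.map' (s₁ := S) (s₂ := mergeSetoid S a b) id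
      (fun x y hxy => le_mergeSetoid S a b hxy) q)
  refine Nat.card_le_card_of_injective f ?_
  intro p q hpq
  induction p using Quotient.inductionOn with
  | h x =>
  induction q using Quotient.inductionOn with
  | h y =>
  simp only [f] at hpq
  by_cases hx : Quotient.mk S x = Quotient.mk S b <;> by_cases hy : Quotient.mk S y = Quotient.mk S b
  · rw [hx, hy]
  · simp [hx, hy] at hpq
  · simp [hx, hy] at hpq
  · rw [if_neg hx, if_neg hy] at hpq
    have h2 := Quotient.exact (Option.some.inj hpq)
    have h3 : mergeSetoid S a b x y := h2
    rw [mergeSetoid, Setoid.ker_def] at h3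
    rw [if_neg (fun h => hx (Quotient.sound h)), if_neg (fun h => hy (Quotient.sound h))] at h3
    exact h3

/-- The number of cycles of a permutation, fixed points included. -/
noncomputable def cyc (π : Perm D) : ℕ := numClasses (Perm.SameCycle.setoid π)

lemma sameCycle_setoid_le {π : Perm D} {S : Setoid D} (h : ∀ x, S x (π x)) :
    Perm.SameCycle.setoid π ≤ S := by
  rintro x y ⟨i, rfl⟩
  have hn : ∀ n : ℕ, ∀ x, S x ((π ^ n) x) := by
    intro n
    induction n with
    | zero => intro x; exact S.refl x
    | succ n ih => intro x; rw [pow_succ']; exact S.trans (ih x) (h _)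
  rcases i with n | n
  · exact hn n x
  · have := hn (n+1) ((π ^ (Int.negSucc n)) x)
    rw [zpow_negSucc] at this ⊢
    simpa using S.symm this

lemma sameCycle_setoid_apply (π : Perm D) (x : D) : Perm.SameCycle.setoid π x (π x) :=
  ⟨1, by simp⟩

lemma sameCycle_mul_swap_le (π : Perm D) {a b : D} {S : Setoid D}
    (h : Perm.SameCycle.setoid π ≤ S) (hab : S a b) : Perm.SameCycle.setoid (π * swap a b) ≤ S := by
  refine sameCycle_setoid_le (fun x => ?_)
  rw [Perm.mul_apply]
  have h' : ∀ y, S y (π y) := fun y => h (sameCycle_setoid_apply π y)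
  by_cases hxa : x = a
  · subst hxa; rw [swap_apply_left]; exact S.trans hab (h' _)
  by_cases hxb : x = b
  · subst hxb; rw [swap_apply_right]; exact S.trans (S.symm hab) (h' _)
  rw [swap_apply_of_ne_of_ne hxa hxb]; exact h' _

lemma sameCycle_le_of_mul_swap (π : Perm D) {a b : D} {S : Setoid D}
    (h : Perm.SameCycle.setoid (π * swap a b) ≤ S) (hab : S a b) : Perm.SameCycle.setoid π ≤ S := by
  have := sameCycle_mul_swap_le (π * swap a b) h hab
  rwa [mul_assoc, swap_mul_self, mul_one] at this

lemma cyc_le_mul_swap (π : Perm D) (a b : D) : cyc π ≤ cyc (π * swap a b) + 1 :=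
  numClasses_le_merge (a := a) (b := b)
    (sameCycle_mul_swap_le π (le_mergeSetoid _ a b) (mergeSetoid_rel _ a b))

lemma cyc_add_one_le {π : Perm D} {a b : D} (h : π.SameCycle a b)
    (h' : ¬ (π * swap a b).SameCycle a b) : cyc π + 1 ≤ cyc (π * swap a b) :=
  numClasses_lt (sameCycle_mul_swap_le π le_rfl h) h h'

lemma sameCycle_or_mul_swap (π : Perm D) (a b : D) :
    π.SameCycle a b ∨ (π * swap a b).SameCycle a b := by
  by_contra hcon
  push Not at hcon
  obtain ⟨h1, h2⟩ := hcon
  have hab : a ≠ b := by rintro rfl; exact h1 (Perm.SameCycle.refl _ _)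
  have hex : ∃ n : ℕ, 0 < n ∧ (π ^ n) a = a := by
    refine ⟨orderOf π, orderOf_pos π, by simp [pow_orderOf_eq_one]⟩
  classical
  obtain ⟨hn0, hna⟩ := Nat.find_spec hex
  set n := Nat.find hex
  have key : ∀ j, 1 ≤ j → j ≤ n → ((π * swap a b) ^ j) b = (π ^ j) a := by
    intro j hj
    induction j, hj using Nat.le_induction with
    | base => intro _; simp
    | succ j hj ih =>
      intro hjn
      rw [pow_succ', Perm.mul_apply, ih (by omega), Perm.mul_apply, pow_succ', Perm.mul_apply]
      rw [swap_apply_of_ne_of_ne]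
      · intro h
        exact Nat.find_min hex (m := j) (by omega) ⟨by omega, h⟩
      · intro h
        exact h1 ⟨j, by simpa using h⟩
  have := key n hn0 le_rfl
  rw [hna] at this
  exact h2 (Perm.SameCycle.symm ⟨n, by simpa using this⟩)

/-- The orbit relation of the group generated by two permutations. -/
def orbSetoid (x y : Perm D) : Setoid D := Perm.SameCycle.setoid x ⊔ Perm.SameCycle.setoid y

/-- The pair `(x, y)` describes a map of genus zero (Euler's formula as an inequality). -/
def Planar (x y : Perm D) : Prop :=
  Fintype.card D + 2 * numClasses (orbSetoid x y) ≤ cyc x + cyc y + cyc (x * y)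

lemma orb_left (x y : Perm D) (d : D) : orbSetoid x y d (x d) :=
  (le_sup_left : Perm.SameCycle.setoid x ≤ orbSetoid x y) (sameCycle_setoid_apply x d)
lemma orb_right (x y : Perm D) (d : D) : orbSetoid x y d (y d) :=
  (le_sup_right : Perm.SameCycle.setoid y ≤ orbSetoid x y) (sameCycle_setoid_apply y d)
lemma orb_le {x y : Perm D} {S : Setoid D} (hx : ∀ d, S d (x d)) (hy : ∀ d, S d (y d)) :
    orbSetoid x y ≤ S := sup_le (sameCycle_setoid_le hx) (sameCycle_setoid_le hy)

lemma orb_le_of_mul_swap (x y : Perm D) {a b : D} {S : Setoid D}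
    (h : orbSetoid x (y * swap a b) ≤ S) (hab : S a b) : orbSetoid x y ≤ S :=
  sup_le (le_trans le_sup_left h) (sameCycle_le_of_mul_swap y (le_trans le_sup_right h) hab)

lemma orb_mul_le (x y : Perm D) : Perm.SameCycle.setoid (x * y) ≤ orbSetoid x y :=
  sameCycle_setoid_le (fun d => (orbSetoid x y).trans (orb_right x y d) (orb_left x y (y d)))

lemma planar_split_of {x y : Perm D} {a b : D} (hP : Planar x y)
    (hgain : cyc y + 1 ≤ cyc (y * swap a b)) : Planar x (y * swap a b) := by
  unfold Planar at *
  rw [← mul_assoc]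
  have h1 : numClasses (orbSetoid x (y * swap a b)) ≤ numClasses (orbSetoid x y) + 1 :=
    numClasses_le_merge (a := a) (b := b)
      (orb_le_of_mul_swap x y (le_mergeSetoid _ a b) (mergeSetoid_rel _ a b))
  by_cases h : (x * y * swap a b).SameCycle a b
  · have h2 := cyc_le_mul_swap (x * y) a b
    have h3 : numClasses (orbSetoid x (y * swap a b)) ≤ numClasses (orbSetoid x y) := by
      refine numClasses_anti (orb_le_of_mul_swap x y le_rfl ?_)
      have := orb_mul_le x (y * swap a b)
      rw [← mul_assoc] at this
      exact this h
    omega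
  · have h2 := cyc_add_one_le ((sameCycle_or_mul_swap (x * y) a b).resolve_right h) h
    omega

lemma planar_split {x y : Perm D} {a b : D} (hP : Planar x y) (h : y.SameCycle a b)
    (h' : ¬ (y * swap a b).SameCycle a b) : Planar x (y * swap a b) :=
  planar_split_of hP (cyc_add_one_le h h')

lemma planar_vertex_split {x y : Perm D} {a b : D} (hP : Planar x y) (hgain : (x * y).SameCycle a b)
    (hgain' : ¬ (x * y * swap a b).SameCycle a b) : Planar x (y * swap a b) := by
  have hg := cyc_add_one_le hgain hgain'
  unfold Planar at *
  rw [← mul_assoc]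
  have h1 : numClasses (orbSetoid x (y * swap a b)) ≤ numClasses (orbSetoid x y) + 1 :=
    numClasses_le_merge (a := a) (b := b)
      (orb_le_of_mul_swap x y (le_mergeSetoid _ a b) (mergeSetoid_rel _ a b))
  by_cases h : (y * swap a b).SameCycle a b
  · have h2 := cyc_le_mul_swap y a b
    have h3 : numClasses (orbSetoid x (y * swap a b)) ≤ numClasses (orbSetoid x y) :=
      numClasses_anti (orb_le_of_mul_swap x y le_rfl
        ((le_sup_right : Perm.SameCycle.setoid (y * swap a b) ≤ orbSetoid x (y * swap a b)) h))
    omega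
  · have h2 := cyc_add_one_le ((sameCycle_or_mul_swap y a b).resolve_right h) h
    omega

lemma not_sameCycle_detach {π : Perm D} {a b : D} (h : π a = b) (hab : a ≠ b) :
    ¬ (π * swap a b).SameCycle a b := by
  intro hs
  have hb : (π * swap a b) b = b := by simp [h]
  exact hab ((hs.eq_of_right hb))

lemma planar_detach {x y : Perm D} {a b : D} (hP : Planar x y) (h : x (y a) = b) (hab : a ≠ b) :
    Planar x (y * swap a b) :=
  planar_vertex_split hP ⟨1, by simpa using h⟩ (not_sameCycle_detach (π := x * y) h hab)

lemma planar_join {x y : Perm D} {a b : D} (hP : Planar x y) (h : ¬ orbSetoid x y a b) :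
    Planar x (y * swap a b) := by
  unfold Planar at *
  rw [← mul_assoc]
  have hy : ¬ y.SameCycle a b := fun hc =>
    h ((le_sup_right : Perm.SameCycle.setoid y ≤ orbSetoid x y) hc)
  have hy' := (sameCycle_or_mul_swap y a b).resolve_left hy
  have hab : orbSetoid x (y * swap a b) a b :=
    (le_sup_right : Perm.SameCycle.setoid (y * swap a b) ≤ _) hy'
  have := numClasses_lt (orb_le_of_mul_swap x y le_rfl hab) hab h
  have h2 := cyc_le_mul_swap y a b
  have h3 := cyc_le_mul_swap (x * y) a b
  omega

lemma cyc_inv (x : Perm D) : cyc x⁻¹ = cyc x := by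
  unfold cyc
  congr 1
  ext a b
  exact Perm.sameCycle_inv

lemma cyc_conj (x g : Perm D) : cyc (g * x * g⁻¹) = cyc x := by
  unfold cyc numClasses
  refine Nat.card_congr (Quotient.congr g⁻¹ ?_)
  intro a b
  exact Perm.sameCycle_conj

lemma orb_rotate (x y : Perm D) : orbSetoid y⁻¹ (x * y) = orbSetoid x y := by
  refine le_antisymm (orb_le (fun d => ?_) (fun d => ?_)) ?_
  · have := orb_right x y (y⁻¹ d)
    rw [perm_apply_inv] at this
    exact (orbSetoid x y).symm this
  · exact (orbSetoid x y).trans (orb_right x y d) (orb_left x y (y d))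
  · have hr : ∀ d, orbSetoid y⁻¹ (x * y) d (y d) := by
      intro d
      have := orb_left y⁻¹ (x * y) (y d)
      rw [perm_inv_apply] at this
      exact (orbSetoid y⁻¹ (x * y)).symm this
    refine orb_le (fun d => ?_) hr
    have h3 := orb_right y⁻¹ (x * y) (y⁻¹ d)
    have h4 := orb_left y⁻¹ (x * y) d
    have : (x * y) (y⁻¹ d) = x d := by simp
    rw [this] at h3
    exact (orbSetoid y⁻¹ (x * y)).trans h4 h3

lemma planar_rotate_iff (x y : Perm D) : Planar y⁻¹ (x * y) ↔ Planar x y := by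
  have h1 : cyc (y⁻¹ * (x * y)) = cyc x := by
    have := cyc_conj x y⁻¹
    rwa [inv_inv, mul_assoc] at this
  unfold Planar
  rw [h1, orb_rotate, cyc_inv]
  constructor <;> intro h <;> omega

lemma not_orb_of_invariant {x y : Perm D} {a b : D} (f : D → Prop) (hx : ∀ d, f (x d) ↔ f d)
    (hy : ∀ d, f (y d) ↔ f d) (ha : f a) (hb : ¬ f b) : ¬ orbSetoid x y a b := by
  intro h
  have : orbSetoid x y ≤ Setoid.ker f :=
    orb_le (fun d => by rw [Setoid.ker_def, hx]) (fun d => by rw [Setoid.ker_def, hy])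
  have := this h
  rw [Setoid.ker_def] at this
  exact hb (this ▸ ha)

lemma planar_detach_left {x y : Perm D} {a b : D} (hP : Planar x y) (h : x (y a) = b)
    (hab : a ≠ b) : Planar (x * swap (y a) (y b)) y := by
  have e : x * swap (y a) (y b) * y = x * y * swap a b := by
    rw [mul_assoc, mul_assoc, mul_swap_eq_swap_mul]
  rw [← planar_rotate_iff, e]
  exact planar_split ((planar_rotate_iff x y).2 hP) ⟨1, by simpa using h⟩
    (not_sameCycle_detach (π := x * y) h hab)

/-- Create a digon on two isolated darts. -/
lemma planar_digon {x y : Perm D} {a b : D} (hP : Planar x y) (hab : a ≠ b) (xa : x a = a)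
    (xb : x b = b) (ya : y a = a) (yb : y b = b) : Planar (x * swap a b) (y * swap a b) := by
  have e : x * swap a b * (y * swap a b) = x * y := by
    ext d
    by_cases hda : d = a
    · subst hda; simp [yb, xa, ya]
    by_cases hdb : d = b
    · subst hdb; simp [yb, xb, ya]
    · have h1 : y d ≠ a := fun h => hda (y.injective (h.trans ya.symm))
      have h2 : y d ≠ b := fun h => hdb (y.injective (h.trans yb.symm))
      simp [swap_apply_of_ne_of_ne hda hdb, swap_apply_of_ne_of_ne h1 h2]
  have h1 := cyc_le_mul_swap x a b
  have h2 := cyc_le_mul_swap y a b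
  have hle : orbSetoid x y ≤ orbSetoid (x * swap a b) (y * swap a b) := by
    refine orb_le (fun d => ?_) (fun d => ?_)
    · by_cases hda : d = a
      · subst hda; rw [xa]
      by_cases hdb : d = b
      · subst hdb; rw [xb]
      have := orb_left (x * swap a b) (y * swap a b) d
      rwa [Perm.mul_apply, swap_apply_of_ne_of_ne hda hdb] at this
    · by_cases hda : d = a
      · subst hda; rw [ya]
      by_cases hdb : d = b
      · subst hdb; rw [yb]
      have := orb_right (x * swap a b) (y * swap a b) d
      rwa [Perm.mul_apply, swap_apply_of_ne_of_ne hda hdb] at this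
  have hT : orbSetoid (x * swap a b) (y * swap a b) a b := by
    have := orb_left (x * swap a b) (y * swap a b) a
    rwa [Perm.mul_apply, swap_apply_left, xb] at this
  have hS : ¬ orbSetoid x y a b := by
    refine not_orb_of_invariant (fun d => d = a) (fun d => ?_) (fun d => ?_) rfl hab.symm
    · exact ⟨fun h => x.injective (h.trans xa.symm), fun h => by rw [h, xa]⟩
    · exact ⟨fun h => y.injective (h.trans ya.symm), fun h => by rw [h, ya]⟩
  have h3 := numClasses_lt hle hT hS
  unfold Planar at *
  rw [e]
  omega

lemma numClasses_le_card {X : Type} [Fintype X] (f : D → X) {S : Setoid D}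
    (h : ∀ a b, f a = f b → S a b) : numClasses S ≤ Fintype.card X := by
  classical
  rw [← Nat.card_eq_fintype_card]
  refine Nat.card_le_card_of_injective (fun q : Quotient S => f q.out) ?_
  intro q q' hq
  have := Quotient.sound (s := S) (h _ _ hq)
  simpa using this

lemma numClasses_subtype (S : Setoid D) (A : D → Prop) [DecidablePred A]
    (hA : ∀ a b, S a b → (A a ↔ A b)) :
    numClasses S = numClasses (S.comap (Subtype.val : {a // A a} → D)) +
      numClasses (S.comap (Subtype.val : {a // ¬ A a} → D)) := by
  unfold numClasses
  rw [← Nat.card_sum]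
  symm
  refine Nat.card_congr (Equiv.ofBijective (Sum.elim
    (Quotient.lift (fun a => Quotient.mk S a.1) (fun a b h => Quotient.sound h))
    (Quotient.lift (fun a => Quotient.mk S a.1) (fun a b h => Quotient.sound h))) ⟨?_, ?_⟩)
  · rintro (q | q) (q' | q') h
    · induction q using Quotient.inductionOn
      induction q' using Quotient.inductionOn
      exact congrArg Sum.inl (Quotient.sound (Quotient.exact (s := S) h))
    · induction q using Quotient.inductionOn with | h a =>
      induction q' using Quotient.inductionOn with | h b =>
      exact absurd ((hA _ _ (Quotient.exact h)).1 a.2) b.2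
    · induction q using Quotient.inductionOn with | h a =>
      induction q' using Quotient.inductionOn with | h b =>
      exact absurd ((hA _ _ (Quotient.exact h)).2 b.2) a.2
    · induction q using Quotient.inductionOn
      induction q' using Quotient.inductionOn
      exact congrArg Sum.inr (Quotient.sound (Quotient.exact (s := S) h))
  · intro q
    induction q using Quotient.inductionOn with | h a =>
    by_cases ha : A a
    · exact ⟨Sum.inl (Quotient.mk _ ⟨a, ha⟩), rfl⟩
    · exact ⟨Sum.inr (Quotient.mk _ ⟨a, ha⟩), rfl⟩

lemma cyc_subtype (π : Perm D) (A : D → Prop) [DecidablePred A] (hA : ∀ d, A (π d) ↔ A d) :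
    cyc π = cyc (π.subtypePerm hA) +
      cyc (π.subtypePerm (p := fun d => ¬ A d) (fun d => not_congr (hA d))) := by
  unfold cyc
  have hs : ∀ a b, Perm.SameCycle.setoid π a b → (A a ↔ A b) := by
    intro a b h
    have h2 : Perm.SameCycle.setoid π ≤ Setoid.ker A :=
      sameCycle_setoid_le (fun d => by rw [Setoid.ker_def, hA])
    have := h2 h
    rw [Setoid.ker_def] at this
    rw [this]
  rw [numClasses_subtype _ A hs]
  congr 2
  · ext a b
    exact (Perm.sameCycle_subtypePerm).symm
  · ext a b
    exact (Perm.sameCycle_subtypePerm).symm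

lemma cyc_one : cyc (1 : Perm D) = Fintype.card D := by
  unfold cyc numClasses
  rw [← Nat.card_eq_fintype_card]
  refine (Nat.card_congr (Equiv.ofBijective (Quotient.mk _) ⟨fun a b h => ?_,
    Quotient.mk_surjective⟩)).symm
  have := Quotient.exact h
  exact Perm.sameCycle_one.1 this

/-- Euler's inequality on the part of a map where `x * y` may act nontrivially. -/
lemma planar_restrict {x y : Perm D} (hP : Planar x y) (A : D → Prop) [DecidablePred A]
    (hx : ∀ d, A (x d) ↔ A d) (hy : ∀ d, A (y d) ↔ A d) (hxy : ∀ d, ¬ A d → x (y d) = d)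
    (hne : ∃ d, A d) :
    Fintype.card {d // A d} + 2 ≤ cyc (x.subtypePerm hx) + cyc (y.subtypePerm hy) +
      cyc (x.subtypePerm hx * y.subtypePerm hy) := by
  have hxy' : ∀ d, A ((x * y) d) ↔ A d := fun d => (hx _).trans (hy d)
  have h1 := cyc_subtype x A hx
  have h2 := cyc_subtype y A hy
  have h3 := cyc_subtype (x * y) A hxy'
  have e1 : (x * y).subtypePerm (p := fun d => ¬ A d) (fun d => not_congr (hxy' d)) = 1 := by
    ext d
    exact hxy d d.2
  have e2 : x.subtypePerm (p := fun d => ¬ A d) (fun d => not_congr (hx d)) =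
      (y.subtypePerm (p := fun d => ¬ A d) (fun d => not_congr (hy d)))⁻¹ := by
    rw [eq_inv_iff_mul_eq_one]
    ext d
    exact hxy d d.2
  rw [e1, cyc_one] at h3
  rw [e2, cyc_inv] at h1
  have e3 : (x * y).subtypePerm hxy' = x.subtypePerm hx * y.subtypePerm hy := rfl
  rw [e3] at h3
  have h4 : Fintype.card D = Fintype.card {d // A d} + Fintype.card {d // ¬ A d} := by
    rw [← Fintype.card_sum]
    exact Fintype.card_congr (Equiv.sumCompl A).symm
  set y' := y.subtypePerm (p := fun d => ¬ A d) (fun d => not_congr (hy d)) with hy'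
  let S : Setoid D := ⟨fun a b => (A a ∧ A b) ∨ (¬ A a ∧ ¬ A b ∧ y.SameCycle a b), by
    refine ⟨fun a => ?_, fun {a b} h => ?_, fun {a b c} h h' => ?_⟩
    · by_cases ha : A a
      · exact Or.inl ⟨ha, ha⟩
      · exact Or.inr ⟨ha, ha, Perm.SameCycle.refl _ _⟩
    · rcases h with h | h
      · exact Or.inl h.symm
      · exact Or.inr ⟨h.2.1, h.1, h.2.2.symm⟩
    · rcases h with h | h <;> rcases h' with h' | h'
      · exact Or.inl ⟨h.1, h'.2⟩
      · exact absurd h.2 h'.1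
      · exact absurd h'.1 h.2.1
      · exact Or.inr ⟨h.1, h'.2.1, h.2.2.trans h'.2.2⟩⟩
  have hS : orbSetoid x y ≤ S := by
    refine orb_le (fun d => ?_) (fun d => ?_)
    · by_cases ha : A d
      · exact Or.inl ⟨ha, (hx d).2 ha⟩
      · refine Or.inr ⟨ha, fun h => ha ((hx d).1 h), ⟨-1, ?_⟩⟩
        have : y (x d) = d := by
          have := hxy (x d) (fun h => ha ((hx d).1 h))
          exact x.injective this
        rw [zpow_neg_one, Perm.inv_eq_iff_eq, this]
    · by_cases ha : A d
      · exact Or.inl ⟨ha, (hy d).2 ha⟩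
      · exact Or.inr ⟨ha, fun h => ha ((hy d).1 h), ⟨1, by simp⟩⟩
  have h5 := numClasses_anti hS
  have h6 := numClasses_subtype S A (by
    rintro a b (h | h)
    · exact iff_of_true h.1 h.2
    · exact iff_of_false h.1 h.2.1)
  have h7 : 1 ≤ numClasses (S.comap (Subtype.val : {a // A a} → D)) := by
    obtain ⟨d, hd⟩ := hne
    have : Nonempty (Quotient (S.comap (Subtype.val : {a // A a} → D))) := ⟨Quotient.mk _ ⟨d, hd⟩⟩
    exact Nat.card_pos
  have h8 : numClasses (S.comap (Subtype.val : {a // ¬ A a} → D)) = cyc y' := by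
    unfold cyc
    congr 1
    ext a b
    constructor
    · rintro (h | h)
      · exact absurd h.1 a.2
      · exact Perm.sameCycle_subtypePerm.2 h.2.2
    · intro h
      exact Or.inr ⟨a.2, b.2, Perm.sameCycle_subtypePerm.1 h⟩
  unfold Planar at hP
  omega

lemma two_mul_cyc_le {α : Perm D} (h : ∀ d, α d ≠ d) : 2 * cyc α ≤ Fintype.card D := by
  classical
  unfold cyc numClasses
  rw [Nat.card_eq_fintype_card, mul_comm, ← smul_eq_mul, ← Finset.card_univ, ← Finset.card_univ,
    Finset.card_eq_sum_card_fiberwise (f := Quotient.mk (Perm.SameCycle.setoid α))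
    (t := Finset.univ) (fun _ _ => Finset.mem_univ _)]
  refine Finset.card_nsmul_le_sum _ _ _ (fun q _ => ?_)
  induction q using Quotient.inductionOn with | h d =>
  have : ({d, α d} : Finset D) ⊆ Finset.univ.filter
      (fun e => Quotient.mk (Perm.SameCycle.setoid α) e = Quotient.mk _ d) := by
    intro e he
    rw [Finset.mem_filter]
    refine ⟨Finset.mem_univ _, Quotient.sound ?_⟩
    simp only [Finset.mem_insert, Finset.mem_singleton] at he
    rcases he with rfl | rfl
    · exact (Perm.SameCycle.setoid α).refl _
    · exact (Perm.SameCycle.setoid α).symm (sameCycle_setoid_apply α d)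
  have h2 := Finset.card_le_card this
  rwa [Finset.card_pair (h d).symm] at h2

/-- Counting cycles of a permutation without fixed points and three-cycles. -/
lemma four_mul_cyc_le {ν : Perm D} (h1 : ∀ d, ν d ≠ d) (h3 : ∀ d, ν (ν (ν d)) ≠ d) :
    4 * cyc ν + (Finset.univ.filter (fun d => ν (ν d) ≠ d)).card ≤ 2 * Fintype.card D ∧
    ((∃ d, ν (ν d) ≠ d ∧ ν (ν (ν (ν d))) ≠ d) →
      4 * cyc ν + (Finset.univ.filter (fun d => ν (ν d) ≠ d)).card < 2 * Fintype.card D) := by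
  classical
  set S := Perm.SameCycle.setoid ν with hS
  have i1 : ∀ d, Quotient.mk S (ν d) = Quotient.mk S d := fun d =>
    Quotient.sound (S.symm (sameCycle_setoid_apply ν d))
  have hbig : ∀ a b, S a b → (ν (ν a) ≠ a ↔ ν (ν b) ≠ b) := by
    intro a b h
    have : S ≤ Setoid.ker (fun d => ν (ν d) ≠ d) :=
      sameCycle_setoid_le (fun d => by rw [Setoid.ker_def]; simp)
    have := this h
    rw [Setoid.ker_def] at this
    rw [this]
  let f : Quotient S → ℕ := fun q => (Finset.univ.filter (fun e => Quotient.mk S e = q)).card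
  let g : Quotient S → ℕ := fun q =>
    ((Finset.univ.filter (fun d => ν (ν d) ≠ d)).filter (fun e => Quotient.mk S e = q)).card
  have ef : Fintype.card D = ∑ q, f q := by
    rw [← Finset.card_univ, Finset.card_eq_sum_card_fiberwise (f := Quotient.mk S)
      (t := Finset.univ) (fun _ _ => Finset.mem_univ _)]
  have eg : (Finset.univ.filter (fun d => ν (ν d) ≠ d)).card = ∑ q, g q := by
    rw [Finset.card_eq_sum_card_fiberwise (f := Quotient.mk S)
      (t := Finset.univ) (fun _ _ => Finset.mem_univ _)]
  have ec : 4 * cyc ν = ∑ q : Quotient S, 4 := by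
    unfold cyc numClasses
    rw [Nat.card_eq_fintype_card, Finset.sum_const, Finset.card_univ, smul_eq_mul, mul_comm]
  have hgf : ∀ q, g q ≤ f q := fun q =>
    Finset.card_le_card (Finset.filter_subset_filter _ (Finset.filter_subset _ _))
  have hsub : ∀ (d : D) (s : Finset D), (∀ e ∈ s, Quotient.mk S e = Quotient.mk S d) →
      s.card ≤ f (Quotient.mk S d) := fun d s hs => Finset.card_le_card (fun e he => by
    rw [Finset.mem_filter]; exact ⟨Finset.mem_univ _, hs e he⟩)
  have key : ∀ d, 4 + g (Quotient.mk S d) ≤ 2 * f (Quotient.mk S d) ∧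
      (ν (ν d) ≠ d → ν (ν (ν (ν d))) ≠ d → 4 + g (Quotient.mk S d) < 2 * f (Quotient.mk S d)) := by
    intro d
    have hd := hgf (Quotient.mk S d)
    by_cases hb : ν (ν d) = d
    · refine ⟨?_, fun h => absurd hb h⟩
      have : g (Quotient.mk S d) = 0 := by
        rw [Finset.card_eq_zero, Finset.filter_eq_empty_iff]
        intro e he he2
        rw [Finset.mem_filter] at he
        exact (hbig e d (Quotient.exact he2)).1 he.2 hb
      have h2 := hsub d {d, ν d} (by simp [i1])
      rw [Finset.card_pair (h1 d).symm] at h2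
      omega
    · have n12 : d ≠ ν d := (h1 d).symm
      have n13 : d ≠ ν (ν d) := fun h => hb h.symm
      have n14 : d ≠ ν (ν (ν d)) := (h3 d).symm
      have n23 : ν d ≠ ν (ν d) := fun h => n12 (ν.injective h)
      have n24 : ν d ≠ ν (ν (ν d)) := fun h => n13 (ν.injective h)
      have n34 : ν (ν d) ≠ ν (ν (ν d)) := fun h => n23 (ν.injective h)
      constructor
      · have h2 := hsub d {d, ν d, ν (ν d), ν (ν (ν d))} (by simp [i1])
        have : ({d, ν d, ν (ν d), ν (ν (ν d))} : Finset D).card = 4 := by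
          rw [Finset.card_insert_of_notMem (by simp [*]), Finset.card_insert_of_notMem (by simp [*]),
            Finset.card_pair n34]
        omega
      · intro _ h4
        have n15 := h4.symm
        have n25 : ν d ≠ ν (ν (ν (ν d))) := fun h => n14 (ν.injective h)
        have n35 : ν (ν d) ≠ ν (ν (ν (ν d))) := fun h => n24 (ν.injective h)
        have n45 : ν (ν (ν d)) ≠ ν (ν (ν (ν d))) := fun h => n34 (ν.injective h)
        have h2 := hsub d {d, ν d, ν (ν d), ν (ν (ν d)), ν (ν (ν (ν d)))} (by simp [i1])
        have : ({d, ν d, ν (ν d), ν (ν (ν d)), ν (ν (ν (ν d)))} : Finset D).card = 5 := by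
          rw [Finset.card_insert_of_notMem (by simp [n12, n13, n14, n15]),
            Finset.card_insert_of_notMem (by simp [n23, n24, n25]),
            Finset.card_insert_of_notMem (by simp [n34, n35]), Finset.card_pair n45]
        omega
  rw [ec, ef, eg, ← Finset.sum_add_distrib, Finset.mul_sum]
  constructor
  · refine Finset.sum_le_sum (fun q _ => ?_)
    induction q using Quotient.inductionOn with | h d => exact (key d).1
  · rintro ⟨d, hd, hd'⟩
    refine Finset.sum_lt_sum (fun q _ => ?_) ⟨Quotient.mk S d, Finset.mem_univ _, (key d).2 hd hd'⟩
    induction q using Quotient.inductionOn with | h d => exact (key d).1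

end Genus
end Heckoid

namespace Heckoid
open Equiv List

/-- The inverse letter. -/
def flipLetter (x : Fin 2 × Bool) : Fin 2 × Bool := (x.1, !x.2)

lemma flipLetter_flipLetter (x : Fin 2 × Bool) : flipLetter (flipLetter x) = x := by
  simp [flipLetter]

lemma flipLetter_ne (x : Fin 2 × Bool) : flipLetter x ≠ x := by
  obtain ⟨a, b⟩ := x
  cases b <;> simp [flipLetter]

/-- `l` is read along a cycle of `φ`. -/
def FaceCyc {D : Type} (φ : Perm D) (l : List D) : Prop := l.map φ = l.rotate 1

/-- A planar diagram with darts `D` and faces `fs`, whose boundary labels are read by `ℓ`; darts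
outside the faces are dead. -/
structure Diag {D : Type} [Fintype D] [DecidableEq D] (φ α : Perm D) (ℓ : D → Fin 2 × Bool)
    (fs : List (List D)) : Prop where
  nodup : fs.flatten.Nodup
  face : ∀ l ∈ fs, FaceCyc φ l
  dead : ∀ d, d ∉ fs.flatten → φ d = α d
  invol : ∀ d, α (α d) = d
  flip : ∀ d ∈ fs.flatten, ℓ (α d) = flipLetter (ℓ d)
  planar : Planar α φ

/-- The words `ws` are the boundary labels of the faces of some planar diagram. -/
def Sph (ws : List (List (Fin 2 × Bool))) : Prop :=
  ∃ (D : Type) (_ : Fintype D) (_ : DecidableEq D) (φ α : Perm D) (ℓ : D → Fin 2 × Bool)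
    (fs : List (List D)), Diag φ α ℓ fs ∧ fs.map (List.map ℓ) = ws

section FaceCyc
variable {D : Type} {φ φ' : Perm D}

lemma faceCyc_nil : FaceCyc φ [] := rfl

lemma faceCyc_cons {d : D} {t : List D} : FaceCyc φ (d :: t) ↔ (d :: t).map φ = t ++ [d] := by
  unfold FaceCyc
  rw [rotate_cons_succ, rotate_zero]

lemma FaceCyc.rotate {l : List D} (h : FaceCyc φ l) (k : ℕ) : FaceCyc φ (l.rotate k) := by
  unfold FaceCyc at *
  rw [List.map_rotate, h, List.rotate_rotate, List.rotate_rotate, add_comm]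

lemma FaceCyc.congr {l : List D} (h : FaceCyc φ l) (hφ : ∀ d ∈ l, φ' d = φ d) :
    FaceCyc φ' l := by
  unfold FaceCyc at *
  rw [← h]
  exact List.map_congr_left hφ

lemma FaceCyc.mem {l : List D} (h : FaceCyc φ l) {d : D} (hd : d ∈ l) : φ d ∈ l := by
  have := List.mem_map_of_mem (f := φ) hd
  rw [h] at this
  exact List.mem_rotate.1 this

lemma FaceCyc.mem_iff {l : List D} (h : FaceCyc φ l) {d : D} : φ d ∈ l ↔ d ∈ l := by
  refine ⟨fun hd => ?_, h.mem⟩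
  have : φ d ∈ l.map φ := by rw [h]; exact List.mem_rotate.2 hd
  obtain ⟨e, he, hed⟩ := List.mem_map.1 this
  rwa [φ.injective hed] at he

lemma FaceCyc.getElem {l : List D} (h : FaceCyc φ l) (i : ℕ) (hi : i < l.length) :
    φ l[i] = l[(i + 1) % l.length]'(Nat.mod_lt _ (by omega)) := by
  have h1 : (l.map φ)[i]'(by simpa) = (l.rotate 1)[i]'(by simpa) := by
    simp only [show l.map φ = l.rotate 1 from h]
  rw [List.getElem_map, List.getElem_rotate] at h1
  exact h1

lemma FaceCyc.pow_getElem {l : List D} (h : FaceCyc φ l) (hl : 0 < l.length) (i : ℕ) :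
    (φ ^ i) (l[0]) = l[i % l.length]'(Nat.mod_lt _ hl) := by
  induction i with
  | zero => simp
  | succ i ih =>
    rw [pow_succ', Perm.mul_apply, ih, h.getElem]
    congr 1
    rw [Nat.mod_add_mod]

lemma FaceCyc.sameCycle {l : List D} (h : FaceCyc φ l) {a b : D} (ha : a ∈ l) (hb : b ∈ l) :
    φ.SameCycle a b := by
  have key : ∀ c ∈ l, ∃ hl : 0 < l.length, φ.SameCycle l[0] c := by
    intro c hc
    obtain ⟨i, hi, rfl⟩ := List.getElem_of_mem hc
    refine ⟨by omega, ⟨i, ?_⟩⟩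
    rw [zpow_natCast, h.pow_getElem (by omega)]
    congr 1
    exact Nat.mod_eq_of_lt hi
  obtain ⟨_, h1⟩ := key a ha
  obtain ⟨_, h2⟩ := key b hb
  exact h1.symm.trans h2

lemma FaceCyc.not_sameCycle [Finite D] {l : List D} (h : FaceCyc φ l) {a b : D} (ha : a ∈ l)
    (hb : b ∉ l) : ¬ φ.SameCycle a b := by
  intro hs
  obtain ⟨n, rfl⟩ := hs.exists_nat_pow_eq
  refine hb ?_
  clear hs hb
  induction n with
  | zero => exact ha
  | succ n ih => rw [pow_succ', Perm.mul_apply]; exact h.mem ih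

lemma FaceCyc.snoc_cons {d e : D} {t u : List D} (h : FaceCyc φ (d :: t)) (hu : d :: t = u ++ [e]) :
    u.map φ = t ∧ φ e = d := by
  rw [faceCyc_cons, hu, List.map_append] at h
  exact ⟨(List.append_inj' h rfl).1, by simpa using (List.append_inj' h rfl).2⟩

lemma faceCyc_of_snoc_cons {d e : D} {t u : List D} (hu : d :: t = u ++ [e]) (h1 : u.map φ = t)
    (h2 : φ e = d) : FaceCyc φ (d :: t) := by
  rw [faceCyc_cons, hu, List.map_append, h1]
  simp [h2]

end FaceCyc

lemma perm_exists_map {α β : Type} (f : α → β) {l : List α} {m : List β} (h : (l.map f).Perm m) :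
    ∃ l', l.Perm l' ∧ l'.map f = m := by
  generalize hl : l.map f = k at h
  induction h generalizing l with
  | nil => exact ⟨l, Perm.refl _, hl⟩
  | cons x h ih =>
    obtain ⟨a, t, rfl, rfl, rfl⟩ := List.map_eq_cons_iff.1 hl
    obtain ⟨l', h1, rfl⟩ := ih rfl
    exact ⟨a :: l', h1.cons a, rfl⟩
  | swap x y t =>
    obtain ⟨a, t, rfl, rfl, ht⟩ := List.map_eq_cons_iff.1 hl
    obtain ⟨b, t, rfl, rfl, rfl⟩ := List.map_eq_cons_iff.1 ht
    exact ⟨b :: a :: t, Perm.swap _ _ _, rfl⟩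
  | trans _ _ ih1 ih2 =>
    obtain ⟨l1, p1, e1⟩ := ih1 hl
    obtain ⟨l2, p2, e2⟩ := ih2 e1
    exact ⟨l2, p1.trans p2, e2⟩

lemma nodup_two_blocks {D : Type} {u v r : List D} {a b : D}
    (h : (u ++ [a] ++ (v ++ [b] ++ r)).Nodup) :
    (a ∉ u ∧ a ∉ v ∧ a ∉ r) ∧ (b ∉ u ∧ b ∉ v ∧ b ∉ r) ∧ a ≠ b := by
  simp only [List.nodup_append, List.mem_append, List.mem_singleton, List.nodup_singleton] at h
  grind

lemma nodup_two_pointed_blocks {D : Type} {u v r : List D} {d c e e' : D}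
    (h : (d :: (u ++ [e]) ++ (c :: (v ++ [e']) ++ r)).Nodup) :
    (d ∉ u ∧ d ∉ v ∧ d ∉ r ∧ c ∉ u ∧ c ∉ v ∧ c ∉ r) ∧ (e ∉ u ∧ e ∉ v ∧ e ∉ r) ∧
      (e' ∉ u ∧ e' ∉ v ∧ e' ∉ r) ∧ d ≠ e ∧ d ≠ c ∧ d ≠ e' ∧ e ≠ c ∧ e ≠ e' ∧ c ≠ e' := by
  simp only [List.cons_append, List.nodup_cons, List.nodup_append, List.mem_append,
    List.mem_cons] at h
  grind

section Diag
variable {D : Type} [Fintype D] [DecidableEq D] {φ α : Perm D} {ℓ : D → Fin 2 × Bool}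
  {fs fs' : List (List D)}

lemma Diag.congr (h : Diag φ α ℓ fs) (hp : fs.flatten.Perm fs'.flatten)
    (hf : ∀ l ∈ fs', FaceCyc φ l) : Diag φ α ℓ fs' where
  nodup := hp.nodup_iff.1 h.nodup
  face := hf
  dead d hd := h.dead d (fun hc => hd (hp.mem_iff.1 hc))
  invol := h.invol
  flip d hd := h.flip d (hp.mem_iff.2 hd)
  planar := h.planar

lemma Diag.α_ne (h : Diag φ α ℓ fs) {d : D} (hd : d ∈ fs.flatten) : α d ≠ d := fun hc => by
  have := h.flip d hd
  rw [hc] at this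
  exact flipLetter_ne _ this.symm

lemma Diag.mem_iff (h : Diag φ α ℓ fs) (d : D) : φ d ∈ fs.flatten ↔ d ∈ fs.flatten := by
  simp only [List.mem_flatten]
  constructor
  · rintro ⟨l, hl, hd⟩
    exact ⟨l, hl, (h.face l hl).mem_iff.1 hd⟩
  · rintro ⟨l, hl, hd⟩
    exact ⟨l, hl, (h.face l hl).mem hd⟩

lemma Diag.α_mem (h : Diag φ α ℓ fs) {d : D} (hd : d ∈ fs.flatten) : α d ∈ fs.flatten := by
  by_contra hc
  have := h.dead _ hc
  rw [h.invol] at this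
  rw [← h.mem_iff, this] at hc
  exact hc hd

lemma Diag.α_mem_iff (h : Diag φ α ℓ fs) (d : D) : α d ∈ fs.flatten ↔ d ∈ fs.flatten :=
  ⟨fun hd => by have := h.α_mem hd; rwa [h.invol] at this, h.α_mem⟩

lemma Diag.split {u v : List D} (hu : u ≠ []) (hv : v ≠ []) (h : Diag φ α ℓ ((u ++ v) :: fs)) :
    ∃ φ' : Perm D, Diag φ' α ℓ (u :: v :: fs) := by
  obtain ⟨x, u1, rfl⟩ := List.exists_cons_of_ne_nil hu
  obtain ⟨y, v1, rfl⟩ := List.exists_cons_of_ne_nil hv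
  obtain ⟨u', a, hu'⟩ : ∃ u' a, x :: u1 = u' ++ [a] :=
    ⟨_, _, (List.dropLast_append_getLast hu).symm⟩
  obtain ⟨v', b, hv'⟩ : ∃ v' a, y :: v1 = v' ++ [a] :=
    ⟨_, _, (List.dropLast_append_getLast hv).symm⟩
  have hnd := h.nodup
  rw [List.flatten_cons, List.append_assoc, hu', hv'] at hnd
  obtain ⟨⟨n1, n2, n3⟩, ⟨n4, n5, n6⟩, hneab⟩ := nodup_two_blocks (by simpa using hnd)
  have hface := h.face _ (List.mem_cons_self ..)
  have hface' := hface
  unfold FaceCyc at hface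
  rw [List.cons_append, rotate_cons_succ, rotate_zero, ← List.cons_append, hu', List.map_append,
    List.map_append, hv', List.map_append] at hface
  have hlen : u'.length = u1.length := by
    have := congrArg List.length hu'; simpa using this.symm
  have hlen2 : v'.length = v1.length := by
    have := congrArg List.length hv'; simpa using this.symm
  rw [← hv', show u1 ++ y :: v1 ++ [x] = u1 ++ [y] ++ (v1 ++ [x]) by simp] at hface
  obtain ⟨e1, e2⟩ := List.append_inj hface (by simp [hlen])
  obtain ⟨f1, f2⟩ := List.append_inj' e1 rfl
  obtain ⟨f3, f4⟩ := List.append_inj' e2 rfl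
  have f2 : φ a = y := by simpa using f2
  have f4 : φ b = x := by simpa using f4
  have hab : ∀ d ∈ u' ++ v' ++ fs.flatten, (φ * swap a b) d = φ d := by
    intro d hd
    rw [List.mem_append, List.mem_append] at hd
    rw [Perm.mul_apply, swap_apply_of_ne_of_ne]
    · rintro rfl; exact hd.elim (fun hd => hd.elim n1 n2) n3
    · rintro rfl; exact hd.elim (fun hd => hd.elim n4 n5) n6
  have hfu : FaceCyc (φ * swap a b) (x :: u1) := by
    refine faceCyc_of_snoc_cons hu' ?_ (by simp [f4])
    rw [← f1]
    exact List.map_congr_left (fun d hd => hab d (by simp [hd]))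
  have hfv : FaceCyc (φ * swap a b) (y :: v1) := by
    refine faceCyc_of_snoc_cons hv' ?_ (by simp [f2])
    rw [← f3]
    exact List.map_congr_left (fun d hd => hab d (by simp [hd]))
  have ha : a ∈ x :: u1 := by rw [hu']; simp
  have hb : b ∈ y :: v1 := by rw [hv']; simp
  have hb' : b ∉ x :: u1 := by rw [hu']; simp [n4, Ne.symm hneab]
  refine ⟨φ * swap a b, ?_, ?_, ?_, h.invol, ?_, ?_⟩
  · have := h.nodup; simpa using this
  · intro l hl
    rw [List.mem_cons, List.mem_cons] at hl
    rcases hl with rfl | rfl | hl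
    · exact hfu
    · exact hfv
    · refine (h.face l (by simp [hl])).congr (fun d hd => hab d ?_)
      simp only [List.mem_append, List.mem_flatten]
      exact Or.inr ⟨l, hl, hd⟩
  · intro d hd
    rw [← h.dead d (by simpa using hd), Perm.mul_apply, swap_apply_of_ne_of_ne]
    · rintro rfl; exact hd (by simp only [List.flatten_cons, List.mem_append]; exact Or.inl ha)
    · rintro rfl; exact hd (by simp only [List.flatten_cons, List.mem_append]; exact Or.inr (Or.inl hb))
  · intro d hd
    exact h.flip d (by simpa using hd)
  · exact planar_split h.planar (hface'.sameCycle (by simp only [List.mem_append]; exact Or.inl ha)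
      (by simp only [List.mem_append]; exact Or.inr hb)) (hfu.not_sameCycle ha hb')

lemma Diag.collapse {d1 d2 : D} (h : Diag φ α ℓ ([d1, d2] :: fs))
    (hl : ℓ d2 = flipLetter (ℓ d1)) : ∃ α' : Perm D, Diag φ α' ℓ fs := by
  have hf := h.face _ (List.mem_cons_self ..)
  rw [faceCyc_cons] at hf
  have p1 : φ d1 = d2 := by simpa using congrArg List.head? hf
  have p2 : φ d2 = d1 := by simpa using congrArg List.getLast? hf
  have hnd := h.nodup
  simp only [List.flatten_cons, List.cons_append, List.nil_append, List.nodup_cons,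
    List.mem_cons, not_or] at hnd
  obtain ⟨⟨n1, n2⟩, n3, hnd⟩ := hnd
  have m1 : d1 ∈ ([d1, d2] :: fs).flatten := by simp
  have m2 : d2 ∈ ([d1, d2] :: fs).flatten := by simp
  have a1 := h.α_ne m1
  have a2 := h.α_ne m2
  have i1 := h.invol d1
  have i2 := h.invol d2
  have ff : ∀ l ∈ fs, FaceCyc φ l := fun l hl => h.face l (by simp [hl])
  by_cases hx : α d1 = d2
  · refine ⟨α, hnd, ff, ?_, h.invol, fun d hd => h.flip d (by simp [hd]), h.planar⟩
    intro d hd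
    by_cases e1 : d = d1
    · rw [e1, p1, hx]
    by_cases e2 : d = d2
    · rw [e2, p2, ← hx, i1]
    exact h.dead d (by simp [hd, e1, e2])
  · have hy : α d2 ≠ d1 := fun hc => hx (by rw [← hc, i2])
    have hxy : α d1 ≠ α d2 := fun hc => n1 (α.injective hc)
    have v1 : (α * swap (α d1) d2 * swap (α d2) d1) (α d1) = α d2 := by
      simp [Perm.mul_apply, swap_apply_of_ne_of_ne hxy a1]
    have v2 : (α * swap (α d1) d2 * swap (α d2) d1) (α d2) = α d1 := by
      simp [Perm.mul_apply, swap_apply_of_ne_of_ne (Ne.symm a1) n1]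
    have v3 : (α * swap (α d1) d2 * swap (α d2) d1) d1 = d2 := by
      simp [Perm.mul_apply, swap_apply_of_ne_of_ne (Ne.symm hxy) a2, i2]
    have v4 : (α * swap (α d1) d2 * swap (α d2) d1) d2 = d1 := by
      simp [Perm.mul_apply, swap_apply_of_ne_of_ne (Ne.symm a2) (Ne.symm n1), i1]
    have v5 : ∀ d, d ≠ d1 → d ≠ d2 → d ≠ α d1 → d ≠ α d2 →
        (α * swap (α d1) d2 * swap (α d2) d1) d = α d := by
      intro d e1 e2 e3 e4
      rw [Perm.mul_apply, swap_apply_of_ne_of_ne e4 e1, Perm.mul_apply,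
        swap_apply_of_ne_of_ne e3 e2]
    have pl : Planar (α * swap (α d1) d2 * swap (α d2) d1) φ := by
      have q1 := planar_detach_left (a := φ⁻¹ (α d1)) (b := d1) h.planar
        (by rw [perm_apply_inv, i1]) (fun hc => hx (by
          have := perm_apply_inv φ (α d1)
          rw [hc, p1] at this
          exact this.symm))
      rw [perm_apply_inv, p1] at q1
      have q2 := planar_detach_left (a := φ⁻¹ (α d2)) (b := d2) q1
        (by rw [perm_apply_inv, Perm.mul_apply, swap_apply_of_ne_of_ne (Ne.symm hxy) a2, i2])
        (fun hc => hy (by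
          have := perm_apply_inv φ (α d2)
          rw [hc, p2] at this
          exact this.symm))
      rwa [perm_apply_inv, p2] at q2
    refine ⟨α * swap (α d1) d2 * swap (α d2) d1, hnd, ff, ?_, ?_, ?_, pl⟩
    · intro d hd
      by_cases e1 : d = d1
      · rw [e1, p1, v3]
      by_cases e2 : d = d2
      · rw [e2, p2, v4]
      have hd' : d ∉ ([d1, d2] :: fs).flatten := by simp [hd, e1, e2]
      rw [h.dead d hd', v5 d e1 e2 (fun hc => hd' (by rw [hc]; exact h.α_mem m1))
        (fun hc => hd' (by rw [hc]; exact h.α_mem m2))]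
    · intro d
      by_cases e1 : d = d1
      · rw [e1, v3, v4]
      by_cases e2 : d = d2
      · rw [e2, v4, v3]
      by_cases e3 : d = α d1
      · rw [e3, v1, v2]
      by_cases e4 : d = α d2
      · rw [e4, v2, v1]
      rw [v5 d e1 e2 e3 e4, v5, h.invol]
      · exact fun hc => e3 (by rw [← hc, h.invol])
      · exact fun hc => e4 (by rw [← hc, h.invol])
      · exact fun hc => e1 (α.injective hc)
      · exact fun hc => e2 (α.injective hc)
    · intro d hd
      have e1 : d ≠ d1 := fun hc => n2 (hc ▸ hd)
      have e2 : d ≠ d2 := fun hc => n3 (hc ▸ hd)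
      have f1 := h.flip d1 m1
      have f2 := h.flip d2 m2
      by_cases e3 : d = α d1
      · rw [e3, v1, f2, hl, f1]
      by_cases e4 : d = α d2
      · rw [e4, v2, f1, f2, hl, flipLetter_flipLetter]
      rw [v5 d e1 e2 e3 e4]
      exact h.flip d (by simp [hd])

lemma Diag.merge {d : D} {t t' : List D} (ht : t ≠ []) (ht' : t' ≠ [])
    (h : Diag φ α ℓ ((d :: t) :: (α d :: t') :: fs)) :
    ∃ φ' : Perm D, Diag φ' α ℓ ((t ++ t') :: fs) := by
  obtain ⟨x, t1, rfl⟩ := List.exists_cons_of_ne_nil ht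
  obtain ⟨y, t1', rfl⟩ := List.exists_cons_of_ne_nil ht'
  obtain ⟨u, e, hu⟩ : ∃ u' a, x :: t1 = u' ++ [a] :=
    ⟨_, _, (List.dropLast_append_getLast ht).symm⟩
  obtain ⟨u', e', hu'⟩ : ∃ u' a, y :: t1' = u' ++ [a] :=
    ⟨_, _, (List.dropLast_append_getLast ht').symm⟩
  have hnd := h.nodup
  simp only [List.flatten_cons, hu, hu'] at hnd
  obtain ⟨g1, g2⟩ := (h.face _ (List.mem_cons_self ..)).snoc_cons (u := d :: u) (e := e)
    (by rw [hu]; rfl)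
  obtain ⟨g3, g4⟩ := (h.face (α d :: y :: t1') (by simp)).snoc_cons (u := α d :: u') (e := e')
    (by rw [hu']; rfl)
  rw [List.map_cons, List.cons.injEq] at g1 g3
  obtain ⟨gx, g1⟩ := g1
  obtain ⟨gy, g3⟩ := g3
  have hid := h.invol d
  obtain ⟨⟨r1, r2, r3, r4, r5, r6⟩, ⟨r7, r8, r9⟩, ⟨r10, r11, r12⟩,  q1, q2, q3, q4, q5, q6⟩ := nodup_two_pointed_blocks hnd
  have w5 : ∀ f, f ≠ e → f ≠ α d → f ≠ e' → f ≠ d → (φ * swap e (α d) * swap e' d) f = φ f := by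
    intro f e1 e2 e3 e4
    rw [Perm.mul_apply, swap_apply_of_ne_of_ne e3 e4, Perm.mul_apply,
        swap_apply_of_ne_of_ne e1 e2]
  have w1 : (φ * swap e (α d) * swap e' d) e = y := by
    simp [Perm.mul_apply, swap_apply_of_ne_of_ne q5 (Ne.symm q1), gy]
  have w2 : (φ * swap e (α d) * swap e' d) e' = x := by
    simp [Perm.mul_apply, swap_apply_of_ne_of_ne q1 q2, gx]
  have w3 : (φ * swap e (α d) * swap e' d) d = α d := by
    simp [Perm.mul_apply, swap_apply_of_ne_of_ne (Ne.symm q5) (Ne.symm q6), g4]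
  have w4 : (φ * swap e (α d) * swap e' d) (α d) = d := by
    simp [Perm.mul_apply, swap_apply_of_ne_of_ne q6 (Ne.symm q2), g2]
  have pl : Planar α (φ * swap e (α d) * swap e' d) := by
    refine planar_detach (planar_detach h.planar (by rw [g2]) q4) ?_ (Ne.symm q3)
    rw [Perm.mul_apply, swap_apply_of_ne_of_ne (Ne.symm q5) (Ne.symm q6), g4, hid]
  have hm : ∀ f, f ∉ (((x :: t1) ++ (y :: t1')) :: fs).flatten → f ≠ d → f ≠ α d →
      f ∉ ((d :: x :: t1) :: (α d :: y :: t1') :: fs).flatten := by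
    intro f hf hd1 hd2
    simp only [List.flatten_cons, List.mem_append, List.mem_cons, not_or] at hf ⊢
    grind
  have hm' : ∀ f ∈ (((x :: t1) ++ (y :: t1')) :: fs).flatten,
      f ∈ ((d :: x :: t1) :: (α d :: y :: t1') :: fs).flatten := by
    intro f hf
    simp only [List.flatten_cons, List.mem_append, List.mem_cons] at hf ⊢
    grind
  have he : e ∈ x :: t1 := by rw [hu]; simp
  have he' : e' ∈ y :: t1' := by rw [hu']; simp
  refine ⟨φ * swap e (α d) * swap e' d, ?_, ?_, ?_, h.invol, fun f hf => h.flip f (hm' f hf), pl⟩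
  · have := h.nodup
    simp only [List.flatten_cons, List.cons_append, List.append_assoc] at this ⊢
    have h2 := (List.nodup_cons.1 this).2
    refine h2.sublist ?_
    exact List.Sublist.cons_cons _ (List.Sublist.append_left (List.sublist_cons_self _ _) _)
  · intro l hl
    rcases List.mem_cons.1 hl with rfl | hl
    · rw [List.cons_append, faceCyc_cons, ← List.cons_append, hu, hu', List.map_append,
        List.map_append, List.map_append]
      have k1 : u.map (φ * swap e (α d) * swap e' d) = t1 := by
        rw [← g1]
        refine List.map_congr_left (fun f hf => w5 f ?_ ?_ ?_ ?_) <;> rintro rfl <;>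
          simp [List.nodup_append] at hnd <;> grind
      have k2 : u'.map (φ * swap e (α d) * swap e' d) = t1' := by
        rw [← g3]
        refine List.map_congr_left (fun f hf => w5 f ?_ ?_ ?_ ?_) <;> rintro rfl <;>
          simp [List.nodup_append] at hnd <;> grind
      rw [k1, k2, List.map_singleton, List.map_singleton, w1, w2, ← hu']
      simp
    · refine (h.face l (by simp [hl])).congr (fun f hf => ?_)
      have hff : f ∈ fs.flatten := List.mem_flatten.2 ⟨l, hl, hf⟩
      refine w5 f ?_ ?_ ?_ ?_ <;> rintro rfl <;>
          simp only [List.nodup_append, List.nodup_cons, List.mem_append, List.mem_cons] at hnd <;> grind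
  · intro f hf
    by_cases e1 : f = d
    · rw [e1, w3]
    by_cases e2 : f = α d
    · rw [e2, w4, hid]
    rw [w5 f _ e2 _ e1, h.dead f (hm f hf e1 e2)]
    · rintro rfl; exact hf (by simp only [List.flatten_cons, List.mem_append]; exact Or.inl (Or.inl he))
    · rintro rfl; exact hf (by simp only [List.flatten_cons, List.mem_append]; exact Or.inl (Or.inr he'))

end Diag
end Heckoid

namespace Heckoid
open Equiv List

section Insert
variable {D : Type} [Fintype D] [DecidableEq D] {φ α : Perm D} {ℓ : D → Fin 2 × Bool}
  {l : List D}

lemma Diag.insert {a b : D} (h : Diag φ α ℓ [l]) (hab : a ≠ b) (ha : a ∉ l) (hb : b ∉ l)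
    (ya : φ a = a) (yb : φ b = b) (x : Fin 2 × Bool) :
    ∃ (φ' α' : Perm D) (ℓ' : D → Fin 2 × Bool), Diag φ' α' ℓ' [a :: b :: l] ∧
      (a :: b :: l).map ℓ' = x :: flipLetter x :: l.map ℓ ∧
      ∀ d, d ≠ a → d ≠ b → d ∉ l → φ' d = φ d := by
  have xa : α a = a := by rw [← h.dead a (by simpa using ha), ya]
  have xb : α b = b := by rw [← h.dead b (by simpa using hb), yb]
  have hpl := planar_digon h.planar hab xa xb ya yb
  have hl' : ∀ d ∈ l, d ≠ a ∧ d ≠ b := fun d hd =>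
    ⟨fun hc => ha (hc ▸ hd), fun hc => hb (hc ▸ hd)⟩
  have hα : ∀ d, d ≠ a → d ≠ b → (α * swap a b) d = α d := fun d h1 h2 => by
    rw [Perm.mul_apply, swap_apply_of_ne_of_ne h1 h2]
  have hφ : ∀ d, d ≠ a → d ≠ b → (φ * swap a b) d = φ d := fun d h1 h2 => by
    rw [Perm.mul_apply, swap_apply_of_ne_of_ne h1 h2]
  have hαa : (α * swap a b) a = b := by simp [xb]
  have hαb : (α * swap a b) b = a := by simp [xa]
  have hφa : (φ * swap a b) a = b := by simp [yb]
  have hφb : (φ * swap a b) b = a := by simp [ya]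
  obtain ⟨φ', hface, hdead, hplan⟩ : ∃ φ' : Perm D, FaceCyc φ' (a :: b :: l) ∧
      (∀ d, d ≠ a → d ≠ b → d ∉ l → φ' d = φ d) ∧ Planar (α * swap a b) φ' := by
    rcases l.eq_nil_or_concat' with rfl | ⟨l', e, rfl⟩
    · exact ⟨φ * swap a b, by rw [faceCyc_cons]; simp [yb, ya], fun d h1 h2 _ => hφ d h1 h2, hpl⟩
    · have he := hl' e (by simp)
      have hf := h.face _ (List.mem_singleton.2 rfl)
      refine ⟨φ * swap a b * swap e b, ?_, ?_, ?_⟩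
      · have hnd : e ∉ l' := by
          have := h.nodup
          simp only [List.flatten_cons, List.flatten_nil, List.append_nil, List.nodup_append] at this
          intro hc
          exact this.2.2 e hc e (by simp) rfl
        refine faceCyc_of_snoc_cons (u := a :: b :: l') (e := e) rfl ?_
          (by rw [Perm.mul_apply, swap_apply_left, hφb])
        have h1 : (φ * swap a b * swap e b) a = b := by
          rw [Perm.mul_apply, swap_apply_of_ne_of_ne (Ne.symm he.1) hab, hφa]
        have h2 : (φ * swap a b * swap e b) b = φ e := by
          rw [Perm.mul_apply, swap_apply_right, hφ e he.1 he.2]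
        have h3 : l'.map (φ * swap a b * swap e b) = l'.map φ := by
          refine List.map_congr_left (fun d hd => ?_)
          have hd' := hl' d (by simp [hd])
          rw [Perm.mul_apply, swap_apply_of_ne_of_ne (by rintro rfl; exact hnd hd) hd'.2,
            hφ d hd'.1 hd'.2]
        rw [List.map_cons, List.map_cons, h1, h2, h3]
        congr 1
        obtain ⟨z, t, hz⟩ : ∃ z t, l' ++ [e] = z :: t := List.exists_cons_of_ne_nil (by simp)
        obtain ⟨g1, g2⟩ := (hz ▸ hf : FaceCyc φ (z :: t)).snoc_cons hz.symm
        rw [g1, g2, hz]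
      · intro d h1 h2 h3
        rw [Perm.mul_apply, swap_apply_of_ne_of_ne (fun hc => h3 (by simp [hc])) h2, hφ d h1 h2]
      · rw [Equiv.swap_comm e b]
        refine planar_join hpl (not_orb_of_invariant (fun d => d = a ∨ d = b) ?_ ?_ (Or.inr rfl) ?_)
        · intro d
          by_cases h1 : d = a
          · simp [h1, xb]
          by_cases h2 : d = b
          · simp [h2, xa]
          rw [hα d h1 h2]
          constructor
          · rintro (hc | hc)
            · exact Or.inl (α.injective (hc.trans xa.symm))
            · exact Or.inr (α.injective (hc.trans xb.symm))
          · rintro (hc | hc)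
            exacts [(h1 hc).elim, (h2 hc).elim]
        · intro d
          by_cases h1 : d = a
          · simp [h1, yb]
          by_cases h2 : d = b
          · simp [h2, ya]
          rw [hφ d h1 h2]
          constructor
          · rintro (hc | hc)
            · exact Or.inl (φ.injective (hc.trans ya.symm))
            · exact Or.inr (φ.injective (hc.trans yb.symm))
          · rintro (hc | hc)
            exacts [(h1 hc).elim, (h2 hc).elim]
        · rintro (hc | hc)
          exacts [he.1 hc, he.2 hc]
  have la : Function.update (Function.update ℓ a x) b (flipLetter x) a = x := by
    rw [Function.update_of_ne hab, Function.update_self]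
  have lb : Function.update (Function.update ℓ a x) b (flipLetter x) b = flipLetter x :=
    Function.update_self ..
  have ll : ∀ d, d ≠ a → d ≠ b →
      Function.update (Function.update ℓ a x) b (flipLetter x) d = ℓ d := fun d h1 h2 => by
    rw [Function.update_of_ne h2, Function.update_of_ne h1]
  refine ⟨φ', α * swap a b, Function.update (Function.update ℓ a x) b (flipLetter x),
    ⟨?_, ?_, ?_, ?_, ?_, hplan⟩, ?_, hdead⟩
  · have := h.nodup
    simp only [List.flatten_cons, List.flatten_nil, List.append_nil] at this ⊢
    simp [this, ha, hb, hab]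
  · simpa using hface
  · intro d hd
    simp only [List.flatten_cons, List.flatten_nil, List.append_nil, List.mem_cons, not_or] at hd
    rw [hdead d hd.1 hd.2.1 hd.2.2, hα d hd.1 hd.2.1]
    exact h.dead d (by simpa using hd.2.2)
  · intro d
    by_cases h1 : d = a
    · rw [h1, hαa, hαb]
    by_cases h2 : d = b
    · rw [h2, hαb, hαa]
    rw [hα d h1 h2, hα, h.invol]
    · exact fun hc => h1 (α.injective (hc.trans xa.symm))
    · exact fun hc => h2 (α.injective (hc.trans xb.symm))
  · intro d hd
    by_cases h1 : d = a
    · rw [h1, hαa, la, lb]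
    by_cases h2 : d = b
    · rw [h2, hαb, la, lb, flipLetter_flipLetter]
    rw [hα d h1 h2, ll d h1 h2, ll]
    · refine h.flip d ?_
      simpa [h1, h2] using hd
    · exact fun hc => h1 (α.injective (hc.trans xa.symm))
    · exact fun hc => h2 (α.injective (hc.trans xb.symm))
  · rw [List.map_cons, List.map_cons, la, lb]
    congr 2
    exact List.map_congr_left (fun d hd => ll d (hl' d hd).1 (hl' d hd).2)

end Insert

lemma Sph.perm {ws ws' : List (List (Fin 2 × Bool))} (h : Sph ws) (hp : ws.Perm ws') :
    Sph ws' := by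
  obtain ⟨D, _, _, φ, α, ℓ, fs, hd, rfl⟩ := h
  obtain ⟨fs', h1, h2⟩ := perm_exists_map _ hp
  exact ⟨D, _, _, φ, α, ℓ, fs', hd.congr h1.flatten (fun l hl => hd.face l (h1.mem_iff.2 hl)), h2⟩

variable {ws : List (List (Fin 2 × Bool))} {u v w : List (Fin 2 × Bool)}

lemma Sph.rotate (h : Sph (w :: ws)) (k : ℕ) : Sph (w.rotate k :: ws) := by
  obtain ⟨D, _, _, φ, α, ℓ, fs, hd, he⟩ := h
  obtain ⟨f, fs, rfl, rfl, rfl⟩ := List.map_eq_cons_iff.1 he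
  refine ⟨D, _, _, φ, α, ℓ, f.rotate k :: fs, hd.congr ?_ ?_, by simp [List.map_rotate]⟩
  · rw [List.flatten_cons, List.flatten_cons]
    exact (List.rotate_perm f k).symm.append_right _
  · intro l hl
    rcases List.mem_cons.1 hl with rfl | hl
    · exact (hd.face f (by simp)).rotate k
    · exact hd.face l (by simp [hl])

lemma Sph.comm (h : Sph ((u ++ v) :: ws)) : Sph ((v ++ u) :: ws) := by
  have := h.rotate u.length
  rwa [List.rotate_append_length_eq] at this

lemma Sph.of_nil (h : Sph ([] :: ws)) : Sph ws := by
  obtain ⟨D, _, _, φ, α, ℓ, fs, hd, he⟩ := h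
  obtain ⟨f, fs, rfl, hf, rfl⟩ := List.map_eq_cons_iff.1 he
  obtain rfl := List.map_eq_nil_iff.1 hf
  exact ⟨D, _, _, φ, α, ℓ, fs, hd.congr (Perm.refl _) (fun l hl => hd.face l (by simp [hl])), rfl⟩

lemma Sph.split (h : Sph ((u ++ v) :: ws)) : Sph (u :: v :: ws) := by
  obtain ⟨D, _, _, φ, α, ℓ, fs, hd, he⟩ := h
  obtain ⟨f, fs, rfl, hf, rfl⟩ := List.map_eq_cons_iff.1 he
  obtain ⟨f1, f2, rfl, rfl, rfl⟩ := List.map_eq_append_iff.1 hf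
  by_cases h1 : f1 = []
  · subst h1
    refine ⟨D, _, _, φ, α, ℓ, [] :: f2 :: fs, hd.congr (Perm.refl _) ?_, rfl⟩
    intro l hl
    rcases List.mem_cons.1 hl with rfl | hl
    · exact faceCyc_nil
    · exact hd.face l hl
  by_cases h2 : f2 = []
  · subst h2
    rw [List.append_nil] at hd
    refine ⟨D, _, _, φ, α, ℓ, f1 :: [] :: fs, hd.congr (Perm.refl _) ?_, rfl⟩
    intro l hl
    rcases List.mem_cons.1 hl with rfl | hl
    · exact hd.face l (by simp)
    rcases List.mem_cons.1 hl with rfl | hl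
    · exact faceCyc_nil
    · exact hd.face l (by simp [hl])
  obtain ⟨φ', h'⟩ := hd.split h1 h2
  exact ⟨D, _, _, φ', α, ℓ, f1 :: f2 :: fs, h', rfl⟩

lemma Sph.zip {x : Fin 2 × Bool} (h : Sph ((x :: flipLetter x :: w) :: ws)) : Sph (w :: ws) := by
  obtain ⟨D, _, _, φ, α, ℓ, fs, hd, he⟩ := Sph.split (u := [x, flipLetter x]) (v := w) h
  obtain ⟨f, fs, rfl, hf, he'⟩ := List.map_eq_cons_iff.1 he
  obtain ⟨d1, f, rfl, rfl, hf'⟩ := List.map_eq_cons_iff.1 hf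
  obtain ⟨d2, f, rfl, hl, hf''⟩ := List.map_eq_cons_iff.1 hf'
  obtain rfl := List.map_eq_nil_iff.1 hf''
  obtain ⟨α', h'⟩ := hd.collapse hl
  exact ⟨D, _, _, φ, α', ℓ, fs, h', he'⟩

lemma invRev_cons (x : Fin 2 × Bool) (w : List (Fin 2 × Bool)) :
    FreeGroup.invRev (x :: w) = FreeGroup.invRev w ++ [flipLetter x] := by
  simp [FreeGroup.invRev, flipLetter]

lemma Sph.zip_conj (g : List (Fin 2 × Bool)) (h : Sph ((g ++ w ++ FreeGroup.invRev g) :: ws)) :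
    Sph (w :: ws) := by
  induction g generalizing w with
  | nil => simpa using h
  | cons x g ih =>
    refine ih ?_
    rw [invRev_cons, ← List.append_assoc] at h
    have := h.comm
    refine Sph.zip (x := flipLetter x) ?_
    rw [flipLetter_flipLetter]
    simpa using this

lemma Diag.sph_of_mirror {D : Type} [Fintype D] [DecidableEq D] {φ α : Perm D}
    {ℓ : D → Fin 2 × Bool} {fs : List (List D)} {d : D} {t t' : List D} (ht : t ≠ [])
    (h : Diag φ α ℓ ((d :: t) :: (α d :: t') :: fs))
    (hw : t'.map ℓ = FreeGroup.invRev (t.map ℓ)) : Sph (fs.map (List.map ℓ)) := by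
  have ht' : t' ≠ [] := by
    rintro rfl
    have := congrArg List.length hw
    simp only [List.map_nil, List.length_nil, FreeGroup.invRev_length, List.length_map] at this
    exact ht (List.length_eq_zero_iff.1 this.symm)
  obtain ⟨φ', h'⟩ := h.merge ht ht'
  refine Sph.of_nil (Sph.zip_conj (t.map ℓ) ?_)
  rw [List.append_nil, ← hw, ← List.map_append, ← List.map_cons]
  exact ⟨D, _, _, φ', α, ℓ, _, h', rfl⟩

lemma Sph.init {w : List (Fin 2 × Bool)} (h : FreeGroup.mk w = 1) : Sph [w] := by
  have hred : FreeGroup.Red w [] := by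
    have := FreeGroup.Red.exact.1 (h.trans FreeGroup.one_eq_mk)
    obtain ⟨c, h1, h2⟩ := this
    rwa [FreeGroup.Red.nil_iff.1 h2] at h1
  have key : ∀ N : ℕ, ∃ (D : Type) (_ : Fintype D) (_ : DecidableEq D) (φ α : Perm D)
      (ℓ : D → Fin 2 × Bool) (l sp : List D), Diag φ α ℓ [l] ∧ l.map ℓ = w ∧ sp.length = N ∧
        sp.Nodup ∧ ∀ d ∈ sp, φ d = d ∧ d ∉ l := by
    clear h
    induction hred using Relation.ReflTransGen.head_induction_on with
    | refl =>
      intro N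
      refine ⟨Fin N, inferInstance, inferInstance, 1, 1, fun _ => (0, true), [], List.finRange N,
        ⟨by simp, by simp [faceCyc_nil], by simp, by simp, by simp, ?_⟩, rfl, by simp,
        List.nodup_finRange N, by simp⟩
      unfold Planar
      rw [one_mul, cyc_one]
      have := numClasses_le_card (X := Fin N) id (S := orbSetoid (1 : Perm (Fin N)) 1)
        (fun a b hab => by rw [show a = b from hab])
      omega
    | head hstep _ ih =>
      intro N
      obtain ⟨D, _, _, φ, α, ℓ, l, sp, hd, hl, hN, hnd, hsp⟩ := ih (N + 2)
      obtain ⟨a, sp, rfl⟩ := List.exists_cons_of_length_eq_add_one hN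
      simp only [List.length_cons, Nat.add_right_cancel_iff] at hN
      obtain ⟨b, sp, rfl⟩ := List.exists_cons_of_length_eq_add_one hN
      simp only [List.length_cons, Nat.add_right_cancel_iff] at hN
      simp only [List.nodup_cons, List.mem_cons, not_or] at hnd
      cases hstep with
      | @not L1 L2 x b' =>
        obtain ⟨l1, l2, rfl, rfl, rfl⟩ := List.map_eq_append_iff.1 hl
        have hp : (l1 ++ l2).Perm (l2 ++ l1) := List.perm_append_comm
        have hd' : Diag φ α ℓ [l2 ++ l1] := by
          refine hd.congr (by simpa using hp) ?_
          intro m hm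
          obtain rfl := List.mem_singleton.1 hm
          have := (hd.face _ (List.mem_singleton.2 rfl)).rotate l1.length
          rwa [List.rotate_append_length_eq] at this
        obtain ⟨φ', α', ℓ', h1, h2, h3⟩ := hd'.insert hnd.1.1
          (fun hc => (hsp a (by simp)).2 (hp.mem_iff.2 hc))
          (fun hc => (hsp b (by simp)).2 (hp.mem_iff.2 hc)) (hsp a (by simp)).1
          (hsp b (by simp)).1 (x, b')
        have hp' : (l1 ++ a :: b :: l2).Perm (a :: b :: (l2 ++ l1)) := by
          rw [← List.cons_append, ← List.cons_append]
          exact List.perm_append_comm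
        refine ⟨D, _, _, φ', α', ℓ', l1 ++ a :: b :: l2, sp, h1.congr (by simpa using hp'.symm) ?_,
          ?_, hN, hnd.2.2, ?_⟩
        · intro m hm
          obtain rfl := List.mem_singleton.1 hm
          have := (h1.face _ (List.mem_singleton.2 rfl)).rotate (a :: b :: l2).length
          rwa [← List.cons_append, ← List.cons_append, List.rotate_append_length_eq] at this
        · rw [List.map_cons, List.map_cons, List.map_append, List.map_append] at h2
          simp only [List.cons.injEq] at h2
          obtain ⟨h4, h5, h6⟩ := h2
          obtain ⟨h7, h8⟩ := List.append_inj h6 (by simp)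
          rw [List.map_append, List.map_cons, List.map_cons, h4, h5, h7, h8]
          rfl
        · intro d hd''
          have ha : d ≠ a := fun hc => hnd.1.2 (hc ▸ hd'')
          have hb : d ≠ b := fun hc => hnd.2.1 (hc ▸ hd'')
          have hl := hsp d (by simp [hd''])
          refine ⟨by rw [h3 d ha hb (fun hc => hl.2 (hp.mem_iff.2 hc)), hl.1], ?_⟩
          intro hc
          rw [List.mem_append, List.mem_cons, List.mem_cons] at hc
          rcases hc with hc | hc | hc | hc
          · exact hl.2 (List.mem_append_left _ hc)
          · exact ha hc
          · exact hb hc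
          · exact hl.2 (List.mem_append_right _ hc)
  obtain ⟨D, _, _, φ, α, ℓ, l, sp, hd, hl, -⟩ := key 0
  exact ⟨D, _, _, φ, α, ℓ, [l], hd, by simp [hl]⟩

end Heckoid

namespace Heckoid
open Equiv

/-- Combinatorial data carried by the darts of a spherical diagram whose faces are labelled by
slopes: `cls` is the kind of face (`0` for relators), `Q c / p c` its slope, `τ` and `θ` are the
letter type and the phase, `T` is the length of a relator. -/
structure SphData {D : Type} (φ α : Perm D) (cls : D → Fin 3) (Q p : Fin 3 → ℤ) (T : ℕ)
    (τ : D → ZMod 2) (θ : D → ℤ) : Prop where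
  invol : ∀ d, α (α d) = d
  cls_φ : ∀ d, cls (φ d) = cls d
  p_pos : ∀ c, 0 < p c
  Q_nonneg : ∀ c, 0 ≤ Q c
  Q_le : ∀ c, Q c ≤ p c
  τ_φ : ∀ d, τ (φ d) = τ d + 1
  τ_α : ∀ d, τ (α d) = τ d
  θ_φ : ∀ d, 2 * p (cls d) ∣ θ (φ d) - θ d - Q (cls d)
  sign : ∀ d, (2 : ℤ) ∣ θ d / p (cls d) + θ (α d) / p (cls (α d)) + 1
  one_face : ∀ d e, cls d ≠ 0 → cls e = cls d → φ.SameCycle d e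
  period : ∀ d, cls d ≠ 0 → (φ ^ (2 * p (cls d))) d = d
  period_rel : ∀ d, cls d = 0 → (φ ^ (T : ℤ)) d = d
  nonmirror : ∀ d, cls d = 0 → cls (α d) = 0 → ¬ 2 * p 0 ∣ θ d + θ (α d) + 1


namespace SphData
variable {D : Type} {φ α : Perm D} {cls : D → Fin 3} {Q p : Fin 3 → ℤ} {T : ℕ}
    {τ : D → ZMod 2} {θ : D → ℤ}

/-- The corner between `d` and `φ d` is small if its vertex has valency two. -/
def Small (φ α : Perm D) (d : D) : Prop := α (φ d) = φ⁻¹ (α d)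

variable (h : SphData φ α cls Q p T τ θ)
include h

lemma cls_zpow (k : ℤ) (d : D) : cls ((φ ^ k) d) = cls d := by
  have hn : ∀ n : ℕ, ∀ d, cls ((φ ^ n) d) = cls d := by
    intro n
    induction n with
    | zero => intro d; rfl
    | succ n ih => intro d; rw [pow_succ', Perm.mul_apply, h.cls_φ, ih]
  rcases k with n | n
  · exact hn n d
  · have := hn (n+1) ((φ ^ (Int.negSucc n)) d)
    rw [zpow_negSucc] at this ⊢
    simpa using this.symm

lemma cls_inv (d : D) : cls (φ⁻¹ d) = cls d := by
  simpa using h.cls_zpow (-1) d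

lemma θ_zpow (k : ℤ) (d : D) : 2 * p (cls d) ∣ θ ((φ ^ k) d) - θ d - Q (cls d) * k := by
  induction k using Int.induction_on with
  | zero => simp
  | succ k ih =>
    have := h.θ_φ ((φ ^ (k : ℤ)) d)
    rw [h.cls_zpow] at this
    rw [zpow_add, zpow_one, Perm.mul_apply, ← Perm.mul_apply, ← zpow_add_one]
    have e : φ ((φ ^ (k : ℤ)) d) = (φ ^ ((k:ℤ)+1)) d := by
      rw [add_comm, zpow_add, zpow_one, Perm.mul_apply]
    rw [e] at this
    have h2 := dvd_add ih this
    rwa [show ∀ a b c q k : ℤ, a - b - q * k + (c - a - q) = c - b - q * (k + 1) by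
      intros; ring] at h2
  | pred k ih =>
    have := h.θ_φ ((φ ^ (-(k : ℤ) - 1)) d)
    rw [h.cls_zpow] at this
    have e : φ ((φ ^ (-(k : ℤ) - 1)) d) = (φ ^ (-(k:ℤ))) d := by
      rw [← Perm.mul_apply, ← zpow_one_add]; congr 2; ring
    rw [e] at this
    have h2 := dvd_sub ih this
    rwa [show ∀ a b c q k : ℤ, a - b - q * k - (a - c - q) = c - b - q * (k - 1) by
      intros; ring] at h2

end SphData

/-- The phase of the mates of `φ ^ k d`, of slope class `c`, lifted to the integers, relative
to its linear growth. -/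
def drift {D : Type} (φ α : Perm D) (cls : D → Fin 3) (Q p : Fin 3 → ℤ) (θ : D → ℤ) (d : D)
    (c : Fin 3) (k : ℤ) : ℤ :=
  p c * ((θ d + Q (cls d) * k) / p (cls d)) + (-θ (α ((φ ^ k) d)) - 1) % p c - Q c * k

lemma lift_congr {p x y H : ℤ} (hxy : (2 : ℤ) ∣ x / p - H) (he : y = p * H + x % p) :
    2 * p ∣ y - x := by
  obtain ⟨z, hz⟩ := hxy
  have := Int.mul_ediv_add_emod x p
  refine ⟨-z, ?_⟩
  have h1 : x / p = H + 2 * z := by linarith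
  rw [h1] at this
  rw [he]; linarith

lemma ediv_parity {p x y : ℤ} (hp : 0 < p) (h : 2 * p ∣ x - y) : (2 : ℤ) ∣ x / p - y / p := by
  obtain ⟨z, hz⟩ := h
  have : x = y + p * (2 * z) := by linarith
  rw [this, Int.add_mul_ediv_left _ _ hp.ne']
  exact ⟨z, by ring⟩

lemma neg_ediv_parity {p x : ℤ} (hp : 0 < p) : (-x - 1) / p = - (x / p) - 1 := by
  have h1 := Int.mul_ediv_add_emod x p
  have h2 := Int.emod_nonneg x hp.ne'
  have h3 := Int.emod_lt_of_pos x hp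
  rw [Int.ediv_eq_iff_of_pos hp]
  constructor <;> nlinarith

namespace SphData
variable {D : Type} {φ α : Perm D} {cls : D → Fin 3} {Q p : Fin 3 → ℤ} {T : ℕ}
    {τ : D → ZMod 2} {θ : D → ℤ} (h : SphData φ α cls Q p T τ θ)
include h

lemma drift_congr (d : D) {c : Fin 3} (k : ℤ) (hc : cls (α ((φ ^ k) d)) = c) :
    2 * p c ∣ drift φ α cls Q p θ d c k + Q c * k + θ (α ((φ ^ k) d)) + 1 := by
  have h1 := h.sign ((φ ^ k) d)
  rw [hc, h.cls_zpow] at h1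
  have h2 : (2 : ℤ) ∣ θ ((φ ^ k) d) / p (cls d) - (θ d + Q (cls d) * k) / p (cls d) :=
    ediv_parity (h.p_pos _) (by convert h.θ_zpow k d using 1; ring)
  have h3 := neg_ediv_parity (p := p c) (x := θ (α ((φ ^ k) d))) (h.p_pos c)
  have := lift_congr (p := p c) (x := -θ (α ((φ ^ k) d)) - 1)
    (H := (θ d + Q (cls d) * k) / p (cls d)) (by omega) rfl
  convert this using 1
  unfold drift
  ring

lemma drift_floor (d : D) (c : Fin 3) (k : ℤ) :
    (drift φ α cls Q p θ d c k + Q c * k) / p c = (θ d + Q (cls d) * k) / p (cls d) := by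
  have hp := h.p_pos c
  unfold drift
  rw [sub_add_cancel, add_comm, Int.add_mul_ediv_left _ _ hp.ne',
    Int.ediv_eq_zero_of_lt (Int.emod_nonneg _ hp.ne') (Int.emod_lt_of_pos _ hp), zero_add]

lemma floor_step (c : Fin 3) (x : ℤ) : x / p c ≤ (x + Q c) / p c ∧ (x + Q c) / p c ≤ x / p c + 1 := by
  have hp := h.p_pos c
  constructor
  · exact Int.ediv_le_ediv hp (by have := h.Q_nonneg c; omega)
  · have : (x + p c) / p c = x / p c + 1 := by
      simpa using Int.add_mul_ediv_left x 1 hp.ne'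
    rw [← this]
    exact Int.ediv_le_ediv hp (by have := h.Q_le c; omega)

lemma drift_step (d : D) {c : Fin 3} (k : ℤ) (hc : cls (α ((φ ^ k) d)) = c)
    (hs : Small φ α ((φ ^ k) d)) :
    drift φ α cls Q p θ d c (k + 1) = drift φ α cls Q p θ d c k := by
  have hp := h.p_pos c
  have e : φ ((φ ^ (k : ℤ)) d) = (φ ^ ((k:ℤ)+1)) d := by
    rw [add_comm, zpow_add, zpow_one, Perm.mul_apply]
  unfold Small at hs
  rw [e] at hs
  have hc' : cls (α ((φ ^ (k+1)) d)) = c := by rw [hs, h.cls_inv, hc]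
  have h1 := h.drift_congr d k hc
  have h2 := h.drift_congr d (k+1) hc'
  have h3 := h.θ_φ (φ⁻¹ (α ((φ ^ k) d)))
  rw [h.cls_inv, hc, perm_apply_inv, ← hs] at h3
  have f1 := h.drift_floor d c k
  have f2 := h.drift_floor d c (k+1)
  have f3 := h.floor_step (cls d) (θ d + Q (cls d) * k)
  rw [show θ d + Q (cls d) * k + Q (cls d) = θ d + Q (cls d) * (k + 1) by ring, ← f1, ← f2] at f3
  set x := drift φ α cls Q p θ d c k
  set y := drift φ α cls Q p θ d c (k+1)
  have g1 := Int.mul_ediv_add_emod (x + Q c * k) (p c)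
  have g2 := Int.mul_ediv_add_emod (y + Q c * (k+1)) (p c)
  have g3 := Int.emod_nonneg (x + Q c * k) hp.ne'
  have g4 := Int.emod_lt_of_pos (x + Q c * k) hp
  have g5 := Int.emod_nonneg (y + Q c * (k+1)) hp.ne'
  have g6 := Int.emod_lt_of_pos (y + Q c * (k+1)) hp
  have q0 := h.Q_nonneg c
  have q1 := h.Q_le c
  have hd : 2 * p c ∣ y - x := by
    obtain ⟨a, ha⟩ := h1
    obtain ⟨b, hb⟩ := h2
    obtain ⟨e, he⟩ := h3
    exact ⟨b - a + e, by linarith⟩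
  obtain ⟨z, hz⟩ := hd
  have u1 : -(p c) - Q c < y - x := by nlinarith
  have u2 : y - x < 2 * p c - Q c := by nlinarith
  have : z = 0 := by
    have a1 : -1 < z := by by_contra hh; have : z ≤ -1 := by omega
                           nlinarith
    have a2 : z < 1 := by by_contra hh; have : 1 ≤ z := by omega
                          nlinarith
    omega
  rw [this] at hz
  linarith

/-- Drift is constant on an interval of small corners. -/
lemma drift_const (d : D) {c : Fin 3} {k l : ℤ} (hkl : k ≤ l) (hc : cls (α ((φ ^ k) d)) = c)
    (hs : ∀ i, k ≤ i → i < l → Small φ α ((φ ^ i) d)) :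
    cls (α ((φ ^ l) d)) = c ∧ drift φ α cls Q p θ d c l = drift φ α cls Q p θ d c k := by
  induction l, hkl using Int.leInduction with
  | base => exact ⟨hc, rfl⟩
  | succ l hl ih =>
    obtain ⟨h1, h2⟩ := ih (fun i hi hil => hs i hi (by omega))
    have hsl := hs l hl (by omega)
    refine ⟨?_, (h.drift_step d l h1 hsl).trans h2⟩
    rw [← h1, add_comm, zpow_add, zpow_one, Perm.mul_apply, hsl, h.cls_inv]

lemma zpow_period {d : D} (hd : cls d ≠ 0) (k : ℤ) :
    (φ ^ (k + 2 * p (cls d))) d = (φ ^ k) d := by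
  rw [zpow_add, Perm.mul_apply, h.period d hd]

lemma zpow_period_rel {d : D} (hd : cls d = 0) (k : ℤ) : (φ ^ (k + T)) d = (φ ^ k) d := by
  rw [zpow_add, Perm.mul_apply, h.period_rel d hd]

lemma drift_period {d : D} (hd : cls d ≠ 0) (c : Fin 3) (k : ℤ) :
    drift φ α cls Q p θ d c (k + 2 * p (cls d)) =
      drift φ α cls Q p θ d c k + 2 * (p c * Q (cls d) - Q c * p (cls d)) := by
  unfold drift
  rw [h.zpow_period hd, show θ d + Q (cls d) * (k + 2 * p (cls d)) =
    θ d + Q (cls d) * k + p (cls d) * (2 * Q (cls d)) by ring,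
    Int.add_mul_ediv_left _ _ (h.p_pos _).ne']
  ring

/-- On an interval of relator-to-relator small corners the two kinds of marks exclude
each other. -/
lemma rel_rel_marks {d : D} (hd : cls d = 0) {y₀ y₁ k l : ℤ} (hk : k ≤ y₀ ∧ k ≤ y₁)
    (hl : y₀ ≤ l ∧ y₁ ≤ l) (hc : cls (α ((φ ^ k) d)) = 0)
    (hs : ∀ i, k ≤ i → i < l → Small φ α ((φ ^ i) d))
    (h₀ : p 0 ∣ θ d + Q 0 * y₀) (h₁ : p 0 ∣ θ d + Q 0 * y₁ + 1) : False := by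
  have hp := h.p_pos 0
  obtain ⟨c0, e0⟩ := h.drift_const d hk.1 hc (fun i a b => hs i a (by omega))
  obtain ⟨c1, e1⟩ := h.drift_const d hk.2 hc (fun i a b => hs i a (by omega))
  have f0 := h.drift_floor d 0 y₀
  have f1 := h.drift_floor d 0 y₁
  rw [e0, hd] at f0
  rw [e1, hd] at f1
  obtain ⟨a, ha⟩ := h₀
  obtain ⟨b, hb⟩ := h₁
  set v := drift φ α cls Q p θ d 0 k with hv
  have hvd : v = θ d := by
    rw [Int.ediv_eq_iff_of_pos hp] at f0 f1
    rw [ha, Int.mul_ediv_cancel_left _ hp.ne'] at f0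
    have hb' : (θ d + Q 0 * y₁) / p 0 = b - 1 := by
      rw [Int.ediv_eq_iff_of_pos hp]; constructor <;> nlinarith
    rw [hb'] at f1
    nlinarith [f0.1, f1.2]
  have g1 := h.drift_congr d y₀ c0
  have g2 := h.θ_zpow y₀ d
  rw [e0, hvd] at g1
  rw [hd] at g2
  refine h.nonmirror ((φ ^ y₀) d) (by rw [h.cls_zpow, hd]) c0 ?_
  obtain ⟨u, hu⟩ := g1
  obtain ⟨w, hw⟩ := g2
  exact ⟨u + w, by linarith⟩

/-- Marks on an interval of small corners of a relator face whose mates have another slope. -/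
lemma rel_marks {d : D} (hd : cls d = 0) {y₀ y₁ k l : ℤ} (hk : k ≤ y₀ ∧ k ≤ y₁)
    (hl : y₀ ≤ l ∧ y₁ ≤ l) {c : Fin 3} (hc : cls (α ((φ ^ k) d)) = c)
    (hs : ∀ i, k ≤ i → i < l → Small φ α ((φ ^ i) d))
    (h₀ : p 0 ∣ θ d + Q 0 * y₀) (h₁ : p 0 ∣ θ d + Q 0 * y₁ + 1) :
    (p 0 * Q c - Q 0 * p c) * (y₁ - y₀) < p c := by
  have hp := h.p_pos 0
  have hp' := h.p_pos c
  obtain ⟨c0, e0⟩ := h.drift_const d hk.1 hc (fun i a b => hs i a (by omega))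
  obtain ⟨c1, e1⟩ := h.drift_const d hk.2 hc (fun i a b => hs i a (by omega))
  have f0 := h.drift_floor d c y₀
  have f1 := h.drift_floor d c y₁
  rw [e0, hd] at f0
  rw [e1, hd] at f1
  obtain ⟨a, ha⟩ := h₀
  obtain ⟨b, hb⟩ := h₁
  set v := drift φ α cls Q p θ d c k with hv
  rw [Int.ediv_eq_iff_of_pos hp'] at f0 f1
  rw [ha, Int.mul_ediv_cancel_left _ hp.ne'] at f0
  have hb' : (θ d + Q 0 * y₁) / p 0 = b - 1 := by
    rw [Int.ediv_eq_iff_of_pos hp]; constructor <;> nlinarith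
  rw [hb'] at f1
  have k1 : Q c * (y₁ - y₀) < p c * (b - a) := by nlinarith [f0.1, f1.2]
  have k2 : Q 0 * (y₁ - y₀) = p 0 * (b - a) - 1 := by linarith
  have := mul_lt_mul_of_pos_left k1 hp
  nlinarith

end SphData
end Heckoid

namespace Heckoid
open Equiv List

/-- The letter of type `τ` and phase `θ` for a slope with denominator `p`. -/
def lett (p : ℤ) (τ : ZMod 2) (θ : ℤ) : Fin 2 × Bool := ⟨τ, decide ((2 : ℤ) ∣ θ / p)⟩

lemma lett_congr {p x y : ℤ} (hp : 0 < p) (h : 2 * p ∣ x - y) (τ : ZMod 2) :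
    lett p τ x = lett p τ y := by
  have := ediv_parity hp h
  unfold lett
  congr 2
  rw [eq_iff_iff]
  omega

lemma flipLetter_lett {p : ℤ} (hp : 0 < p) (τ : ZMod 2) (x : ℤ) :
    flipLetter (lett p τ x) = lett p τ (-x - 1) := by
  unfold lett flipLetter
  rw [neg_ediv_parity hp]
  congr 1
  rw [← decide_not]
  congr 1
  rw [eq_iff_iff]
  omega

lemma lett_eq_flip {p p' x x' : ℤ} {τ τ' : ZMod 2}
    (h : lett p' τ' x' = flipLetter (lett p τ x)) : τ' = τ ∧ (2 : ℤ) ∣ x / p + x' / p' + 1 := by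
  refine ⟨congrArg Prod.fst h, ?_⟩
  have h2 := congrArg Prod.snd h
  simp only [lett, flipLetter, ← decide_not, decide_eq_decide] at h2
  omega

/-- The boundary word of a face of kind `x.1`, read forwards or, for `x.2 = 1`, backwards. -/
def faceWord (Q p : Fin 3 → ℤ) (len : Fin 3 → ℕ) (x : Fin 3 × ℕ) : List (Fin 2 × Bool) :=
  (List.range (len x.1)).map fun i : ℕ =>
    lett (p x.1) ((i : ZMod 2) + x.2) (Q x.1 * i + x.2 * (Q x.1 - 1))

section Position
variable {D : Type} [Fintype D] [DecidableEq D] {φ α : Perm D} {ℓ : D → Fin 2 × Bool}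
  {P : List (List D × (Fin 3 × ℕ))}

/-- The dart `d` is the `j`-th one of the `i`-th face. -/
def At (P : List (List D × (Fin 3 × ℕ))) (d : D) (i : Fin P.length) (j : ℕ) : Prop :=
  P[i].1[j]? = some d

lemma exists_at {d : D} (hd : d ∈ (P.map Prod.fst).flatten) : ∃ i j, At P d i j := by
  obtain ⟨l, hl, hdl⟩ := List.mem_flatten.1 hd
  obtain ⟨x, hx, rfl⟩ := List.mem_map.1 hl
  obtain ⟨i, hi, rfl⟩ := List.getElem_of_mem hx
  obtain ⟨j, hj⟩ := List.mem_iff_getElem?.1 hdl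
  exact ⟨⟨i, hi⟩, j, hj⟩

lemma At.mem {d : D} {i : Fin P.length} {j : ℕ} (h : At P d i j) : d ∈ P[i].1 :=
  List.mem_of_getElem? h

lemma At.mem_flatten {d : D} {i : Fin P.length} {j : ℕ} (h : At P d i j) :
    d ∈ (P.map Prod.fst).flatten :=
  List.mem_flatten.2 ⟨_, List.mem_map_of_mem (List.getElem_mem i.2), h.mem⟩

lemma At.unique (hnd : (P.map Prod.fst).flatten.Nodup) {d : D} {i i' : Fin P.length} {j j' : ℕ}
    (h : At P d i j) (h' : At P d i' j') : i = i' ∧ j = j' := by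
  rw [List.nodup_flatten] at hnd
  have hi : i = i' := by
    by_contra hne
    have := hnd.2
    rw [List.pairwise_iff_getElem] at this
    have key : ∀ a b : Fin P.length, a < b → d ∈ P[a].1 → d ∈ P[b].1 → False := by
      intro a b hab ha hb
      have := this a b (by simp) (by simp) hab
      simp only [List.getElem_map] at this
      exact this ha hb
    rcases lt_or_gt_of_ne hne with hlt | hlt
    · exact key _ _ hlt h.mem h'.mem
    · exact key _ _ hlt h'.mem h.mem
  subst hi
  refine ⟨rfl, ?_⟩
  have hn : P[i].1.Nodup := hnd.1 _ (List.mem_map_of_mem (List.getElem_mem i.2))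
  obtain ⟨a, ha⟩ := List.getElem?_eq_some_iff.1 h
  obtain ⟨b, hb⟩ := List.getElem?_eq_some_iff.1 h'
  exact (hn.getElem_inj_iff (hi := a) (hj := b)).1 (ha.trans hb.symm)

variable {Q p : Fin 3 → ℤ} {len : Fin 3 → ℕ}

lemma length_face (hw : ∀ x ∈ P, x.1.map ℓ = faceWord Q p len x.2) (i : Fin P.length) :
    P[i].1.length = len P[i].2.1 := by
  have := congrArg List.length (hw _ (List.getElem_mem i.2))
  simpa [faceWord] using this

lemma At.lt (hw : ∀ x ∈ P, x.1.map ℓ = faceWord Q p len x.2) {d : D} {i : Fin P.length} {j : ℕ}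
    (h : At P d i j) : j < len P[i].2.1 := by
  rw [← length_face hw]
  exact (List.getElem?_eq_some_iff.1 h).1

lemma At.label (hw : ∀ x ∈ P, x.1.map ℓ = faceWord Q p len x.2) {d : D} {i : Fin P.length}
    {j : ℕ} (h : At P d i j) : ℓ d = lett (p P[i].2.1) ((j : ZMod 2) + P[i].2.2)
      (Q P[i].2.1 * j + P[i].2.2 * (Q P[i].2.1 - 1)) := by
  have hlt := h.lt hw
  have h1 := hw P[i] (List.getElem_mem i.2)
  have h2 : (P[i].1.map ℓ)[j]? = some (ℓ d) := by
    rw [List.getElem?_map, show P[i].1[j]? = some d from h]; rfl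
  rw [h1] at h2
  unfold faceWord at h2
  rw [List.getElem?_map, List.getElem?_range hlt] at h2
  simpa using h2.symm

lemma At.apply (hd : Diag φ α ℓ (P.map Prod.fst))
    (hw : ∀ x ∈ P, x.1.map ℓ = faceWord Q p len x.2) {d : D} {i : Fin P.length} {j : ℕ}
    (h : At P d i j) : At P (φ d) i ((j + 1) % len P[i].2.1) := by
  have hf : FaceCyc φ P[i].1 := hd.face _ (List.mem_map_of_mem (List.getElem_mem i.2))
  obtain ⟨hj, rfl⟩ := List.getElem?_eq_some_iff.1 h
  rw [hf.getElem j hj]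
  unfold At
  rw [← length_face hw, List.getElem?_eq_getElem]

lemma At.pow (hd : Diag φ α ℓ (P.map Prod.fst))
    (hw : ∀ x ∈ P, x.1.map ℓ = faceWord Q p len x.2) {d : D} {i : Fin P.length} {j : ℕ}
    (h : At P d i j) (k : ℕ) : At P ((φ ^ k) d) i ((j + k) % len P[i].2.1) := by
  induction k with
  | zero =>
    rw [add_zero, Nat.mod_eq_of_lt (h.lt hw)]
    exact h
  | succ k ih =>
    have := ih.apply hd hw
    rwa [Nat.mod_add_mod, ← Perm.mul_apply, ← pow_succ', add_assoc] at this

lemma At.pow_len (hd : Diag φ α ℓ (P.map Prod.fst))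
    (hw : ∀ x ∈ P, x.1.map ℓ = faceWord Q p len x.2) {d : D} {i : Fin P.length} {j : ℕ}
    (h : At P d i j) : (φ ^ len P[i].2.1) d = d := by
  have := h.pow hd hw (len P[i].2.1)
  rw [Nat.add_mod_right, Nat.mod_eq_of_lt (h.lt hw)] at this
  exact Option.some.inj ((show _ = _ from this).symm.trans (show _ = _ from h))

lemma At.label_pow (hp : ∀ c, 0 < p c) (hlen : ∀ c, 2 * p c ∣ len c)
    (hd : Diag φ α ℓ (P.map Prod.fst))
    (hw : ∀ x ∈ P, x.1.map ℓ = faceWord Q p len x.2) {d : D} {i : Fin P.length} {j : ℕ}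
    (h : At P d i j) (k : ℕ) : ℓ ((φ ^ k) d) = lett (p P[i].2.1) ((j : ZMod 2) + P[i].2.2 + k)
      (Q P[i].2.1 * j + P[i].2.2 * (Q P[i].2.1 - 1) + Q P[i].2.1 * k) := by
  rw [(h.pow hd hw k).label hw]
  have h1 := Nat.div_add_mod (j + k) (len P[i].2.1)
  set c := P[i].2.1
  obtain ⟨z, hz⟩ := hlen c
  have h2 : ((len c : ℕ) : ZMod 2) = 0 := by
    have : ((len c : ℤ) : ZMod 2) = ((2 * p c * z : ℤ) : ZMod 2) := by rw [hz]
    push_cast at this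
    rw [this, show (2 : ZMod 2) = 0 from rfl]; ring
  have h3 : (((j + k) % len c : ℕ) : ZMod 2) = j + k := by
    have := congrArg (Nat.cast : ℕ → ZMod 2) h1
    push_cast at this
    rw [h2] at this
    rw [← this]; ring
  rw [h3, show (j : ZMod 2) + k + P[i].2.2 = j + P[i].2.2 + k by ring]
  refine lett_congr (hp c) ?_ _
  have h4 : (len c : ℤ) * (((j + k) / len c : ℕ) : ℤ) + (((j + k) % len c : ℕ) : ℤ) = j + k := by
    exact_mod_cast h1
  refine ⟨-(Q c * z * (((j + k) / len c : ℕ) : ℤ)), ?_⟩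
  have h5 : (((j + k) % len c : ℕ) : ℤ) = j + k - 2 * p c * z * (((j + k) / len c : ℕ) : ℤ) := by
    rw [← h4, hz]; ring
  rw [h5]; ring

end Position
end Heckoid

namespace Heckoid
open Equiv List

lemma invRev_map_range (f : ℕ → Fin 2 × Bool) (N : ℕ) :
    FreeGroup.invRev ((List.range N).map f) =
      (List.range N).map fun k => flipLetter (f (N - 1 - k)) := by
  refine List.ext_getElem (by simp [FreeGroup.invRev_length]) (fun k h1 h2 => ?_)
  simp [FreeGroup.invRev, flipLetter]

lemma cast_len {p : Fin 3 → ℤ} {len : Fin 3 → ℕ} (hlen : ∀ c, 2 * p c ∣ len c) (c : Fin 3) :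
    ((len c : ℕ) : ZMod 2) = 0 := by
  obtain ⟨z, hz⟩ := hlen c
  have : ((len c : ℤ) : ZMod 2) = ((2 * p c * z : ℤ) : ZMod 2) := by rw [hz]
  push_cast at this
  rw [this, show (2 : ZMod 2) = 0 from rfl]; ring

lemma neg_zmod_two (x : ZMod 2) : -x = x := by
  revert x; decide

lemma invRev_faceWord {Q p : Fin 3 → ℤ} {len : Fin 3 → ℕ} (hp : ∀ c, 0 < p c)
    (hlen : ∀ c, 2 * p c ∣ len c) (c : Fin 3) :
    FreeGroup.invRev (faceWord Q p len (c, 0)) = faceWord Q p len (c, 1) := by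
  unfold faceWord
  rw [invRev_map_range]
  refine List.map_congr_left (fun k hk => ?_)
  have hk := List.mem_range.1 hk
  simp only at hk ⊢
  rw [flipLetter_lett (hp c)]
  have h1 : ((len c - 1 - k : ℕ) : ℤ) = len c - 1 - k := by omega
  have h2 : ((len c - 1 - k : ℕ) : ZMod 2) = (k : ZMod 2) + 1 := by
    have h3 : ((len c - 1 - k : ℕ) : ZMod 2) = (((len c : ℤ) - 1 - k : ℤ) : ZMod 2) := by
      rw [← h1]; simp
    rw [h3]; push_cast
    rw [cast_len hlen, show (0 : ZMod 2) - 1 - k = -(k + 1) by ring, neg_zmod_two]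
  rw [h1, h2]
  push_cast
  rw [add_zero]
  refine lett_congr (hp c) ?_ _
  obtain ⟨z, hz⟩ := hlen c
  exact ⟨-(Q c * z), by rw [hz]; ring⟩

lemma perm_pair {α : Type} {l : List α} {i j : Fin l.length} (h : i ≠ j) :
    ∃ l', l.Perm (l[i] :: l[j] :: l') := by
  have h1 : l.Perm (l[i] :: l.eraseIdx i) := (List.getElem_cons_eraseIdx_perm i.2).symm
  have h2 : l[j] ∈ l.eraseIdx i :=
    List.mem_eraseIdx_iff_getElem.2 ⟨j, j.2, fun hc => h (Fin.ext hc.symm), rfl⟩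
  obtain ⟨a, b, hab⟩ := List.append_of_mem h2
  refine ⟨a ++ b, h1.trans (Perm.cons _ ?_)⟩
  rw [hab]
  exact List.perm_middle

section Mirror
variable {D : Type} [Fintype D] [DecidableEq D] {φ α : Perm D} {ℓ : D → Fin 2 × Bool}
  {P : List (List D × (Fin 3 × ℕ))} {Q p : Fin 3 → ℤ} {len : Fin 3 → ℕ}

lemma At.rotate (hd : Diag φ α ℓ (P.map Prod.fst))
    (hw : ∀ x ∈ P, x.1.map ℓ = faceWord Q p len x.2) {d : D} {i : Fin P.length} {j : ℕ}
    (h : At P d i j) : P[i].1.rotate j = (List.range (len P[i].2.1)).map fun k => (φ ^ k) d := by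
  refine List.ext_getElem (by simpa using length_face hw i) (fun k h1 h2 => ?_)
  rw [List.getElem_rotate, List.getElem_map, List.getElem_range]
  have := (List.getElem?_eq_some_iff.1 (h.pow hd hw k)).2
  rw [← this]
  congr 1
  rw [length_face hw, add_comm]

lemma At.rotate_cons (hd : Diag φ α ℓ (P.map Prod.fst))
    (hw : ∀ x ∈ P, x.1.map ℓ = faceWord Q p len x.2) {d : D} {i : Fin P.length} {j : ℕ}
    (h : At P d i j) :
    P[i].1.rotate j = d :: (List.range (len P[i].2.1 - 1)).map fun k => (φ ^ (k + 1)) d := by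
  have h0 := h.lt hw
  rw [h.rotate hd hw]
  obtain ⟨N, hN⟩ : ∃ N, len P[i].2.1 = N + 1 := ⟨len P[i].2.1 - 1, by omega⟩
  rw [hN, List.range_succ_eq_map, List.map_cons, List.map_map]
  rfl

lemma sph_of_mirror (hp : ∀ c, 0 < p c) (hlen : ∀ c, 2 * p c ∣ len c)
    (hd : Diag φ α ℓ (P.map Prod.fst))
    (hw : ∀ x ∈ P, x.1.map ℓ = faceWord Q p len x.2)
    {d : D} {i i' : Fin P.length} {j j' : ℕ} (h : At P d i j) (h' : At P (α d) i' j')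
    (hi : P[i].2.1 = 0) (hi' : P[i'].2.1 = 0)
    (hτ : (j : ZMod 2) + P[i].2.2 = (j' : ZMod 2) + P[i'].2.2)
    (hθ : 2 * p 0 ∣ Q 0 * j + P[i].2.2 * (Q 0 - 1) + (Q 0 * j' + P[i'].2.2 * (Q 0 - 1)) + 1) :
    ∃ x y P', P.Perm (x :: y :: P') ∧ x.2.1 = 0 ∧ y.2.1 = 0 ∧
      Sph (P'.map fun z => faceWord Q p len z.2) := by
  have hne : i ≠ i' := by
    intro hc
    rw [← hc] at hτ hθ
    have h1 : (j : ZMod 2) = j' := by simpa using hτ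
    rw [ZMod.natCast_eq_natCast_iff] at h1
    have h2 := (Dvd.intro _ rfl : (2 : ℤ) ∣ 2 * p 0).trans hθ
    obtain ⟨a, ha⟩ : (2 : ℤ) ∣ (j : ℤ) + j' := by
      have : j % 2 = j' % 2 := h1
      omega
    rw [show Q 0 * j + P[i].2.2 * (Q 0 - 1) + (Q 0 * j' + P[i].2.2 * (Q 0 - 1)) + 1 =
      2 * (Q 0 * a + P[i].2.2 * (Q 0 - 1)) + 1 by
        rw [mul_add 2, ← mul_assoc 2, mul_comm 2 (Q 0), mul_assoc (Q 0) 2, ← ha]; ring] at h2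
    omega
  obtain ⟨P', hP'⟩ := perm_pair hne
  refine ⟨_, _, P', hP', hi, hi', ?_⟩
  have h0 : len P[i].2.1 = len 0 := by rw [hi]
  have h0' : len P[i'].2.1 = len 0 := by rw [hi']
  have hpos : 0 < len 0 := by have := h.lt hw; omega
  have hlen2 : 2 ≤ len 0 := by
    obtain ⟨z, hz⟩ := hlen 0
    have h3 := hp 0
    have : 0 < z := by
      by_contra hc
      have : z ≤ 0 := by omega
      nlinarith
    have : (2 : ℤ) ≤ len 0 := by rw [hz]; nlinarith
    omega
  have r1 := h.rotate_cons hd hw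
  have r2 := h'.rotate_cons hd hw
  rw [h0] at r1
  rw [h0'] at r2
  set t := (List.range (len 0 - 1)).map fun k => (φ ^ (k + 1)) d with ht
  set t' := (List.range (len 0 - 1)).map fun k => (φ ^ (k + 1)) (α d) with ht'
  have hD : Diag φ α ℓ ((d :: t) :: (α d :: t') :: P'.map Prod.fst) := by
    refine hd.congr ?_ ?_
    · refine (hP'.map Prod.fst).flatten.trans ?_
      simp only [List.map_cons, List.flatten_cons]
      rw [← r1, ← r2]
      exact ((List.rotate_perm _ _).symm.append ((List.rotate_perm _ _).symm.append_right _))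
    · intro l hl
      rw [← r1, ← r2, List.mem_cons, List.mem_cons] at hl
      rcases hl with rfl | rfl | hl
      · exact (hd.face _ (List.mem_map_of_mem (List.getElem_mem i.2))).rotate _
      · exact (hd.face _ (List.mem_map_of_mem (List.getElem_mem i'.2))).rotate _
      · exact hd.face l ((hP'.map Prod.fst).mem_iff.2 (by simp only [List.map_cons, List.mem_cons]; exact Or.inr (Or.inr hl)))
  have hmir : t'.map ℓ = FreeGroup.invRev (t.map ℓ) := by
    rw [ht, ht', List.map_map, List.map_map, invRev_map_range]
    refine List.map_congr_left (fun k hk => ?_)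
    have hk := List.mem_range.1 hk
    simp only [Function.comp]
    rw [h.label_pow hp hlen hd hw, h'.label_pow hp hlen hd hw, hi, hi', flipLetter_lett (hp 0),
      ← hτ]
    have e1 : ((len 0 - 1 - 1 - k + 1 : ℕ) : ℤ) = len 0 - 1 - k := by omega
    have e2 : ((len 0 - 1 - 1 - k + 1 : ℕ) : ZMod 2) = ((k + 1 : ℕ) : ZMod 2) := by
      have h3 : ((len 0 - 1 - 1 - k + 1 : ℕ) : ZMod 2) = (((len 0 : ℤ) - 1 - k : ℤ) : ZMod 2) := by
        rw [← e1]; simp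
      rw [h3]; push_cast
      rw [cast_len hlen, show (0 : ZMod 2) - 1 - k = -(k + 1) by ring, neg_zmod_two]
    rw [e1, e2]
    refine lett_congr (hp 0) ?_ _
    obtain ⟨z, hz⟩ := hlen 0
    obtain ⟨z', hz'⟩ := hθ
    refine ⟨z' + Q 0 * z, ?_⟩
    rw [mul_add, ← hz', show 2 * p 0 * (Q 0 * z) = Q 0 * (2 * p 0 * z) by ring, ← hz]
    push_cast
    ring
  have hts : t ≠ [] := by
    rw [ht]
    intro hc
    have := congrArg List.length hc
    simp at this
    omega
  have := hD.sph_of_mirror hts hmir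
  rw [List.map_map] at this
  convert this using 1
  exact List.map_congr_left (fun z hz => (hw z (hP'.mem_iff.2 (by simp [hz]))).symm)

end Mirror
end Heckoid

namespace Heckoid
open Equiv List

lemma exists_zip {α β γ : Type} {f : α → γ} {g : β → γ} {l : List α} {m : List β}
    (h : l.map f = m.map g) : ∃ P : List (α × β), P.map Prod.fst = l ∧ P.map Prod.snd = m ∧
      ∀ x ∈ P, f x.1 = g x.2 := by
  induction l generalizing m with
  | nil =>
    rw [List.map_nil, eq_comm, List.map_eq_nil_iff] at h
    exact ⟨[], rfl, h.symm, by simp⟩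
  | cons a l ih =>
    rw [List.map_cons, eq_comm, List.map_eq_cons_iff] at h
    obtain ⟨b, m, rfl, h1, h2⟩ := h
    obtain ⟨P, rfl, rfl, h3⟩ := ih h2.symm
    refine ⟨(a, b) :: P, rfl, rfl, ?_⟩
    intro x hx
    rcases List.mem_cons.1 hx with rfl | hx
    exacts [h1.symm, h3 x hx]

lemma index_unique {α β : Type} [DecidableEq β] {l : List α} {f : α → β} {c : β}
    (h : (l.map f).count c = 1) {i j : Fin l.length} (hi : f l[i] = c) (hj : f l[j] = c) :
    i = j := by
  by_contra hne
  obtain ⟨l', hl'⟩ := perm_pair hne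
  rw [(hl'.map f).count_eq, List.map_cons, List.map_cons, hi, hj, List.count_cons_self,
    List.count_cons_self] at h
  omega

lemma subtypePerm_pow_coe {D : Type} {φ : Perm D} {A : D → Prop} (h : ∀ d, A (φ d) ↔ A d) (k : ℕ)
    (a : {d // A d}) : (((φ.subtypePerm h) ^ k) a).1 = (φ ^ k) a.1 := by
  induction k with
  | zero => rfl
  | succ k ih => rw [pow_succ', Perm.mul_apply, pow_succ', Perm.mul_apply, ← ih]; rfl

variable {Q p : Fin 3 → ℤ} {len : Fin 3 → ℕ}

/-- A reduced diagram on the sphere with two exceptional faces and relator faces, as a system of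
darts, together with the curvature estimate. -/
theorem exists_sphData (hp : ∀ c, 0 < p c) (hQ : ∀ c, 0 ≤ Q c) (hQp : ∀ c, Q c ≤ p c)
    (hlen : ∀ c, 2 * p c ∣ len c) (hlen' : ∀ c, c ≠ 0 → (len c : ℤ) = 2 * p c) (hT : 0 < len 0)
    {S : List (Fin 3 × ℕ)} (hsph : Sph (S.map (faceWord Q p len)))
    (h1 : (S.map Prod.fst).count 1 = 1) (h2 : (S.map Prod.fst).count 2 = 1)
    (hmin : ∀ x y S', S.Perm (x :: y :: S') → x.1 = 0 → y.1 = 0 →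
      ¬ Sph (S'.map (faceWord Q p len))) :
    ∃ (D : Type) (_ : Fintype D) (_ : DecidableEq D) (φ α : Perm D) (cls : D → Fin 3)
      (τ : D → ZMod 2) (θ : D → ℤ), SphData φ α cls Q p (len 0) τ θ ∧
      (∃ d, cls d = 1) ∧ (∃ d, cls d = 2) ∧
      len 0 * (Finset.univ.filter fun d => (α * φ) ((α * φ) d) ≠ d).card ≤
        4 * (Finset.univ.filter fun d => cls d = 0).card ∧
      ((∃ d, (α * φ) ((α * φ) d) ≠ d ∧ (α * φ) ((α * φ) ((α * φ) ((α * φ) d))) ≠ d) →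
        len 0 * (Finset.univ.filter fun d => (α * φ) ((α * φ) d) ≠ d).card <
          4 * (Finset.univ.filter fun d => cls d = 0).card) := by
  classical
  obtain ⟨D, _, _, φ, α, ℓ, fs, hd, hfs⟩ := hsph
  obtain ⟨P, rfl, rfl, hw⟩ := exists_zip hfs
  rw [List.map_map] at h1 h2
  have hpos : ∀ c, 0 < len c := by
    intro c
    by_cases hc : c = 0
    · rwa [hc]
    · have := hlen' c hc
      have := hp c
      omega
  have hnd := hd.nodup
  have hx : ∀ i : Fin P.length, ∀ j < len P[i].2.1, ∃ d, At P d i j := by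
    intro i j hj
    rw [← length_face hw] at hj
    exact ⟨_, List.getElem?_eq_getElem hj⟩
  have hidx : ∀ c, (P.map (Prod.fst ∘ Prod.snd)).count c = 1 → ∃ i : Fin P.length, P[i].2.1 = c := by
    intro c hc
    have : c ∈ P.map (Prod.fst ∘ Prod.snd) := List.count_pos_iff.1 (by omega)
    obtain ⟨x, hx, hxc⟩ := List.mem_map.1 this
    obtain ⟨i, hi, rfl⟩ := List.getElem_of_mem hx
    exact ⟨⟨i, hi⟩, hxc⟩
  have hα := hd.α_mem_iff
  have hφ := hd.mem_iff
  set A : D → Prop := fun d => d ∈ (P.map Prod.fst).flatten with hA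
  choose fi fj hat using fun a : {d // A d} => exists_at a.2
  have hat' : ∀ (a : {d // A d}) i j, At P a.1 i j → fi a = i ∧ fj a = j := fun a i j h =>
    (hat a).unique hnd h
  set φA := φ.subtypePerm hφ with hφA
  set αA := α.subtypePerm hα with hαA
  have hφc : ∀ a : {d // A d}, (φA a).1 = φ a.1 := fun _ => rfl
  have hαc : ∀ a : {d // A d}, (αA a).1 = α a.1 := fun _ => rfl
  have hnext : ∀ a, fi (φA a) = fi a ∧ fj (φA a) = (fj a + 1) % len P[fi a].2.1 := fun a =>
    hat' _ _ _ ((hat a).apply hd hw)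
  set cls : {d // A d} → Fin 3 := fun a => P[fi a].2.1 with hcls
  set τ : {d // A d} → ZMod 2 := fun a => (fj a : ZMod 2) + P[fi a].2.2 with hτ
  set θ : {d // A d} → ℤ := fun a => Q (cls a) * fj a + P[fi a].2.2 * (Q (cls a) - 1) with hθ
  have hlab : ∀ a, ℓ a.1 = lett (p (cls a)) (τ a) (θ a) := fun a => (hat a).label hw
  have hflip : ∀ a, τ (αA a) = τ a ∧
      (2 : ℤ) ∣ θ a / p (cls a) + θ (αA a) / p (cls (αA a)) + 1 := fun a => by
    have := hd.flip a.1 a.2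
    rw [← hαc, hlab, hlab] at this
    exact lett_eq_flip this
  have hsame : ∀ a b, fi a = fi b → φA.SameCycle a b := by
    intro a b hab
    rw [Perm.sameCycle_subtypePerm]
    have hb := (hat b).mem
    rw [← hab] at hb
    exact (hd.face _ (List.mem_map_of_mem (List.getElem_mem (fi a).2))).sameCycle (hat a).mem hb
  have hper : ∀ a, (φA ^ len (cls a)) a = a := fun a => by
    apply Subtype.ext
    rw [subtypePerm_pow_coe]
    exact (hat a).pow_len hd hw
  have hclsφ : ∀ a, cls (φA a) = cls a := fun a => by
    exact congrArg (fun i : Fin P.length => P[i].2.1) (hnext a).1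
  have hτφ : ∀ a, τ (φA a) = τ a + 1 := by
    intro a
    have := Nat.div_add_mod (fj a + 1) (len (cls a))
    have := congrArg (Nat.cast : ℕ → ZMod 2) this
    push_cast at this
    rw [cast_len hlen] at this
    have e1 : P[fi (φA a)].2.2 = P[fi a].2.2 :=
      congrArg (fun i : Fin P.length => P[i].2.2) (hnext a).1
    simp only [hτ]
    rw [e1, (hnext a).2]
    linear_combination this
  have hSph : SphData φA αA cls Q p (len 0) τ θ := by
    refine ⟨fun a => Subtype.ext (hd.invol a.1), hclsφ, hp, hQ, hQp, hτφ, fun a => (hflip a).1,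
      ?_, fun a => (hflip a).2, ?_, ?_, ?_, ?_⟩
    · intro a
      have h3 := Nat.div_add_mod (fj a + 1) (len (cls a))
      obtain ⟨z, hz⟩ := hlen (cls a)
      have h4 : (len (cls a) : ℤ) * (((fj a + 1) / len (cls a) : ℕ) : ℤ) +
        (((fj a + 1) % len (cls a) : ℕ) : ℤ) = fj a + 1 := by exact_mod_cast h3
      have h5 : θ (φA a) = Q (cls a) * (((fj a + 1) % len (cls a) : ℕ) : ℤ) +
          P[fi a].2.2 * (Q (cls a) - 1) := by
        have e1 : P[fi (φA a)].2.2 = P[fi a].2.2 :=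
          congrArg (fun i : Fin P.length => P[i].2.2) (hnext a).1
        simp only [hθ]
        rw [hclsφ, e1, (hnext a).2]
      refine ⟨-(Q (cls a) * z * (((fj a + 1) / len (cls a) : ℕ) : ℤ)), ?_⟩
      rw [h5]
      simp only [hθ]
      rw [show 2 * p (cls a) * -(Q (cls a) * z * (((fj a + 1) / len (cls a) : ℕ) : ℤ)) =
        - (Q (cls a) * ((2 * p (cls a) * z) * (((fj a + 1) / len (cls a) : ℕ) : ℤ))) by ring, ← hz]
      linear_combination Q (cls a) * h4
    · intro a b ha hab
      apply hsame
      have hc : cls a = 1 ∨ cls a = 2 := by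
        revert ha; generalize cls a = c; revert c; decide
      rcases hc with hc | hc
      · exact index_unique (f := Prod.fst ∘ Prod.snd) h1 hc (hab.trans hc)
      · exact index_unique (f := Prod.fst ∘ Prod.snd) h2 hc (hab.trans hc)
    · intro a ha
      rw [← hlen' _ ha, zpow_natCast]
      exact hper a
    · intro a ha
      have := hper a
      rw [ha] at this
      rw [zpow_natCast]
      exact this
    · intro a ha ha' hmir
      have e1 : At P (α a.1) (fi (αA a)) (fj (αA a)) := hat (αA a)
      simp only [hθ, ha, ha'] at hmir
      obtain ⟨x, y, P', q1, q2, q3, q4⟩ := sph_of_mirror hp hlen hd hw (hat a) e1 ha ha'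
        (hflip a).1.symm hmir
      refine hmin _ _ (P'.map Prod.snd) (q1.map Prod.snd) q2 q3 ?_
      rwa [List.map_map]
  have hex : ∀ i : Fin P.length, ∀ j < len P[i].2.1, ∃ a : {d // A d}, fi a = i ∧ fj a = j := by
    intro i j hj
    obtain ⟨d, hdd⟩ := hx i j hj
    exact ⟨⟨d, hdd.mem_flatten⟩, hat' _ _ _ hdd⟩
  have hexc : ∀ c, (P.map (Prod.fst ∘ Prod.snd)).count c = 1 → ∃ a, cls a = c := by
    intro c hc
    obtain ⟨i, hi⟩ := hidx c hc
    obtain ⟨a, ha, -⟩ := hex i 0 (hpos _)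
    refine ⟨a, ?_⟩
    exact (congrArg (fun i : Fin P.length => P[i].2.1) ha).trans hi
  refine ⟨{d // A d}, inferInstance, inferInstance, φA, αA, cls, τ, θ, hSph, hexc 1 h1, hexc 2 h2,
    ?_⟩
  obtain ⟨a0, -⟩ := hexc 1 h1
  have g1 := planar_restrict hd.planar A hα hφ
    (fun d hdd => by rw [hd.dead d hdd, hd.invol]) ⟨a0.1, a0.2⟩
  rw [← hφA, ← hαA] at g1
  have hντ : ∀ a, τ ((αA * φA) a) = τ a + 1 := fun a => by
    rw [Perm.mul_apply, (hflip _).1, hτφ]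
  have g2 : 2 * cyc αA ≤ Fintype.card {d // A d} := two_mul_cyc_le fun a ha => by
    have := (hflip a).2
    rw [ha] at this
    omega
  have z1 : ∀ x : ZMod 2, x + 1 ≠ x := by decide
  have z2 : ∀ x : ZMod 2, x + 1 + 1 + 1 ≠ x := by decide
  obtain ⟨g3, g4⟩ := four_mul_cyc_le (D := {d // A d}) (ν := αA * φA)
    (fun a ha => z1 (τ a) (by rw [← hντ, ha]))
    (fun a ha => z2 (τ a) (by rw [← hντ, ← hντ, ← hντ, ha]))
  have g5 : cyc φA ≤ P.length := by
    have := numClasses_le_card (X := Fin P.length) fi (S := Perm.SameCycle.setoid φA) hsame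
    rw [Fintype.card_fin] at this
    exact this
  simp only [← Nat.card_eq_fintype_card] at g1 g2 g3 g4
  set k := (Finset.univ.filter fun i : Fin P.length => P[i].2.1 = 0).card with hk
  have g6 : P.length ≤ k + 2 := by
    have hu : (Finset.univ : Finset (Fin P.length)) ⊆
        (Finset.univ.filter fun i : Fin P.length => P[i].2.1 = 0) ∪
        ((Finset.univ.filter fun i : Fin P.length => P[i].2.1 = 1) ∪
        (Finset.univ.filter fun i : Fin P.length => P[i].2.1 = 2)) := by
      intro i _
      simp only [Finset.mem_union, Finset.mem_filter, Finset.mem_univ, true_and]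
      generalize P[i].2.1 = c
      revert c; decide
    have l1 : (Finset.univ.filter fun i : Fin P.length => P[i].2.1 = 1).card ≤ 1 :=
      Finset.card_le_one.2 fun i hi j hj =>
        index_unique (f := Prod.fst ∘ Prod.snd) h1 (Finset.mem_filter.1 hi).2
          (Finset.mem_filter.1 hj).2
    have l2 : (Finset.univ.filter fun i : Fin P.length => P[i].2.1 = 2).card ≤ 1 :=
      Finset.card_le_one.2 fun i hi j hj =>
        index_unique (f := Prod.fst ∘ Prod.snd) h2 (Finset.mem_filter.1 hi).2
          (Finset.mem_filter.1 hj).2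
    have l3 := (Finset.card_le_card hu).trans (Finset.card_union_le _ _)
    have l4 := Finset.card_union_le (Finset.univ.filter fun i : Fin P.length => P[i].2.1 = 1)
      (Finset.univ.filter fun i : Fin P.length => P[i].2.1 = 2)
    rw [Finset.card_univ, Fintype.card_fin] at l3
    omega
  have g7 : k * len 0 ≤ (Finset.univ.filter fun a => cls a = 0).card := by
    choose g hg1 hg2 using hex
    rw [hk, ← Finset.card_range (len 0), ← Finset.card_product]
    refine Finset.card_le_card_of_injOn
      (fun x => if hx : x.2 < len P[x.1].2.1 then g x.1 x.2 hx else a0) ?_ ?_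
    · rintro ⟨i, j⟩ hij
      simp only [Finset.coe_product, Set.mem_prod, Finset.mem_coe, Finset.mem_filter,
        Finset.mem_univ, true_and, Finset.mem_range] at hij ⊢
      rw [dif_pos (by rw [hij.1]; exact hij.2)]
      exact (congrArg (fun i : Fin P.length => P[i].2.1) (hg1 _ _ _)).trans hij.1
    · rintro ⟨i, j⟩ hij ⟨i', j'⟩ hij' hh
      simp only [Finset.coe_product, Set.mem_prod, Finset.mem_coe, Finset.mem_filter,
        Finset.mem_univ, true_and, Finset.mem_range] at hij hij' hh
      rw [dif_pos (by rw [hij.1]; exact hij.2), dif_pos (by rw [hij'.1]; exact hij'.2)] at hh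
      have e1 := congrArg fi hh
      have e2 := congrArg fj hh
      rw [hg1, hg1] at e1
      rw [hg2, hg2] at e2
      rw [e1, e2]
  have e : ∀ i1 : DecidablePred fun d : {d // A d} => (αA * φA) ((αA * φA) d) ≠ d,
      (@Finset.filter _ _ i1 Finset.univ).card =
        Nat.card {d : {d // A d} // (αA * φA) ((αA * φA) d) ≠ d} := fun i1 => by
    rw [Nat.card_eq_fintype_card, Fintype.card_subtype]
  rw [e] at g3 g4 ⊢
  constructor
  · have g8 : Nat.card {d : {d // A d} // (αA * φA) ((αA * φA) d) ≠ d} ≤ 4 * k := by omega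
    nlinarith [hpos 0]
  · intro hex4
    have := g4 hex4
    have g9 : Nat.card {d : {d // A d} // (αA * φA) ((αA * φA) d) ≠ d} < 4 * k := by omega
    nlinarith [hpos 0]

end Heckoid

namespace Heckoid

/-- The pattern of vertices of valency at least four around a relator face: `St` marks the
starting points of arcs, `mc` is the kind of the faces across, `w` counts starting points, those
of arcs shared with a non-relator face twice. The integers `x`, `y` with `y - x = s` represent the
two residue classes modulo `P` of marked points, ordered according to the side of the kind. -/
structure FacePattern (St : ℤ → Prop) (mc : ℤ → Fin 3) (w : ℤ → ℕ) (n P : ℤ) (x s J : Fin 3 → ℤ)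
    : Prop where
  hn : 2 ≤ n
  s_pos : ∀ c, 0 < s c
  s_lt : ∀ c, s c < P
  J_pos : ∀ c, 1 ≤ J c
  J_le : ∀ c, J c ≤ 2 * n - 2
  St_period : ∀ y, St (y + 2 * n * P) ↔ St y
  mc_const : ∀ y, ¬ St (y + 1) → mc (y + 1) = mc y
  w_one : ∀ y, St y → 1 ≤ w y
  w_two : ∀ y, St y → mc y ≠ 0 → 2 ≤ w y
  rel : ∀ k l a b, k ≤ a → a ≤ l → k ≤ b → b ≤ l → (∀ i, k < i → i ≤ l → ¬ St i) → mc k = 0 →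
    P ∣ a - x 0 → P ∣ b - x 0 - s 0 → False
  special : ∀ k l a b, k ≤ a → a ≤ l → k ≤ b → b ≤ l → (∀ i, k < i → i ≤ l → ¬ St i) → mc k ≠ 0 →
    P ∣ a - x (mc k) → P ∣ b - x (mc k) - s (mc k) → b - a < s (mc k) + J (mc k) * P
  side : ∀ c c', (P ∣ x c - x c' ∧ s c = s c' ∧ J c = J c') ∨
    (P ∣ x c' - x c - s c ∧ s c + s c' = P ∧ J c + J c' = 2 * n - 1)

/-- Two kinds lie on the same side. -/
def SameSide (P : ℤ) (x s J : Fin 3 → ℤ) (c c' : Fin 3) : Prop :=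
  P ∣ x c - x c' ∧ s c = s c' ∧ J c = J c'

/-- `[y, b)` is an arc, of kind `c`, whose first mark of the first type is `e` and whose last
mark of the second type is `o`. -/
structure IsWin (St : ℤ → Prop) (P : ℤ) (x s : Fin 3 → ℤ) (c : Fin 3) (y b e o : ℤ) : Prop where
  left : St y
  right : St b
  lt : y < b
  none : ∀ i, y < i → i < b → ¬ St i
  le_e : y ≤ e
  e_lt : e < y + P
  e_lt' : e < b
  le_o : y ≤ o
  o_lt : o < b
  le_o' : b ≤ o + P
  mark_e : P ∣ e - x c
  mark_o : P ∣ o - x c - s c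

lemma exists_next {St : ℤ → Prop} {y z : ℤ} (hz : St z) (hyz : y < z) :
    ∃ b, y < b ∧ b ≤ z ∧ St b ∧ ∀ i, y < i → i < b → ¬ St i := by
  classical
  obtain ⟨b, ⟨h1, h2⟩, h3⟩ := Int.exists_least_of_bdd (P := fun b => y < b ∧ St b)
    ⟨y, fun b hb => hb.1.le⟩ ⟨z, hyz, hz⟩
  refine ⟨b, h1, h3 z ⟨hyz, hz⟩, h2, fun i hi hib hs => ?_⟩
  have := h3 i ⟨hi, hs⟩
  omega

lemma exists_first {P : ℤ} (hP : 0 < P) (x y : ℤ) : ∃ i, y ≤ x + P * i ∧ x + P * i < y + P := by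
  refine ⟨-((x - y) / P), ?_⟩
  have h1 := Int.mul_ediv_add_emod (x - y) P
  have h2 := Int.emod_nonneg (x - y) hP.ne'
  have h3 := Int.emod_lt_of_pos (x - y) hP
  constructor <;> nlinarith


namespace FacePattern
variable {St : ℤ → Prop} {mc : ℤ → Fin 3} {w : ℤ → ℕ} {n P : ℤ} {x s J : Fin 3 → ℤ}
  (h : FacePattern St mc w n P x s J)
include h

lemma P_pos : 0 < P := (h.s_pos 0).trans (h.s_lt 0)

/-- The alternatives for the arc starting at `0`, when it is shared with a non-relator face and
the face has no excess. -/
def Outcome (St : ℤ → Prop) (mc : ℤ → Fin 3) (n P : ℤ) (x s J : Fin 3 → ℤ) (b e o : ℤ) : Prop :=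
  (mc b = 0 ∧ mc (2 * n * P - 1) = 0 ∧ 2 ≤ J (mc 0) ∧ o - e = s (mc 0) + (J (mc 0) - 1) * P) ∨
  (mc b ≠ 0 ∧ mc (2 * n * P - 1) = mc b ∧ b < 2 * n * P ∧ (∀ i, b < i → i < 2 * n * P → ¬ St i) ∧
    ((¬ SameSide P x s J (mc b) (mc 0) ∧ o - e = s (mc 0) + (J (mc 0) - 1) * P) ∨
     (SameSide P x s J (mc b) (mc 0) ∧ (s (mc 0) ≤ o - e ∨ (2 ≤ J (mc 0) ∧
        ∃ e' o', IsWin St P x s (mc b) b (2 * n * P) e' o' ∧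
          o' - e' = s (mc b) + (J (mc b) - 1) * P)))))

lemma mc_arc {k l : ℤ} (hkl : k ≤ l) (hs : ∀ i, k < i → i ≤ l → ¬ St i) : mc l = mc k := by
  induction l, hkl using Int.leInduction with
  | base => rfl
  | succ l hl ih =>
    rw [h.mc_const l (hs _ (by omega) le_rfl)]
    exact ih (fun i a b => hs i a (by omega))

lemma rel_arc {c : Fin 3} {y z a b : ℤ} (hya : y ≤ a) (haz : a < z) (hyb : y ≤ b) (hbz : b < z)
    (hs : ∀ i, y < i → i < z → ¬ St i) (h0 : mc y = 0) (ha : P ∣ a - x c) (hb : P ∣ b - x c - s c) :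
    False := by
  rcases h.side 0 c with ⟨h1, h2, -⟩ | ⟨h1, h2, -⟩
  · refine h.rel y (z - 1) a b hya (by omega) hyb (by omega) (fun i u v => hs i u (by omega)) h0 ?_ ?_
    · have := dvd_sub ha h1; rwa [show a - x c - (x 0 - x c) = a - x 0 by ring] at this
    · have := dvd_sub hb h1
      rwa [h2, show b - x 0 - s c = b - x c - s c - (x 0 - x c) by ring]
  · refine h.rel y (z - 1) b a hyb (by omega) hya (by omega) (fun i u v => hs i u (by omega)) h0 ?_ ?_
    · have := dvd_add (dvd_add hb h1) (dvd_refl P)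
      rwa [show b - x c - s c + (x c - x 0 - s 0) + P = b - x 0 by rw [← h2]; ring] at this
    · have := dvd_add ha h1
      rwa [show a - x c + (x c - x 0 - s 0) = a - x 0 - s 0 by ring] at this

lemma rel_arc_length {y z : ℤ} (hs : ∀ i, y < i → i < z → ¬ St i) (h0 : mc y = 0) :
    z < y + P := by
  by_contra hz
  obtain ⟨i, hi⟩ := exists_first h.P_pos (x 0) y
  obtain ⟨j, hj⟩ := exists_first h.P_pos (x 0 + s 0) y
  exact h.rel_arc (c := 0) hi.1 (by omega) hj.1 (by omega) hs h0 ⟨i, by ring⟩ ⟨j, by ring⟩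

lemma all_rel (hrel : ∀ y, St y → mc y = 0) (h0 : St 0) {T : ℕ} (hT : (T : ℤ) = 2 * n * P) :
    5 ≤ ∑ i ∈ Finset.range T, w i := by
  have hP := h.P_pos
  have hn := h.hn
  have step : ∀ y : ℕ, St y → ∃ z : ℕ, y < z ∧ (z : ℤ) < y + P ∧ St z := by
    intro y hy
    obtain ⟨b, h1, -, h3, h4⟩ := exists_next ((h.St_period y).2 hy) (by nlinarith : (y : ℤ) < y + 2 * n * P)
    refine ⟨b.toNat, by omega, ?_, ?_⟩
    · have := h.rel_arc_length h4 (hrel y hy); omega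
    · rwa [Int.toNat_of_nonneg (by omega)]
  obtain ⟨a, a1, a2, a3⟩ := step 0 (by simpa using h0)
  obtain ⟨b, b1, b2, b3⟩ := step a a3
  obtain ⟨c, c1, c2, c3⟩ := step b b3
  obtain ⟨d, d1, d2, d3⟩ := step c c3
  have hd : d < T := by
    have : (d : ℤ) < T := by rw [hT]; push_cast at *; nlinarith
    omega
  have hsub : ({0, a, b, c, d} : Finset ℕ) ⊆ Finset.range T := by
    intro i hi
    simp only [Finset.mem_insert, Finset.mem_singleton] at hi
    rw [Finset.mem_range]; omega
  refine le_trans ?_ (Finset.sum_le_sum_of_subset hsub)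
  have w0 := h.w_one _ h0
  have wa := h.w_one _ a3
  have wb := h.w_one _ b3
  have wc := h.w_one _ c3
  have wd := h.w_one _ d3
  rw [Finset.sum_insert, Finset.sum_insert, Finset.sum_insert, Finset.sum_insert,
    Finset.sum_singleton]
  · push_cast; omega
  all_goals simp only [Finset.mem_insert, Finset.mem_singleton]; omega

lemma sum_ge_three {T : ℕ} {b c : ℤ} (h0 : 0 < b) (hbc : b < c) (hc : c < T) :
    w 0 + w b + w c ≤ ∑ i ∈ Finset.range T, w i := by
  obtain ⟨b', rfl⟩ := Int.eq_ofNat_of_zero_le h0.le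
  obtain ⟨c', rfl⟩ := Int.eq_ofNat_of_zero_le (h0.trans hbc).le
  have hsub : ({0, b', c'} : Finset ℕ) ⊆ Finset.range T := by
    intro i hi
    simp only [Finset.mem_insert, Finset.mem_singleton] at hi
    rw [Finset.mem_range]; omega
  refine le_trans ?_ (Finset.sum_le_sum_of_subset hsub)
  rw [Finset.sum_insert, Finset.sum_insert, Finset.sum_singleton]
  · push_cast; omega
  all_goals simp only [Finset.mem_insert, Finset.mem_singleton]; omega

lemma sum_ge_four {T : ℕ} {b c d : ℤ} (h0 : 0 < b) (hbc : b < c) (hcd : c < d) (hd : d < T) :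
    w 0 + w b + w c + w d ≤ ∑ i ∈ Finset.range T, w i := by
  obtain ⟨b', rfl⟩ := Int.eq_ofNat_of_zero_le h0.le
  obtain ⟨c', rfl⟩ := Int.eq_ofNat_of_zero_le (h0.trans hbc).le
  obtain ⟨d', rfl⟩ := Int.eq_ofNat_of_zero_le (h0.trans (hbc.trans hcd)).le
  have hsub : ({0, b', c', d'} : Finset ℕ) ⊆ Finset.range T := by
    intro i hi
    simp only [Finset.mem_insert, Finset.mem_singleton] at hi
    rw [Finset.mem_range]; omega
  refine le_trans ?_ (Finset.sum_le_sum_of_subset hsub)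
  rw [Finset.sum_insert, Finset.sum_insert, Finset.sum_insert, Finset.sum_singleton]
  · push_cast; omega
  all_goals simp only [Finset.mem_insert, Finset.mem_singleton]; omega

lemma sum_ge_two {T : ℕ} {b : ℤ} (h0 : 0 < b) (hc : b < T) :
    w 0 + w b ≤ ∑ i ∈ Finset.range T, w i := by
  obtain ⟨b', rfl⟩ := Int.eq_ofNat_of_zero_le h0.le
  have hsub : ({0, b'} : Finset ℕ) ⊆ Finset.range T := by
    intro i hi
    simp only [Finset.mem_insert, Finset.mem_singleton] at hi
    rw [Finset.mem_range]; omega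
  refine le_trans ?_ (Finset.sum_le_sum_of_subset hsub)
  rw [Finset.sum_insert, Finset.sum_singleton]
  · push_cast; omega
  all_goals simp only [Finset.mem_singleton]; omega

lemma special_arc {y z a b : ℤ} (hya : y ≤ a) (haz : a < z) (hyb : y ≤ b) (hbz : b < z)
    (hs : ∀ i, y < i → i < z → ¬ St i) (h0 : mc y ≠ 0) (ha : P ∣ a - x (mc y))
    (hb : P ∣ b - x (mc y) - s (mc y)) : b - a < s (mc y) + J (mc y) * P :=
  h.special y (z - 1) a b hya (by omega) hyb (by omega) (fun i u v => hs i u (by omega)) h0 ha hb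

set_option maxHeartbeats 1000000 in
/-- The main estimate for the pattern around a relator face. -/
lemma outcome (h0 : St 0) (hm : mc 0 ≠ 0) {T : ℕ} (hT : (T : ℤ) = 2 * n * P) :
    5 ≤ ∑ i ∈ Finset.range T, w i ∨ (4 ≤ ∑ i ∈ Finset.range T, w i ∧
      ∃ b e o, IsWin St P x s (mc 0) 0 b e o ∧ Outcome St mc n P x s J b e o) := by
  have hP := h.P_pos
  have hn := h.hn
  have hT0 : 0 < 2 * n * P := by positivity
  have hST : St (2 * n * P) := by have := (h.St_period 0).2 h0; rwa [zero_add] at this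
  have hmcT : ∀ {z}, St z → 0 < z → (∀ i, z < i → i < 2 * n * P → ¬ St i) → z < 2 * n * P →
      mc (2 * n * P - 1) = mc z := fun _ _ h1 h2 =>
    h.mc_arc (by omega) (fun i u v => h1 i u (by omega))
  obtain ⟨b, hb0, hbT, hSb, hnb⟩ := exists_next hST hT0
  obtain ⟨ie, he0, heP⟩ := exists_first hP (x (mc 0)) 0
  obtain ⟨io, hoP, hob⟩ := exists_first hP (x (mc 0) + s (mc 0)) (b - P)
  obtain ⟨e, he⟩ : ∃ e, e = x (mc 0) + P * ie := ⟨_, rfl⟩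
  obtain ⟨o, ho⟩ : ∃ o, o = x (mc 0) + s (mc 0) + P * io := ⟨_, rfl⟩
  rw [← he] at he0 heP
  rw [← ho] at hoP hob
  rw [sub_add_cancel] at hob
  have hs0 := h.s_pos (mc 0)
  have hs1 := h.s_lt (mc 0)
  have hJ0 := h.J_pos (mc 0)
  have hJ1 := h.J_le (mc 0)
  have hae : P ∣ e - x (mc 0) := ⟨ie, by rw [he]; ring⟩
  have hbo : P ∣ o - x (mc 0) - s (mc 0) := ⟨io, by rw [ho]; ring⟩
  obtain ⟨j, hj⟩ : ∃ j, j = io - ie := ⟨_, rfl⟩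
  have hoe : o - e = s (mc 0) + P * j := by rw [ho, he, hj]; ring
  have hjJ : j ≤ J (mc 0) - 1 := by
    by_contra hcon
    have hj1 : J (mc 0) ≤ j := by omega
    have h1 : P * J (mc 0) ≤ P * j := mul_le_mul_of_nonneg_left hj1 hP.le
    have h2 : 0 ≤ P * J (mc 0) := by positivity
    have := h.special_arc he0 (by omega) (by omega : 0 ≤ o) (by omega) hnb hm hae hbo
    nlinarith
  have hPj : P * j ≤ P * (2 * n - 3) := mul_le_mul_of_nonneg_left (by omega) hP.le
  have hwin : 0 ≤ j → IsWin St P x s (mc 0) 0 b e o := by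
    intro hj0
    have : 0 ≤ P * j := by positivity
    exact ⟨h0, hSb, hb0, hnb, he0, by omega, by omega, by omega, by omega, by omega, hae, hbo⟩
  have hw0 := h.w_two 0 h0 hm
  rcases hbT.eq_or_lt with hbT' | hbT'
  · exfalso
    subst hbT'
    nlinarith
  have hw1 := h.w_one b hSb
  obtain ⟨c, hbc, hcT, hSc, hnc⟩ := exists_next hST hbT'
  by_cases hmb : mc b = 0
  · -- the next arc is shared with a relator face
    have hB1 : P ∣ o + P - x (mc 0) - s (mc 0) := ⟨io + 1, by rw [ho]; ring⟩
    have hB2 : P ∣ o + 2 * P - x (mc 0) - s (mc 0) := ⟨io + 2, by rw [ho]; ring⟩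
    rcases hcT.eq_or_lt with hcT' | hcT'
    · exfalso
      refine h.rel_arc (c := mc 0) (a := e + 2 * n * P - P) (b := o + P) ?_ ?_ ?_ ?_ hnc hmb
        ⟨ie + 2 * n - 1, by rw [he]; ring⟩ hB1 <;> linarith
    have hw2 := h.w_one c hSc
    by_cases hmc : mc c = 0
    swap
    · left
      have hw2 := h.w_two c hSc hmc
      have := h.sum_ge_three hb0 hbc (by rw [hT]; exact hcT' : c < T)
      omega
    obtain ⟨d, hcd, hdT, hSd, hnd⟩ := exists_next hST hcT'
    rcases hdT.eq_or_lt with hdT' | hdT'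
    swap
    · left
      have hw3 := h.w_one d hSd
      have := h.sum_ge_four hb0 hbc hcd (by rw [hT]; exact hdT' : d < T)
      omega
    right
    have := h.sum_ge_three hb0 hbc (by rw [hT]; exact hcT' : c < T)
    refine ⟨by omega, b, e, o, ?_⟩
    have hj3 : j = 2 * n - 3 := by
      by_contra hne
      have hPj : P * j ≤ P * (2 * n - 4) := mul_le_mul_of_nonneg_left (by omega) hP.le
      have hA : P ∣ e + P * (j + 2) - x (mc 0) := ⟨ie + j + 2, by rw [he]; ring⟩
      by_cases h1 : e + P * (j + 2) < c
      · refine h.rel_arc (c := mc 0) (a := e + P * (j + 2)) (b := o + P) ?_ ?_ ?_ ?_ hnc hmb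
          hA hB1 <;> linarith
      · refine h.rel_arc (c := mc 0) (a := e + P * (j + 2)) (b := o + 2 * P) ?_ ?_ ?_ ?_ hnd hmc
          hA hB2 <;> linarith
    refine ⟨hwin (by omega), Or.inl ⟨hmb, ?_, by omega, ?_⟩⟩
    · subst hdT'
      rw [hmcT hSc (by omega) hnd hcT', hmc]
    · rw [hoe, show J (mc 0) = 2 * n - 2 by omega, hj3]; ring
  · have hw1 := h.w_two b hSb hmb
    rcases hcT.eq_or_lt with hcT' | hcT'
    swap
    · left
      have hw2 := h.w_one c hSc
      have := h.sum_ge_three hb0 hbc (by rw [hT]; exact hcT' : c < T)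
      omega
    right
    subst hcT'
    have := h.sum_ge_two hb0 (by rw [hT]; exact hbT' : b < T)
    refine ⟨by omega, b, e, o, ?_⟩
    by_cases hside : SameSide P x s J (mc b) (mc 0)
    · obtain ⟨hx, hs, hJ⟩ := hside
      by_cases hj0 : 0 ≤ j
      · refine ⟨hwin hj0, Or.inr ⟨hmb, hmcT hSb hb0 hnc hbT', hbT', hnc, Or.inr ⟨⟨hx, hs, hJ⟩, Or.inl ?_⟩⟩⟩
        have : 0 ≤ P * j := by positivity
        omega
      obtain ⟨ie2, he2, he2P⟩ := exists_first hP (x (mc 0)) b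
      obtain ⟨io2, ho2P, ho2⟩ := exists_first hP (x (mc 0) + s (mc 0)) (2 * n * P - P)
      obtain ⟨e2, he2'⟩ : ∃ e, e = x (mc 0) + P * ie2 := ⟨_, rfl⟩
      obtain ⟨o2, ho2'⟩ : ∃ o, o = x (mc 0) + s (mc 0) + P * io2 := ⟨_, rfl⟩
      rw [← he2'] at he2 he2P
      rw [← ho2'] at ho2P ho2
      rw [sub_add_cancel] at ho2
      have hae2 : P ∣ e2 - x (mc b) := by
        have : P ∣ e2 - x (mc 0) := ⟨ie2, by rw [he2']; ring⟩
        have := dvd_sub this hx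
        rwa [show e2 - x (mc 0) - (x (mc b) - x (mc 0)) = e2 - x (mc b) by ring] at this
      have hbo2 : P ∣ o2 - x (mc b) - s (mc b) := by
        have : P ∣ o2 - x (mc 0) - s (mc 0) := ⟨io2, by rw [ho2']; ring⟩
        have := dvd_sub this hx
        rwa [hs, show o2 - x (mc b) - s (mc 0) =
          o2 - x (mc 0) - s (mc 0) - (x (mc b) - x (mc 0)) by ring]
      obtain ⟨j2, hj2⟩ : ∃ j, j = io2 - ie2 := ⟨_, rfl⟩
      have hoe2 : o2 - e2 = s (mc 0) + P * j2 := by rw [ho2', he2', hj2]; ring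
      have hjJ2 : j2 ≤ J (mc 0) - 1 := by
        by_contra hcon
        have hj1 : J (mc 0) ≤ j2 := by omega
        have h1 : P * J (mc 0) ≤ P * j2 := mul_le_mul_of_nonneg_left hj1 hP.le
        have h2 : 0 ≤ P * J (mc 0) := by positivity
        have := h.special_arc he2 (by omega) (by omega : b ≤ o2) (by omega) hnc hmb hae2 hbo2
        rw [hs, hJ] at this
        nlinarith
      have k1 : ie2 - io ≤ 2 := by
        by_contra hcon
        have : P * 3 ≤ P * (ie2 - io) := mul_le_mul_of_nonneg_left (by omega) hP.le
        nlinarith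
      have k2 : ie - io2 + 2 * n ≤ 2 := by
        by_contra hcon
        have : P * 3 ≤ P * (ie - io2 + 2 * n) := mul_le_mul_of_nonneg_left (by omega) hP.le
        nlinarith
      have l1 : j = -1 := by omega
      have l2 : j2 = 2 * n - 3 := by omega
      have l3 : J (mc 0) = 2 * n - 2 := by omega
      have l4 : ie2 = ie + 1 := by omega
      have l5 : io2 = io + 2 * n - 1 := by omega
      have m1 : e2 = e + P := by rw [he2', he, l4]; ring
      have m2 : o2 = o + 2 * n * P - P := by rw [ho2', ho, l5]; ring
      have m3 : o2 - e2 = s (mc 0) + (2 * n - 3) * P := by rw [hoe2, l2]; ring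
      have m4 : P ≤ (2 * n - 3) * P := by nlinarith
      refine ⟨⟨h0, hSb, hb0, hnb, he0, by omega, by omega, by omega, hob, by omega, hae, hbo⟩,
        Or.inr ⟨hmb, hmcT hSb hb0 hnc hbT', hbT', hnc, Or.inr ⟨⟨hx, hs, hJ⟩,
        Or.inr ⟨by omega, e2, o2,
          ⟨hSb, hST, hbT', hnc, he2, he2P, by omega, by omega, ho2, by omega, hae2, hbo2⟩, ?_⟩⟩⟩⟩
      rw [hs, hJ, m3, l3]; ring
    · have hside' := (h.side (mc b) (mc 0)).resolve_left hside
      obtain ⟨hx, hs, hJ⟩ := hside'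
      have key := h.special_arc (y := b) (z := 2 * n * P) (a := o + P) (b := e + 2 * n * P - P)
        (by omega) (by linarith) (by linarith) (by linarith) hnc hmb
        (by
          have h1 := dvd_add hbo (dvd_add hx (dvd_refl P))
          have h2 : o - x (mc 0) - s (mc 0) + (x (mc 0) - x (mc b) - s (mc b) + P) =
            o + P - x (mc b) - P := by rw [← hs]; ring
          rw [h2] at h1
          have := dvd_add h1 (dvd_refl P)
          rwa [sub_add_cancel] at this)
        (by
          have h1 := dvd_add hae (dvd_add hx (Dvd.intro (2 * n - 1) rfl : P ∣ P * (2 * n - 1)))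
          rwa [show e - x (mc 0) + (x (mc 0) - x (mc b) - s (mc b) + P * (2 * n - 1)) =
            e + 2 * n * P - P - x (mc b) - s (mc b) by ring] at h1)
      have hj4 : j = J (mc 0) - 1 := by
        by_contra hne
        have : P * j ≤ P * (J (mc 0) - 2) := mul_le_mul_of_nonneg_left (by omega) hP.le
        have e1 : J (mc b) = 2 * n - 1 - J (mc 0) := by omega
        have e2 : s (mc b) = P - s (mc 0) := by omega
        rw [e1, e2] at key
        linarith
      refine ⟨hwin (by omega), Or.inr ⟨hmb, hmcT hSb hb0 hnc hbT', hbT', hnc, Or.inl ⟨hside, ?_⟩⟩⟩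
      rw [hoe, hj4]; ring

end FacePattern
end Heckoid

namespace Heckoid

/-- The pattern along a non-relator face all of whose mates are relators: `G` marks the corners at
vertices of valency at least four, `v` is the drift, `A` and `B` are the two kinds of marks. -/
structure LinePattern (G : ℤ → Prop) (v : ℤ → ℤ) (A B : ℤ → Prop) (P s q Δ : ℤ) : Prop where
  s_pos : 0 < s
  s_lt : s < P
  q_pos : 0 < q
  Δ_pos : 0 < Δ
  G_period : ∀ k, G (k + 2 * q) ↔ G k
  v_period : ∀ k, v (k + 2 * q) = v k + 2 * Δ
  v_const : ∀ k, ¬ G k → v (k + 1) = v k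
  star : ∀ k l, A k → B l → Δ * (l - k) < q * (v l - v k + 1)
  congr : ∀ k l, A k → B l → P ∣ l - k - s * (1 + v l - v k)

/-- `(y, g]` is a window between consecutive large corners, with first mark `a` of the first kind
and last mark `b` of the second kind. -/
structure IsLineWin (G : ℤ → Prop) (A B : ℤ → Prop) (P : ℤ) (y g a b : ℤ) : Prop where
  left : G y
  right : G g
  lt : y < g
  none : ∀ i, y < i → i < g → ¬ G i
  lt_a : y < a
  a_le : a ≤ g
  a_le' : a ≤ y + P
  mark_a : A a
  lt_b : y < b
  b_le : b ≤ g
  g_lt : g < b + P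
  mark_b : B b

namespace LinePattern
variable {G : ℤ → Prop} {v : ℤ → ℤ} {A B : ℤ → Prop} {P s q Δ : ℤ}
  (h : LinePattern G v A B P s q Δ)
include h

lemma v_arc {k l : ℤ} (hkl : k ≤ l) (hs : ∀ i, k ≤ i → i < l → ¬ G i) : v l = v k := by
  induction l, hkl using Int.leInduction with
  | base => rfl
  | succ l hl ih =>
    rw [h.v_const l (hs _ hl (by omega))]
    exact ih (fun i a b => hs i a (by omega))

lemma v_win {y g a b : ℤ} (hw : IsLineWin G A B P y g a b) {k : ℤ} (h1 : y < k) (h2 : k ≤ g) :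
    v k = v g :=
  (h.v_arc h2 (fun i u w => hw.none i (by omega) w)).symm

lemma v_add_mul (k : ℤ) (N : ℕ) : v (k + N * (2 * q)) = v k + N * (2 * Δ) := by
  induction N with
  | zero => simp
  | succ N ih =>
    have := h.v_period (k + N * (2 * q))
    rw [ih] at this
    push_cast
    rw [show k + (N + 1) * (2 * q) = k + N * (2 * q) + 2 * q by ring, this]; ring

lemma G_add_mul (k : ℤ) (N : ℕ) : G (k + N * (2 * q)) ↔ G k := by
  induction N with
  | zero => simp
  | succ N ih =>
    rw [show k + ((N + 1 : ℕ) : ℤ) * (2 * q) = k + N * (2 * q) + 2 * q by push_cast; ring]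
    exact (h.G_period _).trans ih

lemma next_win (hwin : ∀ g, G g → ∃ y a b, IsLineWin G A B P y g a b) {g : ℤ} (hg : G g) :
    ∃ g' a b, IsLineWin G A B P g g' a b := by
  classical
  obtain ⟨g', ⟨h1, h2⟩, h3⟩ := Int.exists_least_of_bdd (P := fun b => g < b ∧ G b)
    ⟨g, fun b hb => hb.1.le⟩ ⟨g + 2 * q, by have := h.q_pos; omega, (h.G_period g).2 hg⟩
  obtain ⟨y, a, b, hw⟩ := hwin g' h2
  have : y = g := by
    have e1 : ¬ g < y := fun hc => by have := h3 y ⟨hc, hw.left⟩; have := hw.lt; omega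
    have e2 : ¬ y < g := fun hc => hw.none g hc h1 hg
    omega
  subst this
  exact ⟨g', a, b, hw⟩

lemma gap_nonneg {y g z a b a' b' : ℤ} (hw : IsLineWin G A B P y g a b)
    (hw' : IsLineWin G A B P g z a' b') : 0 ≤ v (g + 1) - v g := by
  have h1 := h.star a b' hw.mark_a hw'.mark_b
  rw [h.v_win hw hw.lt_a hw.a_le, h.v_win hw' hw'.lt_b hw'.b_le,
    ← h.v_win hw' (by omega : g < g + 1) (by have := hw'.lt; omega)] at h1
  have h2 : a < b' := by have := hw.a_le; have := hw'.lt_b; omega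
  have h3 : 0 ≤ Δ * (b' - a) := mul_nonneg h.Δ_pos.le (by omega)
  have := h.q_pos
  by_contra hc
  have : v (g+1) - v g + 1 ≤ 0 := by omega
  nlinarith

lemma gap_le {y g z a b a' b' : ℤ} (hw : IsLineWin G A B P y g a b)
    (hw' : IsLineWin G A B P g z a' b') :
    (v (g + 1) - v g - 1) * q < Δ * (a' - b) ∧ 1 ≤ a' - b ∧ a' - b ≤ 2 * P - 1 ∧
      P ∣ a' - b - s * (v (g + 1) - v g - 1) := by
  have h1 := h.star a' b hw'.mark_a hw.mark_b
  have h2 := h.congr a' b hw'.mark_a hw.mark_b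
  rw [h.v_win hw hw.lt_b hw.b_le, h.v_win hw' hw'.lt_a hw'.a_le,
    ← h.v_win hw' (by omega : g < g + 1) (by have := hw'.lt; omega)] at h1 h2
  refine ⟨by linarith, by have := hw.b_le; have := hw'.lt_a; omega,
    by have := hw.g_lt; have := hw'.a_le'; omega, ?_⟩
  obtain ⟨i, hi⟩ := h2
  exact ⟨-i, by linarith⟩

/-- Gaps are small if windows are at least as long as the distance of the classes of marks. -/
lemma gap_lt (hs2 : 2 ≤ s) (hq : Δ * s < q) {y g z a b a' b' : ℤ} (hw : IsLineWin G A B P y g a b)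
    (hw' : IsLineWin G A B P g z a' b') : v (g + 1) - v g ≤ P - 1 := by
  obtain ⟨h1, h2, h3, h4⟩ := h.gap_le hw hw'
  by_contra hc
  set d := v (g + 1) - v g
  have hΔ := h.Δ_pos
  have hsP := h.s_lt
  have k1 : (d - 1) * s < a' - b := by
    by_contra hcon
    have : Δ * (a' - b) ≤ Δ * ((d - 1) * s) := mul_le_mul_of_nonneg_left (by omega) hΔ.le
    have : (d - 1) * (Δ * s) ≤ (d - 1) * q := mul_le_mul_of_nonneg_left hq.le (by omega)
    nlinarith
  have k2 : (P - 1) * 2 ≤ (d - 1) * s := mul_le_mul (by omega) hs2 (by omega) (by omega)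
  have k3 : a' - b - s * (d - 1) = 1 := by
    have : s * (d - 1) = (d - 1) * s := mul_comm _ _
    omega
  rw [k3] at h4
  have := Int.le_of_dvd one_pos h4
  omega

lemma full_step {J : ℤ} (hJ : 2 ≤ J)
    (hfull : ∀ y g a b, IsLineWin G A B P y g a b → b - a = s + (J - 1) * P)
    {y g z a b a' b' : ℤ} (hw : IsLineWin G A B P y g a b) (hw' : IsLineWin G A B P g z a' b') :
    a - (s + J * P) * v g ≤ a' - (s + J * P) * v z := by
  have h0 := h.gap_nonneg hw hw'
  obtain ⟨h1, h2, h3, h4⟩ := h.gap_le hw hw'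
  have hvz : v (g + 1) = v z := h.v_win hw' (by omega) (by have := hw'.lt; omega)
  have hf := hfull _ _ _ _ hw
  have hst := h.star a b hw.mark_a hw.mark_b
  rw [h.v_win hw hw.lt_a hw.a_le, h.v_win hw hw.lt_b hw.b_le, hf] at hst
  set d := v (g + 1) - v g with hd
  have hΔ := h.Δ_pos
  have hsP := h.s_lt
  have hs0 := h.s_pos
  have hJP : P ≤ (J - 1) * P := by nlinarith
  have hq1 : Δ * (s + P) < q := by
    have : Δ * (s + P) ≤ Δ * (s + (J - 1) * P) := mul_le_mul_of_nonneg_left (by omega) hΔ.le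
    linarith
  have hd1 : d ≤ 1 := by
    by_contra hc
    have k1 : (d - 1) * (s + P) < a' - b := by
      by_contra hcon
      have : Δ * (a' - b) ≤ Δ * ((d - 1) * (s + P)) := mul_le_mul_of_nonneg_left (by omega) hΔ.le
      have : (d - 1) * (Δ * (s + P)) ≤ (d - 1) * q := mul_le_mul_of_nonneg_left hq1.le (by omega)
      nlinarith
    have hd2 : d = 2 := by
      by_contra hne
      have : 2 * (s + P) ≤ (d - 1) * (s + P) := mul_le_mul_of_nonneg_right (by omega) (by omega)
      omega
    rw [hd2] at h4 k1
    obtain ⟨i, hi⟩ := h4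
    have i1 : 1 < i := by by_contra hcon
                          have : P * i ≤ P * 1 := mul_le_mul_of_nonneg_left (by omega) (by omega)
                          omega
    have : P * 2 ≤ P * i := mul_le_mul_of_nonneg_left (by omega) (by omega)
    omega
  have hcases : d = 0 ∨ d = 1 := by omega
  rcases hcases with h' | h'
  · have : v z = v g := by omega
    rw [this]
    have : a ≤ a' := by omega
    omega
  · have e1 : v z = v g + 1 := by omega
    rw [h'] at h4
    simp only [sub_self, mul_zero, sub_zero] at h4
    have := Int.le_of_dvd (by omega) h4
    rw [e1]
    nlinarith

/-- Not all windows can have the maximal length. -/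
lemma not_full {J : ℤ} (hJ : 2 ≤ J) (hq : q < Δ * (s + J * P)) (hG : ∃ g, G g)
    (hwin : ∀ g, G g → ∃ y a b, IsLineWin G A B P y g a b)
    (hfull : ∀ y g a b, IsLineWin G A B P y g a b → b - a = s + (J - 1) * P) : False := by
  have main : ∀ m : ℕ, ∀ g g' y y' a b a' b' : ℤ, g' - g ≤ m → g ≤ g' → IsLineWin G A B P y g a b →
      IsLineWin G A B P y' g' a' b' → a - (s + J * P) * v g ≤ a' - (s + J * P) * v g' := by
    intro m
    induction m with
    | zero =>
      intro g g' y y' a b a' b' h1 h2 hw hw'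
      obtain rfl : g = g' := by push_cast at h1; omega
      obtain rfl : y = y' := by
        have e1 : ¬ y < y' := fun hc => hw.none y' hc hw'.lt hw'.left
        have e2 : ¬ y' < y := fun hc => hw'.none y hc hw.lt hw.left
        omega
      have hdvd : P ∣ a - a' := by
        have e1 := h.congr a b hw.mark_a hw.mark_b
        have e2 := h.congr a' b hw'.mark_a hw.mark_b
        rw [h.v_win hw hw.lt_a hw.a_le, h.v_win hw hw.lt_b hw.b_le] at e1
        rw [h.v_win hw hw'.lt_a hw'.a_le, h.v_win hw hw.lt_b hw.b_le] at e2
        obtain ⟨i, hi⟩ := e1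
        obtain ⟨j, hj⟩ := e2
        exact ⟨j - i, by linarith⟩
      have : a - a' = 0 := by
        refine Int.eq_zero_of_abs_lt_dvd hdvd ?_
        rw [abs_lt]
        have := hw.lt_a; have := hw.a_le'; have := hw'.lt_a; have := hw'.a_le'
        constructor <;> omega
      have : a = a' := by omega
      rw [this]
    | succ m ih =>
      intro g g' y y' a b a' b' h1 h2 hw hw'
      rcases h2.eq_or_lt with rfl | h2
      · exact ih g g y y' a b a' b' (by omega) le_rfl hw hw'
      · obtain ⟨z, a2, b2, hw2⟩ := h.next_win hwin hw.right
        have hz : z ≤ g' := by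
          by_contra hc
          exact hw2.none g' h2 (by omega) hw'.right
        have := hw2.lt
        exact (h.full_step hJ hfull hw hw2).trans
          (ih z g' g y' a2 b2 a' b' (by push_cast at h1; omega) hz hw2 hw')
  obtain ⟨g, hg⟩ := hG
  obtain ⟨y, a, b, hw⟩ := hwin g hg
  obtain ⟨N, hN⟩ : ∃ N : ℕ, g - a < N := ⟨(g - a).toNat + 1, by omega⟩
  obtain ⟨y', a', b', hw'⟩ := hwin _ ((h.G_add_mul g N).2 hg)
  have hNq : (0 : ℤ) ≤ N * (2 * q) := by have := h.q_pos; positivity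
  have key := main (N * (2 * q)).toNat g _ y y' a b a' b' (by omega) (by omega) hw hw'
  rw [h.v_add_mul] at key
  have h1 := hw'.a_le
  have h2 : (N : ℤ) * (2 * (q + 1)) ≤ N * (2 * (Δ * (s + J * P))) :=
    mul_le_mul_of_nonneg_left (by omega) (by omega)
  have h3 := hw.a_le
  nlinarith

end LinePattern
end Heckoid

namespace Heckoid
open Equiv

/-- The discriminant of the slope `Q c / p c` with respect to the slope of the relator. -/
def disc (Q p : Fin 3 → ℤ) (c : Fin 3) : ℤ := p 0 * Q c - Q 0 * p c

/-- The value attached to the side of the relator slope on which the slope of kind `c` lies. -/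
def bySide (Q p : Fin 3 → ℤ) (u v : ℤ) (c : Fin 3) : ℤ := if 0 ≤ disc Q p c then u else v

/-- The arithmetic relations between the slope of the relator and the two other slopes: `pp` and
`pm` are the denominators of the neighbours of the slope of the relator. -/
structure Slopes (Q p : Fin 3 → ℤ) (n pp pm Jp Jm : ℤ) : Prop where
  hn : 2 ≤ n
  add : pp + pm = p 0
  two_le_pp : 2 ≤ pp
  two_le_pm : 2 ≤ pm
  Jadd : Jp + Jm = 2 * n - 1
  Jp_pos : 1 ≤ Jp
  Jm_pos : 1 ≤ Jm
  dvd : p 0 ∣ Q 0 * pp + 1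
  disc_ne : ∀ c, c ≠ 0 → disc Q p c ≠ 0
  ne : p 1 * Q 2 ≠ Q 1 * p 2
  le_above : ∀ c, 0 < disc Q p c → p c ≤ disc Q p c * (pp + Jp * p 0)
  lt_above : ∀ c, 0 < disc Q p c → 2 ≤ Jp → p c < disc Q p c * (pp + Jp * p 0)
  le_below : ∀ c, disc Q p c < 0 → p c ≤ -disc Q p c * (pm + Jm * p 0)
  lt_below : ∀ c, disc Q p c < 0 → 2 ≤ Jm → p c < -disc Q p c * (pm + Jm * p 0)

/-- The residue of the marks of the first type on a relator face of phase `t`. -/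
def mark (Q p : Fin 3 → ℤ) (pp t : ℤ) (c : Fin 3) : ℤ := pp * t + bySide Q p 0 pp c

/-- Start of an arc. -/
def Start {D : Type} (φ α : Perm D) (d : D) (y : ℤ) : Prop :=
  ¬ SphData.Small φ α ((φ ^ (y - 1)) d)

/-- Weight of a dart as a starting point of an arc. -/
noncomputable def wt {D : Type} (φ α : Perm D) (cls : D → Fin 3) (d : D) : ℕ :=
  open scoped Classical in
  if SphData.Small φ α (φ⁻¹ d) then 0 else if cls (α d) = 0 then 1 else 2

namespace Slopes
variable {Q p : Fin 3 → ℤ} {n pp pm Jp Jm : ℤ} (g : Slopes Q p n pp pm Jp Jm)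
include g

lemma mark_zero_iff (t y : ℤ) : p 0 ∣ t + Q 0 * y ↔ p 0 ∣ y - pp * t := by
  constructor
  · intro h
    have := dvd_sub (dvd_mul_of_dvd_left g.dvd y) (dvd_mul_of_dvd_right h pp)
    rwa [show (Q 0 * pp + 1) * y - pp * (t + Q 0 * y) = y - pp * t by ring] at this
  · intro h
    have := dvd_add (dvd_mul_of_dvd_left g.dvd t) (dvd_mul_of_dvd_right h (Q 0))
    rwa [show (Q 0 * pp + 1) * t + Q 0 * (y - pp * t) = t + Q 0 * y by ring] at this

lemma mark_one_iff (t y : ℤ) : p 0 ∣ t + Q 0 * y + 1 ↔ p 0 ∣ y - pp * t - pp := by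
  rw [show t + Q 0 * y + 1 = (t + 1) + Q 0 * y by ring, g.mark_zero_iff,
    show y - pp * t - pp = y - pp * (t + 1) by ring]

lemma first_iff (t y : ℤ) (c : Fin 3) : p 0 ∣ y - mark Q p pp t c ↔
    (0 ≤ disc Q p c ∧ p 0 ∣ t + Q 0 * y) ∨ (disc Q p c < 0 ∧ p 0 ∣ t + Q 0 * y + 1) := by
  rw [g.mark_zero_iff, g.mark_one_iff]
  unfold mark bySide
  split_ifs with hc
  · simp [hc, not_lt.2 hc]
  · simp [hc, not_le.1 hc, sub_add_eq_sub_sub]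

lemma second_iff (t y : ℤ) (c : Fin 3) : p 0 ∣ y - mark Q p pp t c - bySide Q p pp pm c ↔
    (0 ≤ disc Q p c ∧ p 0 ∣ t + Q 0 * y + 1) ∨ (disc Q p c < 0 ∧ p 0 ∣ t + Q 0 * y) := by
  rw [g.mark_zero_iff, g.mark_one_iff]
  unfold mark bySide
  split_ifs with hc
  · simp [hc, not_lt.2 hc]
  · have e : y - (pp * t + pp) - pm = y - pp * t - p 0 := by rw [← g.add]; ring
    simp [hc, not_le.1 hc, e]

end Slopes

namespace SphData
variable {D : Type} {φ α : Perm D} {cls : D → Fin 3} {Q p : Fin 3 → ℤ} {T : ℕ}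
    {τ : D → ZMod 2} {θ : D → ℤ} {n pp pm Jp Jm : ℤ}

lemma zpow_succ_apply (φ : Perm D) (k : ℤ) (d : D) : (φ ^ (k + 1)) d = φ ((φ ^ k) d) := by
  rw [add_comm, zpow_add, zpow_one, Perm.mul_apply]

lemma start_succ {d : D} {y : ℤ} (h : ¬ Start φ α d (y + 1)) : Small φ α ((φ ^ y) d) := by
  unfold Start at h
  rwa [not_not, add_sub_cancel_right] at h

variable (h : SphData φ α cls Q p T τ θ) (g : Slopes Q p n pp pm Jp Jm)
include h g

lemma facePattern (hT : (T : ℤ) = 2 * n * p 0) {d : D} (hd : cls d = 0) :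
    FacePattern (Start φ α d) (fun y => cls (α ((φ ^ y) d))) (fun y => wt φ α cls ((φ ^ y) d)) n
      (p 0) (mark Q p pp (θ d)) (bySide Q p pp pm) (bySide Q p Jp Jm) where
  hn := g.hn
  s_pos c := by
    have := g.two_le_pp; have := g.two_le_pm
    unfold bySide; split_ifs <;> omega
  s_lt c := by
    have := g.two_le_pp; have := g.two_le_pm; have := g.add
    unfold bySide; split_ifs <;> omega
  J_pos c := by
    have := g.Jp_pos; have := g.Jm_pos
    unfold bySide; split_ifs <;> omega
  J_le c := by
    have := g.Jp_pos; have := g.Jm_pos; have := g.Jadd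
    unfold bySide; split_ifs <;> omega
  St_period y := by
    unfold Start
    rw [← hT, show y + T - 1 = (y - 1) + T by ring, h.zpow_period_rel hd]
  mc_const y hy := by
    have := start_succ hy
    unfold Small at this
    rw [zpow_succ_apply, this, h.cls_inv]
  w_one y hy := by
    unfold Start at hy
    have e : (φ ^ (y - 1)) d = φ⁻¹ ((φ ^ y) d) := by
      rw [← zpow_neg_one, ← Perm.mul_apply, ← zpow_add]; congr 2; ring
    rw [e] at hy
    unfold wt
    rw [if_neg hy]
    split_ifs <;> omega
  w_two y hy hm := by
    unfold Start at hy
    have e : (φ ^ (y - 1)) d = φ⁻¹ ((φ ^ y) d) := by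
      rw [← zpow_neg_one, ← Perm.mul_apply, ← zpow_add]; congr 2; ring
    rw [e] at hy
    unfold wt
    rw [if_neg hy, if_neg hm]
  rel k l a b ka al kb bl hs h0 ha hb := by
    have hs' : ∀ i, k ≤ i → i < l → Small φ α ((φ ^ i) d) := fun i u v =>
      start_succ (hs (i + 1) (by omega) (by omega))
    have e : 0 ≤ disc Q p 0 := by unfold disc; rw [mul_comm]; simp
    rw [g.first_iff] at ha
    rw [g.second_iff] at hb
    simp only [e, not_lt.2 e, true_and, false_and, or_false] at ha hb
    exact h.rel_rel_marks hd ⟨ka, kb⟩ ⟨al, bl⟩ h0 hs' ha hb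
  special k l a b ka al kb bl hs h0 ha hb := by
    have hs' : ∀ i, k ≤ i → i < l → Small φ α ((φ ^ i) d) := fun i u v =>
      start_succ (hs (i + 1) (by omega) (by omega))
    have hne := g.disc_ne _ h0
    beta_reduce at *
    generalize hc : cls (α ((φ ^ k) d)) = c at *
    rw [g.first_iff] at ha
    rw [g.second_iff] at hb
    rcases lt_or_gt_of_ne hne with hΔ | hΔ
    · simp only [hΔ, not_le.2 hΔ, true_and, false_and, false_or] at ha hb
      have := h.rel_marks hd ⟨kb, ka⟩ ⟨bl, al⟩ hc hs' hb ha
      have h2 := g.le_below c hΔ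
      have e : (p 0 * Q c - Q 0 * p c) = disc Q p c := rfl
      rw [e] at this
      simp only [bySide, if_neg (not_le.2 hΔ)]
      by_contra hcon
      nlinarith
    · simp only [hΔ.le, not_lt.2 hΔ.le, true_and, false_and, or_false] at ha hb
      have := h.rel_marks hd ⟨ka, kb⟩ ⟨al, bl⟩ hc hs' ha hb
      have h2 := g.le_above c hΔ
      have e : (p 0 * Q c - Q 0 * p c) = disc Q p c := rfl
      rw [e] at this
      simp only [bySide, if_pos hΔ.le]
      by_contra hcon
      nlinarith
  side c c' := by
    have := g.add; have := g.Jadd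
    unfold mark bySide
    split_ifs
    · left; simp
    · right
      refine ⟨by ring_nf; simp, by omega, by omega⟩
    · right
      refine ⟨⟨-1, ?_⟩, by omega, by omega⟩
      rw [← g.add]; ring
    · left; simp

end SphData
end Heckoid

namespace Heckoid
open Equiv

namespace FacePattern
variable {St : ℤ → Prop} {mc : ℤ → Fin 3} {w : ℤ → ℕ} {n P : ℤ} {x s J : Fin 3 → ℤ}

lemma exists_start (h : FacePattern St mc w n P x s J) : ∃ y, St y := by
  by_contra! hno
  obtain ⟨i, hi, -⟩ := exists_first h.P_pos (x (mc 0)) 0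
  have hs := h.s_pos (mc 0)
  have hJ := h.J_pos (mc 0)
  have hP := h.P_pos
  by_cases h0 : mc 0 = 0
  · rw [h0] at hi hs
    exact h.rel 0 (x 0 + P * i + s 0) _ (x 0 + P * i + s 0) hi (by omega) (by omega) le_rfl
      (fun i _ _ => hno i) h0 ⟨i, by ring⟩ ⟨i, by ring⟩
  · have hJP : 0 < J (mc 0) * P := by positivity
    have := h.special 0 (x (mc 0) + P * i + (s (mc 0) + J (mc 0) * P)) _
      (x (mc 0) + P * i + (s (mc 0) + J (mc 0) * P)) hi (by omega) (by omega) le_rfl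
      (fun i _ _ => hno i) h0 ⟨i, by ring⟩ ⟨i + J (mc 0), by ring⟩
    omega

end FacePattern

namespace SphData
variable {D : Type} {φ α : Perm D} {cls : D → Fin 3} {Q p : Fin 3 → ℤ} {T : ℕ}
    {τ : D → ZMod 2} {θ : D → ℤ} {n pp pm Jp Jm : ℤ}

lemma start_zpow (d : D) (y z : ℤ) : Start φ α ((φ ^ y) d) z ↔ Start φ α d (z + y) := by
  unfold Start
  rw [← Perm.mul_apply, ← zpow_add, show z - 1 + y = z + y - 1 by ring]

section
variable (h : SphData φ α cls Q p T τ θ)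
include h

lemma small_iff (d : D) : Small φ α d ↔ (α * φ) ((α * φ) d) = d := by
  unfold Small
  simp only [Perm.mul_apply]
  constructor
  · intro e; rw [e]; simp [h.invol]
  · intro e
    rw [Perm.eq_inv_iff_eq]
    have := congrArg α e
    rwa [h.invol] at this

lemma small_next (d : D) : Small φ α (α (φ d)) ↔ Small φ α d := by
  rw [h.small_iff, h.small_iff]
  exact (α * φ).injective.eq_iff (a := (α * φ) ((α * φ) d)) (b := d)

lemma small_inv (d : D) : Small φ α (φ⁻¹ d) ↔ Small φ α (α d) := by
  have := h.small_next (φ⁻¹ d)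
  simpa using this.symm

lemma sum_zpow (w : D → ℕ) {d : D} (hd : cls d = 0) (y : ℤ) :
    ∑ i ∈ Finset.range T, w ((φ ^ (i : ℤ)) ((φ ^ y) d)) =
      ∑ i ∈ Finset.range T, w ((φ ^ (i : ℤ)) d) := by
  have key : ∀ e, cls e = 0 → ∑ i ∈ Finset.range T, w ((φ ^ (i : ℤ)) (φ e)) =
      ∑ i ∈ Finset.range T, w ((φ ^ (i : ℤ)) e) := by
    intro e he
    have h1 := Finset.sum_range_succ (fun i : ℕ => w ((φ ^ (i : ℤ)) e)) T
    have h2 := Finset.sum_range_succ' (fun i : ℕ => w ((φ ^ (i : ℤ)) e)) T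
    have h3 : ∀ i : ℕ, (φ ^ (i : ℤ)) (φ e) = (φ ^ ((i + 1 : ℕ) : ℤ)) e := fun i => by
      push_cast
      rw [zpow_add, zpow_one, Perm.mul_apply]
    simp only [h3]
    have h4 : (φ ^ (T : ℤ)) e = (φ ^ ((0 : ℕ) : ℤ)) e := by
      rw [h.period_rel e he]; simp
    rw [h4] at h1
    omega
  induction y using Int.induction_on with
  | zero => simp
  | succ k ih => rw [zpow_succ_apply, key _ (by rw [h.cls_zpow, hd]), ih]
  | pred k ih =>
    have := key ((φ ^ (-(k : ℤ) - 1)) d) (by rw [h.cls_zpow, hd])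
    rw [← zpow_succ_apply, sub_add_cancel] at this
    rw [← this, ih]

end

variable (h : SphData φ α cls Q p T τ θ) (g : Slopes Q p n pp pm Jp Jm)
include h g

lemma exists_start (hT : (T : ℤ) = 2 * n * p 0) {d : D} (hd : cls d = 0) : ∃ y, Start φ α d y :=
  (h.facePattern g hT hd).exists_start

lemma four_le_sum (hT : (T : ℤ) = 2 * n * p 0) {d : D} (hd : cls d = 0) :
    4 ≤ ∑ i ∈ Finset.range T, wt φ α cls ((φ ^ (i : ℤ)) d) := by
  by_cases hs : ∃ y, Start φ α d y ∧ cls (α ((φ ^ y) d)) ≠ 0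
  · obtain ⟨y, hy, hc⟩ := hs
    rw [← h.sum_zpow _ hd y]
    have hf := h.facePattern g hT (d := (φ ^ y) d) (by rw [h.cls_zpow, hd])
    rcases hf.outcome ((start_zpow d y 0).2 (by rwa [zero_add])) (by simpa using hc) hT with
      h1 | ⟨h1, -⟩ <;> omega
  · push Not at hs
    obtain ⟨y, hy⟩ := h.exists_start g hT hd
    rw [← h.sum_zpow _ hd y]
    have hf := h.facePattern g hT (d := (φ ^ y) d) (by rw [h.cls_zpow, hd])
    have := hf.all_rel (fun z hz => by
      have := hs (z + y) ((start_zpow d y z).1 hz)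
      rwa [zpow_add, Perm.mul_apply] at this)
      ((start_zpow d y 0).2 (by rwa [zero_add])) hT
    omega

open scoped Classical in
theorem tight [Fintype D] (hT : (T : ℤ) = 2 * n * p 0)
    (hcard : T * (Finset.univ.filter fun d => (α * φ) ((α * φ) d) ≠ d).card ≤
        4 * (Finset.univ.filter fun d => cls d = 0).card) :
    (∀ d, cls d = 0 → ∑ i ∈ Finset.range T, wt φ α cls ((φ ^ (i : ℤ)) d) = 4) ∧
    (∀ d, cls d ≠ 0 → ¬ Small φ α d → cls (α d) = 0) ∧
    4 * (Finset.univ.filter fun d => cls d = 0).card ≤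
      T * (Finset.univ.filter fun d => (α * φ) ((α * φ) d) ≠ d).card := by
  set R := Finset.univ.filter fun d : D => cls d = 0 with hR
  have hT0 : 0 < T := by
    have := g.hn; have := h.p_pos 0
    have : (0 : ℤ) < T := by rw [hT]; positivity
    omega
  simp only [ne_eq, ← h.small_iff] at hcard ⊢
  have hle : ∀ d ∈ R, 4 ≤ ∑ i ∈ Finset.range T, wt φ α cls ((φ ^ (i : ℤ)) d) := fun d hd =>
    h.four_le_sum g hT (Finset.mem_filter.1 hd).2
  have h1 : ∑ d ∈ R, ∑ i ∈ Finset.range T, wt φ α cls ((φ ^ (i : ℤ)) d) =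
      T * ∑ d ∈ R, wt φ α cls d := by
    rw [Finset.sum_comm, ← smul_eq_mul, ← Finset.card_range T, ← Finset.sum_const,
      Finset.card_range]
    refine Finset.sum_congr rfl fun i _ => ?_
    refine Finset.sum_equiv (φ ^ (i : ℤ)) (fun d => ?_) (fun d _ => rfl)
    simp only [hR, Finset.mem_filter, Finset.mem_univ, true_and, h.cls_zpow]
  have h2 : ∑ d ∈ R, wt φ α cls d =
      (R.filter fun d => ¬ Small φ α (φ⁻¹ d)).card +
      (R.filter fun d => ¬ Small φ α (φ⁻¹ d) ∧ cls (α d) ≠ 0).card := by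
    rw [Finset.card_filter, Finset.card_filter, ← Finset.sum_add_distrib]
    refine Finset.sum_congr rfl fun d _ => ?_
    unfold wt
    generalize φ⁻¹ d = d'
    by_cases e1 : Small φ α d' <;> by_cases e2 : cls (α d) = 0 <;> simp [e1, e2]
  have h3 : (R.filter fun d => ¬ Small φ α (φ⁻¹ d)).card =
      (R.filter fun d => ¬ Small φ α d).card := by
    refine Finset.card_equiv (φ⁻¹) fun d => ?_
    simp only [hR, Finset.mem_filter, Finset.mem_univ, true_and, h.cls_inv]
  have h4 : (R.filter fun d => ¬ Small φ α (φ⁻¹ d) ∧ cls (α d) ≠ 0).card =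
      (Finset.univ.filter fun d => ¬ Small φ α d ∧ cls d ≠ 0 ∧ cls (α d) = 0).card := by
    refine Finset.card_equiv α fun d => ?_
    simp only [hR, Finset.mem_filter, Finset.mem_univ, true_and, h.small_inv, h.invol]
    tauto
  have h5 : (Finset.univ.filter fun d => ¬ Small φ α d).card =
      (R.filter fun d => ¬ Small φ α d).card +
      ((Finset.univ.filter fun d => ¬ Small φ α d ∧ cls d ≠ 0 ∧ cls (α d) = 0).card +
      (Finset.univ.filter fun d => ¬ Small φ α d ∧ cls d ≠ 0 ∧ cls (α d) ≠ 0).card) := by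
    rw [hR, Finset.filter_filter, Finset.card_filter, Finset.card_filter, Finset.card_filter,
      Finset.card_filter, ← Finset.sum_add_distrib, ← Finset.sum_add_distrib]
    refine Finset.sum_congr rfl fun d _ => ?_
    by_cases e0 : Small φ α d <;> by_cases e1 : cls d = 0 <;> by_cases e2 : cls (α d) = 0 <;>
      simp [e0, e1, e2]
  have h6 : ∑ d ∈ R, 4 ≤ ∑ d ∈ R, ∑ i ∈ Finset.range T, wt φ α cls ((φ ^ (i : ℤ)) d) :=
    Finset.sum_le_sum hle
  have h7 : ∑ d ∈ R, 4 = 4 * R.card := by rw [Finset.sum_const, smul_eq_mul, mul_comm]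
  rw [h3, h4] at h2
  set X := (Finset.univ.filter fun d => ¬ Small φ α d ∧ cls d ≠ 0 ∧ cls (α d) ≠ 0).card with hX
  rw [← add_assoc, ← h2] at h5
  rw [h7] at h6
  rw [h5] at hcard ⊢
  rw [mul_add] at hcard ⊢
  have h8 : T * X = 0 := by omega
  have h9 : ∑ d ∈ R, 4 = ∑ d ∈ R, ∑ i ∈ Finset.range T, wt φ α cls ((φ ^ (i : ℤ)) d) := by omega
  refine ⟨fun d hd => ?_, fun d hd hs => ?_, by omega⟩
  · exact ((Finset.sum_eq_sum_iff_of_le hle).1 h9 d (by simp [hR, hd])).symm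
  · by_contra hc
    have : X = 0 := by
      rcases Nat.mul_eq_zero.1 h8 with h | h
      · omega
      · exact h
    rw [hX, Finset.card_eq_zero] at this
    have hm : d ∈ (∅ : Finset D) := by
      rw [← this]; simp [hd, hs, hc]
    simp at hm

end SphData
end Heckoid

namespace Heckoid
open Equiv

/-- A diagram for which the curvature estimate is sharp. -/
structure Extremal {D : Type} (φ α : Perm D) (cls : D → Fin 3) (Q p : Fin 3 → ℤ) (T : ℕ)
    (τ : D → ZMod 2) (θ : D → ℤ) (n pp pm Jp Jm : ℤ) : Prop where
  sph : SphData φ α cls Q p T τ θ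
  slopes : Slopes Q p n pp pm Jp Jm
  length : (T : ℤ) = 2 * n * p 0
  sum_eq : ∀ d, cls d = 0 → ∑ i ∈ Finset.range T, wt φ α cls ((φ ^ (i : ℤ)) d) = 4
  mate : ∀ d, cls d ≠ 0 → ¬ SphData.Small φ α d → cls (α d) = 0
  four : ∀ d, ¬ SphData.Small φ α d → (α * φ) ((α * φ) ((α * φ) ((α * φ) d))) = d

namespace Extremal
open SphData
variable {D : Type} {φ α : Perm D} {cls : D → Fin 3} {Q p : Fin 3 → ℤ} {T : ℕ}
    {τ : D → ZMod 2} {θ : D → ℤ} {n pp pm Jp Jm : ℤ}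
    (h : Extremal φ α cls Q p T τ θ n pp pm Jp Jm)
include h

lemma disc_mul_ne {c c' : Fin 3} (hc : c ≠ 0) (hcc : c' ≠ c) : p c' * Q c ≠ Q c' * p c := by
  have h0 := fun c hc => sub_ne_zero.1 (h.slopes.disc_ne c hc)
  have h1 := h0 1 (by decide)
  have h2 := h0 2 (by decide)
  have h3 := h.slopes.ne
  have h4 : p 2 * Q 1 ≠ Q 2 * p 1 := fun e => h3 (by linarith)
  fin_cases c <;> fin_cases c' <;> simp_all

lemma τ_zpow (d : D) (k : ℤ) : τ ((φ ^ k) d) = τ d + k := by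
  induction k using Int.induction_on with
  | zero => simp
  | succ k ih => rw [zpow_succ_apply, h.sph.τ_φ, ih]; push_cast; ring
  | pred k ih =>
    have := h.sph.τ_φ ((φ ^ (-(k : ℤ) - 1)) d)
    rw [← zpow_succ_apply, sub_add_cancel, ih] at this
    push_cast at this ⊢
    linear_combination -this

lemma exists_big {d : D} (hd : cls d ≠ 0) : ∃ k : ℤ, ¬ Small φ α ((φ ^ k) d) := by
  by_contra! hno
  obtain ⟨h1, h2⟩ := h.sph.drift_const d (k := 0) (l := 0 + 2 * p (cls d))
    (by have := h.sph.p_pos (cls d); omega) rfl (fun i _ _ => hno i)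
  rw [h.sph.drift_period hd] at h2
  rw [zpow_zero, Perm.one_apply] at h2
  by_cases hc : cls (α d) = cls d
  · obtain ⟨m, hm⟩ := h.sph.one_face d (α d) hd hc
    have hτ := h.sph.τ_α d
    rw [← hm, h.τ_zpow] at hτ
    have : ((m : ℤ) : ZMod 2) = 0 := by simpa using hτ
    obtain ⟨j, rfl⟩ := (ZMod.intCast_zmod_eq_zero_iff_dvd m 2).1 this
    have hmove : ∀ i : ℕ, α ((φ ^ (i : ℤ)) d) = (φ ^ (-(i : ℤ))) (α d) := by
      intro i
      induction i with
      | zero => simp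
      | succ i ih =>
        have := hno i
        unfold SphData.Small at this
        push_cast
        rw [zpow_succ_apply, this, ih, ← zpow_neg_one, ← Perm.mul_apply, ← zpow_add]
        congr 2; ring
    obtain ⟨z, hz⟩ : ∃ z : ℕ, 0 ≤ j + p (cls d) * z := ⟨j.natAbs, by
      have := h.sph.p_pos (cls d)
      have h3 : -j ≤ j.natAbs := by omega
      nlinarith⟩
    obtain ⟨i, hi⟩ := Int.eq_ofNat_of_zero_le hz
    have e := hmove i
    have hper : ∀ z : ℕ, (φ ^ (z * (2 * p (cls d)))) d = d := by
      intro z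
      induction z with
      | zero => simp
      | succ z ih =>
        push_cast
        rw [add_mul, one_mul, h.sph.zpow_period hd, ih]
    have e2 : α ((φ ^ (i : ℤ)) d) = (φ ^ (i : ℤ)) d := by
      rw [e, ← hm, ← Perm.mul_apply, ← zpow_add]
      rw [show -(i : ℤ) + ((2 : ℕ) : ℤ) * j = i + -(z * (2 * p (cls d))) by push_cast; linarith,
        zpow_add, Perm.mul_apply, zpow_neg]
      congr 1
      rw [Perm.inv_eq_iff_eq, hper]
    have := h.sph.sign ((φ ^ (i : ℤ)) d)
    rw [e2] at this
    omega
  · have := h.disc_mul_ne hd hc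
    omega

lemma mate_rel {d : D} (hd : cls d ≠ 0) : cls (α d) = 0 := by
  classical
  obtain ⟨k, hk⟩ := h.exists_big hd
  have hp := h.sph.p_pos (cls d)
  have hper : ∀ z : ℕ, ¬ Small φ α ((φ ^ (k + z * (2 * p (cls d)))) d) := by
    intro z
    induction z with
    | zero => simpa
    | succ z ih =>
      push_cast
      rwa [add_mul, one_mul, ← add_assoc, h.sph.zpow_period hd]
  obtain ⟨g, ⟨g1, g2⟩, g3⟩ := Int.exists_least_of_bdd
    (P := fun g => 0 ≤ g ∧ ¬ Small φ α ((φ ^ g) d)) ⟨0, fun b hb => hb.1⟩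
    ⟨_, by have : -k ≤ k.natAbs := by omega
           nlinarith, hper k.natAbs⟩
  have := (h.sph.drift_const d g1 (c := cls (α d)) (by simp) (fun i hi hig => by
    by_contra hc; have := g3 i ⟨hi, hc⟩; omega)).1
  rw [← this]
  exact h.mate _ (by rwa [h.sph.cls_zpow]) g2

/-- Marks of the first type along a line, in the sense of the face across. -/
def FirstMark (φ α : Perm D) (cls : D → Fin 3) (Q p : Fin 3 → ℤ) (θ : D → ℤ) (d : D) (k : ℤ) :
    Prop :=
  (disc Q p (cls d) < 0 ∧ p 0 ∣ drift φ α cls Q p θ d 0 k + Q 0 * k) ∨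
  (0 ≤ disc Q p (cls d) ∧ p 0 ∣ drift φ α cls Q p θ d 0 k + Q 0 * k + 1)

/-- Marks of the second type along a line, in the sense of the face across. -/
def SecondMark (φ α : Perm D) (cls : D → Fin 3) (Q p : Fin 3 → ℤ) (θ : D → ℤ) (d : D) (k : ℤ) :
    Prop :=
  (0 ≤ disc Q p (cls d) ∧ p 0 ∣ drift φ α cls Q p θ d 0 k + Q 0 * k) ∨
  (disc Q p (cls d) < 0 ∧ p 0 ∣ drift φ α cls Q p θ d 0 k + Q 0 * k + 1)

lemma drift_star (d : D) {k l : ℤ} (hk : p 0 ∣ drift φ α cls Q p θ d 0 k + Q 0 * k)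
    (hl : p 0 ∣ drift φ α cls Q p θ d 0 l + Q 0 * l + 1) :
    disc Q p (cls d) * (l - k) <
      p (cls d) * (drift φ α cls Q p θ d 0 l - drift φ α cls Q p θ d 0 k + 1) := by
  have f0 := h.sph.drift_floor d 0 k
  have f1 := h.sph.drift_floor d 0 l
  have hp := h.sph.p_pos 0
  have hq := h.sph.p_pos (cls d)
  obtain ⟨a, ha⟩ := hk
  obtain ⟨b, hb⟩ := hl
  rw [ha, Int.mul_ediv_cancel_left _ hp.ne'] at f0
  rw [show drift φ α cls Q p θ d 0 l + Q 0 * l = p 0 * b - 1 by linarith] at f1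
  have e1 : (p 0 * b - 1) / p 0 = b - 1 := by
    rw [Int.ediv_eq_iff_of_pos hp]; constructor <;> linarith
  rw [e1] at f1
  have h1 := Int.mul_ediv_add_emod (θ d + Q (cls d) * k) (p (cls d))
  have h2 := Int.emod_nonneg (θ d + Q (cls d) * k) hq.ne'
  have h3 := Int.mul_ediv_add_emod (θ d + Q (cls d) * l) (p (cls d))
  have h4 := Int.emod_lt_of_pos (θ d + Q (cls d) * l) hq
  rw [← f0] at h1
  rw [← f1] at h3
  have e2 : p (cls d) * a ≤ θ d + Q (cls d) * k := by linarith
  have e3 : θ d + Q (cls d) * l < p (cls d) * b := by linarith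
  have e4 := mul_le_mul_of_nonneg_left e2 hp.le
  have e5 := mul_lt_mul_of_pos_left e3 hp
  unfold disc
  have e6 : p (cls d) * (p 0 * a) = p (cls d) * (drift φ α cls Q p θ d 0 k + Q 0 * k) := by rw [ha]
  have e7 : p (cls d) * (p 0 * b) =
    p (cls d) * (drift φ α cls Q p θ d 0 l + Q 0 * l + 1) := by rw [hb]
  nlinarith

lemma drift_marks (d : D) {k l : ℤ} (hk : p 0 ∣ drift φ α cls Q p θ d 0 k + Q 0 * k)
    (hl : p 0 ∣ drift φ α cls Q p θ d 0 l + Q 0 * l + 1) :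
    p 0 ∣ l - k - pp * (1 + drift φ α cls Q p θ d 0 l - drift φ α cls Q p θ d 0 k) := by
  obtain ⟨z, hz⟩ := dvd_sub (dvd_mul_of_dvd_left h.slopes.dvd (l - k))
    (dvd_mul_of_dvd_right (dvd_sub hl hk) pp)
  exact ⟨z, by linear_combination hz⟩

lemma linePattern {d : D} (hd : cls d ≠ 0) :
    LinePattern (fun k => ¬ Small φ α ((φ ^ k) d))
      (fun k => bySide Q p 1 (-1) (cls d) * drift φ α cls Q p θ d 0 k)
      (SecondMark φ α cls Q p θ d) (FirstMark φ α cls Q p θ d) (p 0)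
      (bySide Q p pp pm (cls d)) (p (cls d)) (bySide Q p 1 (-1) (cls d) * disc Q p (cls d)) where
  s_pos := by
    have := h.slopes.two_le_pp; have := h.slopes.two_le_pm
    unfold bySide; split_ifs <;> omega
  s_lt := by
    have := h.slopes.two_le_pp; have := h.slopes.two_le_pm; have := h.slopes.add
    unfold bySide; split_ifs <;> omega
  q_pos := h.sph.p_pos _
  Δ_pos := by
    have := h.slopes.disc_ne _ hd
    unfold bySide; split_ifs <;> omega
  G_period k := by rw [h.sph.zpow_period hd]
  v_period k := by
    rw [h.sph.drift_period hd]
    unfold disc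
    ring
  v_const k hk := by
    rw [not_not] at hk
    rw [h.sph.drift_step d k (h.mate_rel (by rwa [h.sph.cls_zpow])) hk]
  star k l hk hl := by
    by_cases hc : 0 ≤ disc Q p (cls d)
    · simp only [FirstMark, SecondMark, hc, not_lt.2 hc, true_and, false_and, or_false,
        false_or] at hk hl
      have := h.drift_star d hk hl
      simp only [bySide, if_pos hc]
      linarith
    · simp only [FirstMark, SecondMark, hc, not_le.1 hc, true_and, false_and, or_false,
        false_or] at hk hl
      have := h.drift_star d hl hk
      simp only [bySide, if_neg hc]
      linarith
  congr k l hk hl := by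
    by_cases hc : 0 ≤ disc Q p (cls d)
    · simp only [FirstMark, SecondMark, hc, not_lt.2 hc, true_and, false_and, or_false,
        false_or] at hk hl
      obtain ⟨z, hz⟩ := h.drift_marks d hk hl
      simp only [bySide, if_pos hc]
      exact ⟨z, by linear_combination hz⟩
    · simp only [FirstMark, SecondMark, hc, not_le.1 hc, true_and, false_and, or_false,
        false_or] at hk hl
      obtain ⟨z, hz⟩ := h.drift_marks d hl hk
      simp only [bySide, if_neg hc]
      exact ⟨-z - (1 + drift φ α cls Q p θ d 0 k - drift φ α cls Q p θ d 0 l), by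
        linear_combination -hz - (1 + drift φ α cls Q p θ d 0 k - drift φ α cls Q p θ d 0 l) *
          h.slopes.add⟩

end Extremal
end Heckoid

namespace Heckoid
open Equiv

namespace Slopes
variable {Q p : Fin 3 → ℤ} {n pp pm Jp Jm : ℤ} (g : Slopes Q p n pp pm Jp Jm)
include g

lemma mark_shift {t t' b : ℤ} (ht : p 0 ∣ t' - t - Q 0 * b) (y : ℤ) (c : Fin 3) :
    p 0 ∣ y - b - mark Q p pp t' c - (y - mark Q p pp t c) := by
  obtain ⟨z, hz⟩ := dvd_add (dvd_mul_of_dvd_left g.dvd b) (dvd_mul_of_dvd_right ht pp)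
  unfold mark
  exact ⟨-z, by linear_combination -hz⟩

lemma sameSide_iff (t : ℤ) (c c' : Fin 3) :
    SameSide (p 0) (mark Q p pp t) (bySide Q p pp pm) (bySide Q p Jp Jm) c c' ↔
      (0 ≤ disc Q p c ↔ 0 ≤ disc Q p c') := by
  have := g.Jadd
  unfold SameSide mark bySide
  constructor
  · rintro ⟨-, -, h⟩
    split_ifs at h <;> first | tauto | omega
  · intro h
    by_cases hc : 0 ≤ disc Q p c
    · simp [hc, h.1 hc]
    · have hc' : ¬ 0 ≤ disc Q p c' := fun h' => hc (h.2 h')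
      simp only [if_neg hc, if_neg hc', sub_self, dvd_zero, and_self]

end Slopes

namespace Extremal
open SphData
variable {D : Type} {φ α : Perm D} {cls : D → Fin 3} {Q p : Fin 3 → ℤ} {T : ℕ}
    {τ : D → ZMod 2} {θ : D → ℤ} {n pp pm Jp Jm : ℤ}

/-- The arc of a relator face starting at the mate of `E`. -/
def FaceWin (φ α : Perm D) (cls : D → Fin 3) (Q p : Fin 3 → ℤ) (θ : D → ℤ) (pp pm : ℤ) (E : D)
    (b e o : ℤ) : Prop :=
  IsWin (Start φ α (α E)) (p 0) (mark Q p pp (θ (α E))) (bySide Q p pp pm) (cls E) 0 b e o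

/-- The arc of a relator face starting at the mate of `E` is as long as possible. -/
def FullAt (φ α : Perm D) (cls : D → Fin 3) (Q p : Fin 3 → ℤ) (θ : D → ℤ) (pp pm Jp Jm : ℤ)
    (E : D) : Prop :=
  ∃ b e o, FaceWin φ α cls Q p θ pp pm E b e o ∧
    o - e = bySide Q p pp pm (cls E) + (bySide Q p Jp Jm (cls E) - 1) * p 0

variable (h : Extremal φ α cls Q p T τ θ n pp pm Jp Jm)
include h

lemma start_zero (E : D) : Start φ α (α E) 0 ↔ ¬ SphData.Small φ α E := by
  unfold Start
  rw [zero_sub, zpow_neg_one, h.sph.small_inv, h.sph.invol]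

lemma mate_arc {E : D} {b : ℤ} (hs : ∀ i, 0 < i → i < b → ¬ Start φ α (α E) i) {y : ℤ}
    (h0 : 0 ≤ y) (hy : y < b) :
    α ((φ ^ (-y)) E) = (φ ^ y) (α E) ∧
      (Start φ α (α E) (y + 1) ↔ ¬ SphData.Small φ α ((φ ^ (-(y + 1))) E)) := by
  have key : ∀ y : ℤ, α ((φ ^ (-y)) E) = (φ ^ y) (α E) →
      (Start φ α (α E) (y + 1) ↔ ¬ SphData.Small φ α ((φ ^ (-(y + 1))) E)) := by
    intro y hy
    unfold Start
    rw [add_sub_cancel_right, ← hy, show -y = -(y + 1) + 1 by ring, zpow_succ_apply,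
      h.sph.small_next]
  suffices hh : α ((φ ^ (-y)) E) = (φ ^ y) (α E) from ⟨hh, key y hh⟩
  induction y, h0 using Int.leInduction with
  | base => simp
  | succ y hy0 ih =>
    have ih := ih (by omega)
    have h1 := (key y ih).not.1 (hs (y + 1) (by omega) hy)
    rw [not_not] at h1
    unfold SphData.Small at h1
    rw [← zpow_succ_apply, show -(y + 1) + 1 = -y by ring, ih] at h1
    rw [zpow_succ_apply, h1]
    simp

/-- The alternatives at a vertex of valency four on a line. -/
lemma outcome {E : D} (hE : cls E ≠ 0) (hbig : ¬ SphData.Small φ α E) :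
    ∃ b e o, FaceWin φ α cls Q p θ pp pm E b e o ∧ ¬ SphData.Small φ α ((φ ^ (-b)) E) ∧
      (∀ i, 0 < i → i < b → SphData.Small φ α ((φ ^ (-i)) E)) ∧
      cls ((α * φ) ((α * φ) ((φ ^ (-b)) E))) = cls ((α * φ) ((α * φ) E)) ∧
      ((cls ((α * φ) ((α * φ) E)) = 0 ∧ 2 ≤ bySide Q p Jp Jm (cls E) ∧
        o - e = bySide Q p pp pm (cls E) + (bySide Q p Jp Jm (cls E) - 1) * p 0) ∨
      (cls ((α * φ) ((α * φ) E)) ≠ 0 ∧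
        ((¬ (0 ≤ disc Q p (cls ((α * φ) ((α * φ) E))) ↔ 0 ≤ disc Q p (cls E)) ∧
          o - e = bySide Q p pp pm (cls E) + (bySide Q p Jp Jm (cls E) - 1) * p 0) ∨
        ((0 ≤ disc Q p (cls ((α * φ) ((α * φ) E))) ↔ 0 ≤ disc Q p (cls E)) ∧
          (bySide Q p pp pm (cls E) ≤ o - e ∨ (2 ≤ bySide Q p Jp Jm (cls E) ∧
            FullAt φ α cls Q p θ pp pm Jp Jm ((α * φ) ((α * φ) ((φ ^ (-b)) E))))))))) := by
  have hF : cls (α E) = 0 := h.mate E hE hbig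
  have hf := h.sph.facePattern h.slopes h.length hF
  have hm0 : cls (α ((φ ^ (0 : ℤ)) (α E))) = cls E := by simp [h.sph.invol]
  have hout := hf.outcome ((h.start_zero E).2 hbig) (by rwa [hm0]) h.length
  rw [h.sum_eq _ hF] at hout
  obtain ⟨-, b, e, o, hw, ho⟩ := hout.resolve_left (by omega)
  simp only [hm0] at hw
  have hb := hw.lt
  have harc := fun y h0 hy => h.mate_arc (E := E) (b := b) hw.none (y := y) h0 hy
  have hnext : α ((φ ^ b) (α E)) = (α * φ) ((α * φ) ((φ ^ (-b)) E)) := by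
    have := (harc (b - 1) (by omega) (by omega)).1
    have e1 : (φ ^ (-(b - 1))) E = φ ((φ ^ (-b)) E) := by
      rw [← zpow_succ_apply]; congr 2; ring
    rw [e1] at this
    have e2 : (φ ^ b) (α E) = φ ((φ ^ (b - 1)) (α E)) := by
      rw [← zpow_succ_apply]; congr 2; ring
    rw [e2, ← this]
    rfl
  have hlast : cls (α ((φ ^ (2 * n * p 0 - 1)) (α E))) = cls ((α * φ) ((α * φ) E)) := by
    have e1 : (φ ^ (2 * n * p 0 - 1)) (α E) = φ⁻¹ (α E) := by
      rw [← h.length, show (T : ℤ) - 1 = -1 + T by ring, h.sph.zpow_period_rel hF, zpow_neg_one]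
    rw [e1]
    have h4 := h.four E hbig
    have e2 : φ⁻¹ (α E) = (α * φ) ((α * φ) ((α * φ) E)) := by
      rw [Perm.inv_eq_iff_eq]
      conv_lhs => rw [← h4]
      rw [Perm.mul_apply, h.sph.invol]
    rw [e2]
    have e3 : α ((α * φ) ((α * φ) ((α * φ) E))) = φ ((α * φ) ((α * φ) E)) := by
      rw [Perm.mul_apply, h.sph.invol]
    rw [e3, h.sph.cls_φ]
  have hstart := (harc (b - 1) (by omega) (by omega)).2
  rw [sub_add_cancel] at hstart
  refine ⟨b, e, o, hw, hstart.1 hw.right, fun i i0 ib => ?_, ?_⟩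
  · have := (harc (i - 1) (by omega) (by omega)).2
    rw [sub_add_cancel] at this
    exact not_not.1 (this.not.1 (hw.none i i0 ib))
  · unfold FacePattern.Outcome at ho
    simp only [hm0, hlast, hnext, h.slopes.sameSide_iff] at ho
    rcases ho with ⟨h1, h2, h3, h4⟩ | ⟨h1, h2, h3, h4, h5⟩
    · exact ⟨h1.trans h2.symm, Or.inl ⟨h2, h3, h4⟩⟩
    · refine ⟨h2.symm, Or.inr ⟨h2 ▸ h1, ?_⟩⟩
      rw [← h2] at h5
      refine h5.imp_right fun ⟨h6, h7⟩ => ⟨h6, h7.imp_right fun ⟨h8, e', o', h9, h10⟩ => ⟨h8, ?_⟩⟩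
      rw [h2] at h9 h10
      have hX : α ((α * φ) ((α * φ) ((φ ^ (-b)) E))) = (φ ^ b) (α E) := by
        rw [← hnext, h.sph.invol]
      refine ⟨2 * n * p 0 - b, e' - b, o' - b, ?_, by rw [← h10]; ring⟩
      have hθ := dvd_of_mul_left_dvd (h.sph.θ_zpow b (α E))
      rw [hF] at hθ
      unfold FaceWin
      rw [hX]
      have hsh := fun y => h.slopes.mark_shift hθ y (cls ((α * φ) ((α * φ) ((φ ^ (-b)) E))))
      constructor
      · rw [start_zpow, zero_add]; exact h9.left
      · rw [start_zpow, sub_add_cancel]; exact h9.right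
      · have := h9.lt; omega
      · intro i i0 i1
        rw [start_zpow]; exact h9.none _ (by omega) (by omega)
      · have := h9.le_e; omega
      · have := h9.e_lt; omega
      · have := h9.e_lt'; omega
      · have := h9.le_o; omega
      · have := h9.o_lt; omega
      · have := h9.le_o'; omega
      · have := dvd_add (hsh e') h9.mark_e
        rwa [sub_add_cancel] at this
      · have := dvd_add (hsh o') h9.mark_o
        rwa [show ∀ a b c d : ℤ, a - (b - c) + (b - c - d) = a - d by intros; ring] at this

end Extremal
end Heckoid

namespace Heckoid
open Equiv

lemma IsLineWin.left_unique {G A B : ℤ → Prop} {P y y' g a b a' b' : ℤ}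
    (hw : IsLineWin G A B P y g a b) (hw' : IsLineWin G A B P y' g a' b') : y = y' := by
  have e1 : ¬ y < y' := fun hc => hw.none y' hc hw'.lt hw'.left
  have e2 : ¬ y' < y := fun hc => hw'.none y hc hw.lt hw.left
  omega

lemma LinePattern.win_length {G : ℤ → Prop} {v : ℤ → ℤ} {A B : ℤ → Prop} {P s q Δ : ℤ}
    (h : LinePattern G v A B P s q Δ) {y y' g a b a' b' : ℤ}
    (hw : IsLineWin G A B P y g a b) (hw' : IsLineWin G A B P y' g a' b') : b - a = b' - a' := by
  obtain rfl := hw.left_unique hw'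
  obtain ⟨i, hi⟩ := h.congr a b hw.mark_a hw.mark_b
  obtain ⟨j, hj⟩ := h.congr a' b hw'.mark_a hw.mark_b
  obtain ⟨l, hl⟩ := h.congr a b' hw.mark_a hw'.mark_b
  rw [h.v_win hw hw.lt_a hw.a_le] at hi hl
  rw [h.v_win hw hw'.lt_a hw'.a_le] at hj
  rw [h.v_win hw hw.lt_b hw.b_le] at hi hj
  rw [h.v_win hw hw'.lt_b hw'.b_le] at hl
  have ha : a - a' = 0 := by
    refine Int.eq_zero_of_abs_lt_dvd (m := P) ⟨j - i, by linarith⟩ ?_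
    rw [abs_lt]
    have := hw.lt_a; have := hw.a_le'; have := hw'.lt_a; have := hw'.a_le'
    constructor <;> omega
  have hb : b - b' = 0 := by
    refine Int.eq_zero_of_abs_lt_dvd (m := P) ⟨i - l, by linarith⟩ ?_
    rw [abs_lt]
    have := hw.b_le; have := hw.g_lt; have := hw'.b_le; have := hw'.g_lt
    constructor <;> omega
  omega

namespace Extremal
open SphData
variable {D : Type} {φ α : Perm D} {cls : D → Fin 3} {Q p : Fin 3 → ℤ} {T : ℕ}
    {τ : D → ZMod 2} {θ : D → ℤ} {n pp pm Jp Jm : ℤ}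
    (h : Extremal φ α cls Q p T τ θ n pp pm Jp Jm)
include h

lemma lineWin {d : D} (hd : cls d ≠ 0) {g b e o : ℤ}
    (hw : FaceWin φ α cls Q p θ pp pm ((φ ^ g) d) b e o) :
    IsLineWin (fun k => ¬ SphData.Small φ α ((φ ^ k) d)) (SecondMark φ α cls Q p θ d)
      (FirstMark φ α cls Q p θ d) (p 0) (g - b) g (g - o) (g - e) := by
  have hsub : ∀ i, (φ ^ (-i)) ((φ ^ g) d) = (φ ^ (g - i)) d := fun i => by
    rw [← Perm.mul_apply, ← zpow_add, neg_add_eq_sub]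
  have harc := fun y h0 hy => h.mate_arc (E := (φ ^ g) d) (b := b) hw.none (y := y) h0 hy
  simp only [hsub] at harc
  have hcls : cls (α ((φ ^ g) d)) = 0 := h.mate_rel (by rwa [h.sph.cls_zpow])
  have hmark : ∀ y, 0 ≤ y → y < b → ∃ z, p 0 * z = θ (α ((φ ^ g) d)) + Q 0 * y +
      (drift φ α cls Q p θ d 0 (g - y) + Q 0 * (g - y)) + 1 := by
    intro y h0 hy
    have h1 := h.sph.drift_congr d (c := 0) (g - y) (h.mate_rel (by rwa [h.sph.cls_zpow]))
    rw [(harc y h0 hy).1] at h1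
    have h2 := h.sph.θ_zpow y (α ((φ ^ g) d))
    rw [hcls] at h2
    obtain ⟨z, hz⟩ := dvd_sub h1 h2
    exact ⟨2 * z, by linear_combination -hz⟩
  have hfirst := (h.slopes.first_iff _ _ _).1 hw.mark_e
  have hsecond := (h.slopes.second_iff _ _ _).1 hw.mark_o
  rw [h.sph.cls_zpow] at hfirst hsecond
  have hlt := hw.lt; have := hw.le_e; have := hw.e_lt; have := hw.e_lt'
  have := hw.le_o; have := hw.o_lt; have := hw.le_o'
  obtain ⟨z, hz⟩ := hmark e (by omega) (by omega)
  obtain ⟨w, hw'⟩ := hmark o (by omega) (by omega)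
  have hstart := (harc (b - 1) (by omega) (by omega)).2
  rw [sub_add_cancel] at hstart
  refine ⟨hstart.1 hw.right, (h.start_zero _).1 hw.left, by omega, fun i i0 ib => ?_, by omega,
    by omega, by omega, ?_, by omega, by omega, by omega, ?_⟩
  · have := (harc (g - i - 1) (by omega) (by omega)).2
    rw [sub_add_cancel, sub_sub_cancel] at this
    exact this.not.1 (hw.none _ (by omega) (by omega))
  · rcases hsecond with ⟨hs, u, hu⟩ | ⟨hs, u, hu⟩
    · exact Or.inl ⟨hs, w - u, by linear_combination -hw' - hu⟩
    · exact Or.inr ⟨hs, w - u, by linear_combination -hw' - hu⟩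
  · rcases hfirst with ⟨hs, u, hu⟩ | ⟨hs, u, hu⟩
    · exact Or.inr ⟨hs, z - u, by linear_combination -hz - hu⟩
    · exact Or.inl ⟨hs, z - u, by linear_combination -hz - hu⟩

lemma exists_lineWin {d : D} (hd : cls d ≠ 0) (g : ℤ) (hg : ¬ SphData.Small φ α ((φ ^ g) d)) :
    ∃ y a b, IsLineWin (fun k => ¬ SphData.Small φ α ((φ ^ k) d)) (SecondMark φ α cls Q p θ d)
      (FirstMark φ α cls Q p θ d) (p 0) y g a b := by
  obtain ⟨b, e, o, hw, -⟩ := h.outcome (E := (φ ^ g) d) (by rwa [h.sph.cls_zpow]) hg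
  exact ⟨_, _, _, h.lineWin hd hw⟩

lemma fullLine_false {d : D} (hd : cls d ≠ 0) (hJ : 2 ≤ bySide Q p Jp Jm (cls d))
    (hfull : ∀ E, cls E = cls d → ¬ SphData.Small φ α E → FullAt φ α cls Q p θ pp pm Jp Jm E) :
    False := by
  have hL := h.linePattern hd
  refine hL.not_full hJ ?_ (h.exists_big hd) (h.exists_lineWin hd) fun y g a b hw => ?_
  · have h1 := h.slopes.lt_above (cls d)
    have h2 := h.slopes.lt_below (cls d)
    have h3 := h.slopes.disc_ne _ hd
    unfold bySide at hJ ⊢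
    split_ifs at hJ ⊢ with hc
    · have := h1 (by omega) hJ
      linarith
    · have := h2 (by omega) hJ
      linarith
  · obtain ⟨b', e, o, hw', he⟩ := hfull _ (h.sph.cls_zpow g d) hw.right
    have := hL.win_length hw (h.lineWin hd hw')
    rw [h.sph.cls_zpow] at he
    omega

lemma kind_line {d : D} (hd : cls d ≠ 0) (m : ℕ) : ∀ g g' : ℤ,
    ¬ SphData.Small φ α ((φ ^ g) d) → ¬ SphData.Small φ α ((φ ^ g') d) → g ≤ g' → g' - g ≤ m →
    cls ((α * φ) ((α * φ) ((φ ^ g) d))) = cls ((α * φ) ((α * φ) ((φ ^ g') d))) := by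
  induction m with
  | zero =>
    intro g g' _ _ h1 h2
    obtain rfl : g = g' := by push_cast at h2; omega
    rfl
  | succ m ih =>
    intro g g' hg hg' h1 h2
    rcases h1.eq_or_lt with rfl | h1
    · rfl
    obtain ⟨b, e, o, hw, hb, hn, hk, -⟩ := h.outcome (E := (φ ^ g') d) (by rwa [h.sph.cls_zpow]) hg'
    rw [← hk]
    have hsub : ∀ i, (φ ^ (-i)) ((φ ^ g') d) = (φ ^ (g' - i)) d := fun i => by
      rw [← Perm.mul_apply, ← zpow_add, neg_add_eq_sub]
    simp only [hsub] at hb hn ⊢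
    have hgb : g ≤ g' - b := by
      by_contra hc
      have := hn (g' - g) (by omega) (by omega)
      rw [sub_sub_cancel] at this
      exact hg this
    exact ih _ _ hg hb hgb (by have := hw.lt; push_cast at h2; omega)

/-- All vertices of valency four on a face have the same kind of face across. -/
lemma kind_eq {d e : D} (hd : cls d ≠ 0) (he : cls e = cls d) (h1 : ¬ SphData.Small φ α d)
    (h2 : ¬ SphData.Small φ α e) :
    cls ((α * φ) ((α * φ) d)) = cls ((α * φ) ((α * φ) e)) := by
  obtain ⟨m, rfl⟩ := h.sph.one_face d e hd he
  rcases le_total 0 m with hm | hm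
  · simpa using h.kind_line hd m.natAbs 0 m (by simpa using h1) h2 hm (by omega)
  · simpa using (h.kind_line hd m.natAbs m 0 h2 (by simpa using h1) hm (by omega)).symm

lemma big_opposite {E : D} (hE : ¬ SphData.Small φ α E) :
    ¬ SphData.Small φ α ((α * φ) ((α * φ) E)) := by
  rw [h.sph.small_iff] at hE ⊢
  rw [h.four E (by rwa [h.sph.small_iff])]
  exact fun hc => hE hc.symm

lemma exists_long {E₀ : D} (hE₀ : cls E₀ ≠ 0) (hbig : ¬ SphData.Small φ α E₀)
    (hk : cls ((α * φ) ((α * φ) E₀)) ≠ 0)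
    (hside : 0 ≤ disc Q p (cls ((α * φ) ((α * φ) E₀))) ↔ 0 ≤ disc Q p (cls E₀)) :
    ∃ E b e o, cls E = cls E₀ ∧ ¬ SphData.Small φ α E ∧ FaceWin φ α cls Q p θ pp pm E b e o ∧
      bySide Q p pp pm (cls E) ≤ o - e := by
  by_contra! hno
  have key : ∀ E, cls E = cls E₀ → ¬ SphData.Small φ α E → ∃ b : ℤ, 0 < b ∧
      ¬ SphData.Small φ α ((φ ^ (-b)) E) ∧
      (∀ i, 0 < i → i < b → SphData.Small φ α ((φ ^ (-i)) E)) ∧ 2 ≤ bySide Q p Jp Jm (cls E) ∧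
      FullAt φ α cls Q p θ pp pm Jp Jm ((α * φ) ((α * φ) ((φ ^ (-b)) E))) := by
    intro E hE hEb
    have e1 := h.kind_eq hE₀ hE hbig hEb
    obtain ⟨b, e, o, hw, hb, hn, -, ho⟩ := h.outcome (hE ▸ hE₀) hEb
    rw [← e1, hE] at ho
    rcases ho with ho | ⟨-, ho | ⟨-, ho⟩⟩
    · exact absurd ho.1 hk
    · exact absurd hside ho.1
    · rw [← hE] at ho
      have := hno E b e o hE hEb hw
      obtain ⟨ho1, ho2⟩ := ho.resolve_left (by omega)
      exact ⟨b, hw.lt, hb, hn, ho1, ho2⟩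
  obtain ⟨-, -, -, -, hJ, -⟩ := key E₀ rfl hbig
  refine h.fullLine_false hk ?_ fun X hX hXb => ?_
  · unfold bySide at hJ ⊢
    simp only [hside]
    exact hJ
  set E := (α * φ) ((α * φ) X) with hEdef
  have hEb := h.big_opposite hXb
  have hEcls : cls E = cls E₀ := by
    rw [hEdef, ← h.kind_eq hk hX (h.big_opposite hbig) hXb, h.four E₀ hbig]
  have hL := h.linePattern (d := E) (hEcls ▸ hE₀)
  obtain ⟨g, y, b', hw⟩ := hL.next_win (h.exists_lineWin (hEcls ▸ hE₀)) (g := 0)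
    (by rwa [zpow_zero, Perm.one_apply])
  obtain ⟨b, b0, hb, hn, -, hf⟩ := key ((φ ^ g) E) (by rwa [h.sph.cls_zpow]) hw.right
  have hsub : ∀ i, (φ ^ (-i)) ((φ ^ g) E) = (φ ^ (g - i)) E := fun i => by
    rw [← Perm.mul_apply, ← zpow_add, neg_add_eq_sub]
  have hg := hw.lt
  have : b = g := by
    simp only [hsub] at hb hn
    have e1 : ¬ b < g := fun hc => hw.none (g - b) (by omega) (by omega) hb
    have e2 : ¬ g < b := fun hc => hw.left (by simpa using hn g hg hc)
    omega
  rwa [hsub, this, sub_self, zpow_zero, Perm.one_apply, hEdef, h.four X hXb] at hf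

lemma gap_bounds {E : D} {b e o : ℤ} (hE : cls E ≠ 0)
    (hw : FaceWin φ α cls Q p θ pp pm E b e o) (hl : bySide Q p pp pm (cls E) ≤ o - e) {d : D}
    (hd : cls d = cls E) {k : ℤ} (hk : ¬ SphData.Small φ α ((φ ^ k) d)) :
    0 ≤ bySide Q p 1 (-1) (cls d) *
        (drift φ α cls Q p θ d 0 (k + 1) - drift φ α cls Q p θ d 0 k) ∧
      bySide Q p 1 (-1) (cls d) *
        (drift φ α cls Q p θ d 0 (k + 1) - drift φ α cls Q p θ d 0 k) ≤ p 0 - 1 := by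
  have hd0 : cls d ≠ 0 := hd ▸ hE
  have hL := h.linePattern hd0
  obtain ⟨m, rfl⟩ := h.sph.one_face d E hd0 hd.symm
  have hw := h.lineWin hd0 hw
  have hst := hL.star _ _ hw.mark_a hw.mark_b
  rw [hL.v_win hw hw.lt_a hw.a_le, hL.v_win hw hw.lt_b hw.b_le] at hst
  rw [h.sph.cls_zpow] at hl
  have hq : bySide Q p 1 (-1) (cls d) * disc Q p (cls d) * bySide Q p pp pm (cls d) < p (cls d) := by
    have := mul_le_mul_of_nonneg_left hl hL.Δ_pos.le
    rw [sub_self, zero_add, mul_one] at hst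
    refine lt_of_le_of_lt (this.trans_eq ?_) hst
    ring
  obtain ⟨y, a, c, h1⟩ := h.exists_lineWin hd0 k hk
  obtain ⟨z, a', c', h2⟩ := hL.next_win (h.exists_lineWin hd0) (g := k) hk
  have e1 := hL.gap_nonneg h1 h2
  have e2 := hL.gap_lt (by
    have := h.slopes.two_le_pp; have := h.slopes.two_le_pm
    unfold bySide; split_ifs <;> omega) hq h1 h2
  beta_reduce at e1 e2
  rw [mul_sub]
  exact ⟨e1, e2⟩

lemma gap_congr {d : D} (hd : cls d ≠ 0) (k : ℤ) :
    2 * p 0 ∣ drift φ α cls Q p θ d 0 (k + 1) - drift φ α cls Q p θ d 0 k + Q 0 +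
      θ ((α * φ) ((φ ^ k) d)) - θ (α ((φ ^ k) d)) := by
  obtain ⟨x, hx⟩ := h.sph.drift_congr d (c := 0) k (h.mate_rel (by rwa [h.sph.cls_zpow]))
  obtain ⟨y, hy⟩ := h.sph.drift_congr d (c := 0) (k + 1) (h.mate_rel (by rwa [h.sph.cls_zpow]))
  rw [zpow_succ_apply] at hy
  refine ⟨y - x, ?_⟩
  rw [Perm.mul_apply]
  linear_combination hy - hx

lemma gap_opposite {d : D} (hd : cls d ≠ 0) {k : ℤ} (hk : ¬ SphData.Small φ α ((φ ^ k) d))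
    (hX : cls ((α * φ) ((α * φ) ((φ ^ k) d))) ≠ 0) :
    2 * p 0 ∣ drift φ α cls Q p θ d 0 (k + 1) - drift φ α cls Q p θ d 0 k +
      (drift φ α cls Q p θ ((α * φ) ((α * φ) ((φ ^ k) d))) 0 (0 + 1) -
        drift φ α cls Q p θ ((α * φ) ((α * φ) ((φ ^ k) d))) 0 0) := by
  set E := (φ ^ k) d with hEdef
  have hE : cls E ≠ 0 := by rwa [h.sph.cls_zpow]
  set X := (α * φ) ((α * φ) E) with hXdef
  obtain ⟨x, hx⟩ := h.gap_congr hd k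
  obtain ⟨y, hy⟩ := h.gap_congr hX 0
  rw [← hEdef] at hx
  rw [zpow_zero, Perm.one_apply] at hy
  have hνE : cls ((α * φ) E) = 0 := h.mate_rel (by rwa [h.sph.cls_φ])
  have hνX : cls ((α * φ) X) = 0 := h.mate_rel (by rwa [h.sph.cls_φ])
  obtain ⟨u, hu⟩ := h.sph.θ_φ ((α * φ) E)
  obtain ⟨w, hw⟩ := h.sph.θ_φ ((α * φ) X)
  rw [hνE] at hu
  rw [hνX] at hw
  have e1 : α X = φ ((α * φ) E) := by rw [hXdef, Perm.mul_apply, h.sph.invol]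
  have e2 : φ ((α * φ) X) = α E := by
    conv_rhs => rw [← h.four E hk, ← hXdef]
    rw [Perm.mul_apply α φ ((α * φ) X), h.sph.invol]
  rw [e1] at hy
  rw [e2] at hw
  exact ⟨x + y + u + w, by linear_combination hx + hy + hu + hw⟩

/-- An extremal diagram contains relator faces only. -/
theorem cls_eq_zero (d : D) : cls d = 0 := by
  by_contra hd
  obtain ⟨k, hk⟩ := h.exists_big hd
  obtain ⟨E, hE⟩ : ∃ E, E = (φ ^ k) d := ⟨_, rfl⟩
  rw [← hE] at hk
  replace hd : cls E ≠ 0 := by rwa [hE, h.sph.cls_zpow]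
  clear hE
  set X := (α * φ) ((α * φ) E) with hXdef
  have hXb : ¬ SphData.Small φ α X := h.big_opposite hk
  have hXE : (α * φ) ((α * φ) X) = E := h.four E hk
  by_cases hX : cls X = 0
  · have key : ∀ E', cls E' = cls E → ¬ SphData.Small φ α E' → 2 ≤ bySide Q p Jp Jm (cls E) ∧
        FullAt φ α cls Q p θ pp pm Jp Jm E' := by
      intro E' h1 h2
      obtain ⟨b, e, o, hw, -, -, -, ho⟩ := h.outcome (h1 ▸ hd) h2
      rw [← h.kind_eq hd h1 hk h2] at ho
      obtain ⟨-, h3, h4⟩ := ho.resolve_right (fun hc => hc.1 hX)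
      exact ⟨h1 ▸ h3, b, e, o, hw, h4⟩
    exact h.fullLine_false hd (key E rfl hk).1 fun E' h1 h2 => (key E' h1 h2).2
  by_cases hside : 0 ≤ disc Q p (cls X) ↔ 0 ≤ disc Q p (cls E)
  · obtain ⟨E₁, b, e, o, h1, h2, h3, h4⟩ := h.exists_long hd hk hX hside
    obtain ⟨X₁, b', e', o', h1', h2', h3', h4'⟩ := h.exists_long hX hXb
      (by rwa [hXE]) (by rw [hXE]; exact hside.symm)
    have hL := h.linePattern hd
    have hconst : ∀ k, bySide Q p 1 (-1) (cls E) * drift φ α cls Q p θ E 0 (k + 1) =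
        bySide Q p 1 (-1) (cls E) * drift φ α cls Q p θ E 0 k := by
      intro k
      by_cases hk' : SphData.Small φ α ((φ ^ k) E)
      · exact hL.v_const k (not_not.2 hk')
      have hY : cls ((α * φ) ((α * φ) ((φ ^ k) E))) = cls X :=
        (h.kind_eq hd (h.sph.cls_zpow k E) hk hk').symm
      obtain ⟨c1, c2⟩ := h.gap_bounds (h1 ▸ hd) h3 h4 h1.symm hk'
      obtain ⟨c3, c4⟩ := h.gap_bounds (h1' ▸ hX) h3' h4' (hY.trans h1'.symm) (k := 0)
        (by simpa using h.big_opposite hk')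
      have c5 := h.gap_opposite hd hk' (hY ▸ hX)
      have hs : bySide Q p 1 (-1) (cls ((α * φ) ((α * φ) ((φ ^ k) E)))) =
          bySide Q p 1 (-1) (cls E) := by
        rw [hY]; unfold bySide; simp only [hside]
      rw [hs] at c3 c4
      have c6 := Int.eq_zero_of_abs_lt_dvd (dvd_mul_of_dvd_right c5 (bySide Q p 1 (-1) (cls E))) (by
        rw [abs_lt, mul_add]; constructor <;> linarith)
      rw [mul_add] at c6
      rw [mul_sub] at c1
      linarith
    have hc : ∀ m : ℕ, bySide Q p 1 (-1) (cls E) * drift φ α cls Q p θ E 0 m =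
        bySide Q p 1 (-1) (cls E) * drift φ α cls Q p θ E 0 0 := by
      intro m
      induction m with
      | zero => rfl
      | succ m ih => push_cast; rw [hconst, ih]
    have h5 := hL.v_period 0
    have h6 := hc (2 * p (cls E)).toNat
    rw [Int.toNat_of_nonneg (by have := h.sph.p_pos (cls E); omega)] at h6
    rw [zero_add, h6] at h5
    have := hL.Δ_pos
    omega
  · have key : ∀ E : D, cls E ≠ 0 → ¬ SphData.Small φ α E → cls ((α * φ) ((α * φ) E)) ≠ 0 →
        ¬ (0 ≤ disc Q p (cls ((α * φ) ((α * φ) E))) ↔ 0 ≤ disc Q p (cls E)) →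
        ¬ 2 ≤ bySide Q p Jp Jm (cls E) := by
      intro E hd hk hX hside hJ
      refine h.fullLine_false hd hJ fun E' h1 h2 => ?_
      obtain ⟨b, e, o, hw, -, -, -, ho⟩ := h.outcome (h1 ▸ hd) h2
      rw [← h.kind_eq hd h1 hk h2] at ho
      refine ⟨b, e, o, hw, ?_⟩
      rcases ho with ho | ⟨-, ho | ⟨ho, -⟩⟩
      · exact absurd ho.1 hX
      · exact ho.2
      · rw [h1] at ho; exact absurd ho hside
    have k1 := key E hd hk hX hside
    have k2 := key X hX hXb (by rwa [hXE]) (by rw [hXE]; exact fun hc => hside hc.symm)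
    have := h.slopes.Jadd
    have := h.slopes.hn
    unfold bySide at k1 k2
    split_ifs at k1 k2 <;> omega

end Extremal
end Heckoid

namespace Heckoid
open Equiv

/-- There is no spherical diagram with two exceptional faces whose slopes are far from the slope
of the relators. -/
theorem Slopes.not_sph {Q p : Fin 3 → ℤ} {n pp pm Jp Jm : ℤ} (g : Slopes Q p n pp pm Jp Jm)
    {len : Fin 3 → ℕ} (hp : ∀ c, 0 < p c) (hQ : ∀ c, 0 ≤ Q c) (hQp : ∀ c, Q c ≤ p c)
    (hT : (len 0 : ℤ) = 2 * n * p 0) (hlen' : ∀ c, c ≠ 0 → (len c : ℤ) = 2 * p c) (m : ℕ) :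
    ∀ S : List (Fin 3 × ℕ), S.length ≤ m → Sph (S.map (faceWord Q p len)) →
      (S.map Prod.fst).count 1 = 1 → (S.map Prod.fst).count 2 ≠ 1 := by
  induction m with
  | zero =>
    intro S hS _ h1
    obtain rfl : S = [] := List.length_eq_zero_iff.1 (by omega)
    simp at h1
  | succ m ih =>
    intro S hS hsph h1 h2
    have hlen : ∀ c, 2 * p c ∣ len c := by
      intro c
      by_cases hc : c = 0
      · rw [hc]; exact ⟨n, by rw [hT]; ring⟩
      · rw [hlen' c hc]
    have hT0 : 0 < len 0 := by
      have := g.hn; have := hp 0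
      have : (0 : ℤ) < len 0 := by rw [hT]; positivity
      omega
    obtain ⟨D, _, _, φ, α, cls, τ, θ, hs, ⟨d, hd⟩, -, hcard, hstrict⟩ :=
      exists_sphData hp hQ hQp hlen hlen' hT0 hsph h1 h2 fun x y S' hperm hx hy hsph' => by
        have hl := hperm.length_eq
        have hc1 := (hperm.map Prod.fst).count_eq 1
        have hc2 := (hperm.map Prod.fst).count_eq 2
        simp [hx, hy] at hl hc1 hc2
        exact ih S' (by omega) hsph' (by omega) (by omega)
    obtain ⟨t1, t2, t3⟩ := hs.tight g hT (by convert hcard)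
    have hE : Extremal φ α cls Q p (len 0) τ θ n pp pm Jp Jm := by
      refine ⟨hs, g, hT, t1, t2, fun d hd => ?_⟩
      by_contra hne
      rw [hs.small_iff] at hd
      have := hstrict ⟨d, hd, hne⟩
      refine absurd this (Nat.not_lt.2 ?_)
      convert t3
    rw [hE.cls_eq_zero d] at hd
    exact absurd hd (by decide)

end Heckoid

namespace Heckoid

/-- The action of a continued fraction on numerators and denominators of its tail. -/
def cfAct : List ℕ → ℤ × ℤ → ℤ × ℤ
  | [], x => x
  | a :: l, x => ((cfAct l x).2, a * (cfAct l x).2 + (cfAct l x).1)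

lemma cfQ_append {L l : List ℕ} (hL : ∀ a ∈ L, 0 < a) {x : ℤ × ℤ} (h1 : 0 ≤ x.1) (h2 : 0 < x.2)
    (hl : cfQ l = x.1 / x.2) :
    cfQ (L ++ l) = (cfAct L x).1 / (cfAct L x).2 ∧ 0 ≤ (cfAct L x).1 ∧ 0 < (cfAct L x).2 := by
  induction L with
  | nil => exact ⟨hl, h1, h2⟩
  | cons a L ih =>
    obtain ⟨e, f, g⟩ := ih fun a ha => hL a (List.mem_cons_of_mem _ ha)
    have ha : (1 : ℤ) ≤ a := by exact_mod_cast hL a List.mem_cons_self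
    have hpos : 0 < a * (cfAct L x).2 + (cfAct L x).1 := by nlinarith
    refine ⟨?_, g.le, hpos⟩
    have g' : ((cfAct L x).2 : ℚ) ≠ 0 := by exact_mod_cast g.ne'
    have hpos' : ((a * (cfAct L x).2 + (cfAct L x).1 : ℤ) : ℚ) ≠ 0 := by exact_mod_cast hpos.ne'
    simp only [List.cons_append, cfQ, e, cfAct]
    push_cast at hpos' ⊢
    have e2 : (a : ℚ) + (cfAct L x).1 / (cfAct L x).2 =
        (a * (cfAct L x).2 + (cfAct L x).1) / (cfAct L x).2 := by field_simp
    rw [e2, one_div_div]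

lemma cfAct_eq (L : List ℕ) (u v : ℤ) : cfAct L (u, v) =
    (u * (cfAct L (1, 0)).1 + v * (cfAct L (0, 1)).1,
      u * (cfAct L (1, 0)).2 + v * (cfAct L (0, 1)).2) := by
  induction L with
  | nil => simp [cfAct]
  | cons a L ih =>
    simp only [cfAct]
    rw [ih]
    simp only [Prod.mk.injEq, true_and]
    ring

lemma cfAct_det (L : List ℕ) : (cfAct L (1, 0)).1 * (cfAct L (0, 1)).2 -
    (cfAct L (1, 0)).2 * (cfAct L (0, 1)).1 = (-1) ^ L.length := by
  induction L with
  | nil => simp [cfAct]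
  | cons a L ih =>
    simp only [cfAct, List.length_cons, pow_succ]
    linear_combination -ih

lemma cfAct_nonneg (L : List ℕ) {x : ℤ × ℤ} (h1 : 0 ≤ x.1) (h2 : 0 ≤ x.2) :
    0 ≤ (cfAct L x).1 ∧ 0 ≤ (cfAct L x).2 := by
  induction L with
  | nil => exact ⟨h1, h2⟩
  | cons a L ih => simp only [cfAct]; exact ⟨ih.2, by have := ih.1; have := ih.2; positivity⟩

lemma two_le_cfAct {L : List ℕ} (hL : ∀ a ∈ L, 0 < a) {m : ℕ} (hm : 2 ≤ m)
    (hh : L.head? = some m) : 2 ≤ (cfAct L (0, 1)).2 := by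
  cases L with
  | nil => simp at hh
  | cons a L =>
    obtain rfl : a = m := by simpa using hh
    obtain ⟨-, h1, h2⟩ := cfQ_append (l := []) (x := (0, 1))
      (fun b hb => hL b (List.mem_cons_of_mem a hb)) le_rfl one_pos (by simp [cfQ])
    have : (2 : ℤ) ≤ a := by exact_mod_cast hm
    simp only [cfAct]
    nlinarith

lemma num_mul_le {s : ℚ} {a b : ℤ} (hb : 0 < b) (h : s ≤ a / b) : s.num * b ≤ a * s.den := by
  have hd : (0 : ℚ) < s.den := by exact_mod_cast s.pos
  rw [← Rat.num_div_den s, div_le_div_iff₀ hd (by exact_mod_cast hb)] at h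
  exact_mod_cast h

lemma le_num_mul {s : ℚ} {a b : ℤ} (hb : 0 < b) (h : a / b ≤ s) : a * s.den ≤ s.num * b := by
  have hd : (0 : ℚ) < s.den := by exact_mod_cast s.pos
  rw [← Rat.num_div_den s, div_le_div_iff₀ (by exact_mod_cast hb) hd] at h
  exact_mod_cast h

lemma num_mul_lt {s : ℚ} {a b : ℤ} (hb : 0 < b) (h : s < a / b) : s.num * b < a * s.den := by
  have hd : (0 : ℚ) < s.den := by exact_mod_cast s.pos
  rw [← Rat.num_div_den s, div_lt_div_iff₀ hd (by exact_mod_cast hb)] at h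
  exact_mod_cast h

lemma lt_num_mul {s : ℚ} {a b : ℤ} (hb : 0 < b) (h : a / b < s) : a * s.den < s.num * b := by
  have hd : (0 : ℚ) < s.den := by exact_mod_cast s.pos
  rw [← Rat.num_div_den s, div_lt_div_iff₀ (by exact_mod_cast hb) hd] at h
  exact_mod_cast h

/-- The slopes in the union of the two intervals are far from the slope of the relator. -/
theorem exists_slopes {M : List ℕ} {m n : ℕ} (hlen : 2 ≤ M.length) (hpos : ∀ x ∈ M, 0 < x)
    (hlast : 2 ≤ M.getLast!) (hm : M.head? = some m) (hn : 2 ≤ n) (hm2 : 2 ≤ m)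
    {t : Fin 3 → ℚ} (h0 : t 0 = cfQ M) (hne : t 1 ≠ t 2)
    (hmem : ∀ c, c ≠ 0 → memI1 M n (t c) ∨ memI2 M n (t c)) :
    ∃ pp pm Jp Jm, Slopes (fun c => (t c).num) (fun c => ((t c).den : ℤ)) n pp pm Jp Jm := by
  obtain ⟨L, x, rfl⟩ : ∃ L x, M = L ++ [x] :=
    ⟨_, _, (List.dropLast_append_getLast (l := M) (by rintro rfl; simp at hlen)).symm⟩
  have hx : (L ++ [x]).getLast! = x := by simp [List.getLast!_eq_getLast?_getD]
  have hL : ∀ a ∈ L, 0 < a := fun a ha => hpos a (by simp [ha])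
  have hx2 : (2 : ℤ) ≤ x := by rw [hx] at hlast; exact_mod_cast hlast
  have hn2 : (2 : ℤ) ≤ n := by exact_mod_cast hn
  have hB : 2 ≤ (cfAct L (0, 1)).2 := by
    refine two_le_cfAct hL hm2 ?_
    cases L with
    | nil => simp at hlen
    | cons a L => simpa using hm
  have hC := (cfAct_nonneg L (x := (1, 0)) zero_le_one le_rfl).2
  have hdet := cfAct_det L
  obtain ⟨r1, -, r3⟩ := cfQ_append hL (l := [x]) (x := (1, (x : ℤ))) (by simp) (by omega)
    (by simp [cfQ])
  obtain ⟨y1, -, y3⟩ := cfQ_append hL (l := [x - 1, 2]) (x := (2, 2 * (x : ℤ) - 1)) (by simp)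
    (by simp; omega) (by
      have : ((x - 1 : ℕ) : ℚ) = x - 1 := by rw [Nat.cast_sub (by omega)]; simp
      have h2 : (2 * (x : ℚ) - 1) ≠ 0 := by
        have : (2 : ℚ) ≤ x := by exact_mod_cast hx2
        linarith
      simp only [cfQ, this]
      push_cast
      have e2 : (x : ℚ) - 1 + 1 / (2 + 0) = (2 * x - 1) / 2 := by ring
      rw [e2, one_div_div])
  obtain ⟨z1, -, z3⟩ := cfQ_append hL (l := [x, 2 * n - 2])
    (x := (2 * n - 2, x * (2 * (n : ℤ) - 2) + 1)) (by simp; omega)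
    (by simp only []; nlinarith) (by
      have : ((2 * n - 2 : ℕ) : ℚ) = 2 * n - 2 := by rw [Nat.cast_sub (by omega)]; simp
      have h2 : (2 * (n : ℚ) - 2) ≠ 0 := by
        have : (2 : ℚ) ≤ n := by exact_mod_cast hn2
        linarith
      simp only [cfQ, this]
      push_cast
      have e2 : (x : ℚ) + 1 / (2 * n - 2 + 0) = (x * (2 * n - 2) + 1) / (2 * n - 2) := by
        rw [add_zero, eq_div_iff h2, add_mul, one_div, inv_mul_cancel₀ h2]
      rw [e2, one_div_div])
  rw [cfAct_eq L 1 x] at r1 r3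
  rw [cfAct_eq L 2] at y1 y3
  rw [cfAct_eq L (2 * (n : ℤ) - 2)] at z1 z3
  dsimp only at r1 r3 y1 y3 z1 z3
  generalize (cfAct L (1, 0)).1 = C₁, (cfAct L (1, 0)).2 = C₂, (cfAct L (0, 1)).1 = B₁,
    (cfAct L (0, 1)).2 = B₂ at *
  have hcop : Nat.Coprime (1 * C₁ + x * B₁).natAbs (1 * C₂ + x * B₂).natAbs := by
    rw [← Int.isCoprime_iff_nat_coprime]
    refine ⟨(-1) ^ L.length * B₂, -((-1) ^ L.length * B₁), ?_⟩
    have : ((-1 : ℤ) ^ L.length) * (-1) ^ L.length = 1 := by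
      rw [← mul_pow]; simp
    linear_combination (-1) ^ L.length * hdet + this
  rw [r1] at h0
  have hnum : (t 0).num = 1 * C₁ + x * B₁ := by
    rw [h0]; exact Rat.num_div_eq_of_coprime r3 hcop
  have hden : ((t 0).den : ℤ) = 1 * C₂ + x * B₂ := by
    rw [h0]; exact Rat.den_div_eq_of_coprime r3 hcop
  have hne' : ((t 1).den : ℤ) * (t 2).num ≠ (t 1).num * (t 2).den := by
    rw [mul_comm]
    exact fun h => hne (Rat.eq_iff_mul_eq_mul.mpr h.symm)
  have hxB : 2 * B₂ ≤ x * B₂ := by nlinarith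
  have hd : ∀ c, (0 : ℤ) < (t c).den := fun c => by exact_mod_cast (t c).pos
  have hdisc : ∀ c, disc (fun c => (t c).num) (fun c => ((t c).den : ℤ)) c =
      (1 * C₂ + x * B₂) * (t c).num - (1 * C₁ + x * B₁) * (t c).den := fun c => by
    simp only [disc, hnum, hden]
  have hdisc0 : (1 * C₂ + x * B₂) * (t 0).num - (1 * C₁ + x * B₁) * (t 0).den = 0 := by
    rw [hnum, hden]; ring
  simp only [memI1, memI2, hx, List.dropLast_concat, List.append_assoc, List.length_append,
    List.length_singleton, Nat.even_add_one, List.singleton_append] at hmem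
  rcases Nat.even_or_odd L.length with hL' | hL'
  · simp only [hL', hL'.neg_one_pow, not_true, if_false] at hmem hdet
    have key : ∀ c, c ≠ 0 → ((t c).den : ℤ) ≤
          disc (fun c => (t c).num) (fun c => ((t c).den : ℤ)) c *
            (2 * C₂ + (2 * x - 1) * B₂) ∨
        ((t c).den : ℤ) < -disc (fun c => (t c).num) (fun c => ((t c).den : ℤ)) c *
          ((2 * n - 2) * C₂ + (x * (2 * n - 2) + 1) * B₂) := by
      intro c hc
      rw [hdisc]
      rcases hmem c hc with h | h
      · have := mul_lt_mul_of_pos_left (num_mul_lt z3 (z1 ▸ h.2)) r3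
        right
        linear_combination this - (t c).den * hdet
      · have := mul_le_mul_of_nonneg_left (le_num_mul y3 (y1 ▸ h.1)) r3.le
        left
        linear_combination this - (t c).den * hdet
    have hpos' : ∀ c, 0 < disc (fun c => (t c).num) (fun c => ((t c).den : ℤ)) c →
        ((t c).den : ℤ) ≤ disc (fun c => (t c).num) (fun c => ((t c).den : ℤ)) c *
            (2 * C₂ + (2 * x - 1) * B₂) := by
      intro c hc
      have hc0 : c ≠ 0 := by rintro rfl; rw [hdisc, hdisc0] at hc; exact hc.false
      rcases key c hc0 with h | h
      · exact h
      · nlinarith [hd c]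
    have hneg' : ∀ c, disc (fun c => (t c).num) (fun c => ((t c).den : ℤ)) c < 0 →
        ((t c).den : ℤ) < -disc (fun c => (t c).num) (fun c => ((t c).den : ℤ)) c *
          ((2 * n - 2) * C₂ + (x * (2 * n - 2) + 1) * B₂) := by
      intro c hc
      have hc0 : c ≠ 0 := by rintro rfl; rw [hdisc, hdisc0] at hc; exact hc.false
      rcases key c hc0 with h | h
      · nlinarith [hd c]
      · exact h
    refine ⟨C₂ + (x - 1) * B₂, B₂, 1, 2 * n - 2, hn2, ?_, by linarith, hB, by ring, le_rfl,
      by linarith, ⟨C₁ + x * B₁ - B₁, ?_⟩, fun c hc h => ?_, hne', fun c hc => ?_,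
      fun c _ h => by linarith, fun c hc => ?_, fun c hc _ => ?_⟩
    · simp only [hden]; ring
    · simp only [hden, hnum]; linear_combination -hdet
    · have := key c hc
      rw [h] at this
      have := hd c
      simp at *
      omega
    · have := hpos' c hc
      simp only [hden]
      linear_combination this
    · have := hneg' c hc
      simp only [hden]
      linear_combination this
    · have := hneg' c hc
      simp only [hden]
      linear_combination this
  · simp only [Nat.not_even_iff_odd.mpr hL', hL'.neg_one_pow, not_false_eq_true, if_true]
      at hmem hdet
    have key : ∀ c, c ≠ 0 →
        ((t c).den : ℤ) < disc (fun c => (t c).num) (fun c => ((t c).den : ℤ)) c *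
          ((2 * n - 2) * C₂ + (x * (2 * n - 2) + 1) * B₂) ∨
        ((t c).den : ℤ) ≤ -disc (fun c => (t c).num) (fun c => ((t c).den : ℤ)) c *
          (2 * C₂ + (2 * x - 1) * B₂) := by
      intro c hc
      rw [hdisc]
      rcases hmem c hc with h | h
      · have := mul_le_mul_of_nonneg_left (num_mul_le y3 (y1 ▸ h.2)) r3.le
        right
        linear_combination this + (t c).den * hdet
      · have := mul_lt_mul_of_pos_left (lt_num_mul z3 (z1 ▸ h.1)) r3
        left
        linear_combination this + (t c).den * hdet
    have hpos' : ∀ c, 0 < disc (fun c => (t c).num) (fun c => ((t c).den : ℤ)) c →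
        ((t c).den : ℤ) < disc (fun c => (t c).num) (fun c => ((t c).den : ℤ)) c *
          ((2 * n - 2) * C₂ + (x * (2 * n - 2) + 1) * B₂) := by
      intro c hc
      have hc0 : c ≠ 0 := by rintro rfl; rw [hdisc, hdisc0] at hc; exact hc.false
      rcases key c hc0 with h | h
      · exact h
      · nlinarith [hd c]
    have hneg' : ∀ c, disc (fun c => (t c).num) (fun c => ((t c).den : ℤ)) c < 0 →
        ((t c).den : ℤ) ≤ -disc (fun c => (t c).num) (fun c => ((t c).den : ℤ)) c *
          (2 * C₂ + (2 * x - 1) * B₂) := by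
      intro c hc
      have hc0 : c ≠ 0 := by rintro rfl; rw [hdisc, hdisc0] at hc; exact hc.false
      rcases key c hc0 with h | h
      · nlinarith [hd c]
      · exact h
    refine ⟨B₂, C₂ + (x - 1) * B₂, 2 * n - 2, 1, hn2, ?_, hB, by linarith, by ring, by linarith,
      le_rfl, ⟨B₁, ?_⟩, fun c hc h => ?_, hne', fun c hc => ?_, fun c hc _ => ?_,
      fun c hc => ?_, fun c _ h => by linarith⟩
    · simp only [hden]; ring
    · simp only [hden, hnum]; linear_combination hdet
    · have := key c hc
      rw [h] at this
      have := hd c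
      simp at *
      omega
    · have := hpos' c hc
      simp only [hden]
      linear_combination this
    · have := hpos' c hc
      simp only [hden]
      linear_combination this
    · have := hneg' c hc
      simp only [hden]
      linear_combination this

end Heckoid

namespace Heckoid
open FreeGroup

lemma cfQ_mem_unit {l : List ℕ} (hl : ∀ a ∈ l, 0 < a) : 0 ≤ cfQ l ∧ cfQ l ≤ 1 := by
  induction l with
  | nil => simp [cfQ]
  | cons a l ih =>
    obtain ⟨h1, -⟩ := ih fun a ha => hl a (List.mem_cons_of_mem _ ha)
    have ha : (1 : ℚ) ≤ a := by exact_mod_cast hl a List.mem_cons_self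
    have : (1 : ℚ) ≤ a + cfQ l := by linarith
    exact ⟨by unfold cfQ; positivity, by unfold cfQ; exact div_le_one_of_le₀ this (by linarith)⟩

lemma mem_unit_of_mem {M : List ℕ} {n : ℕ} {s : ℚ} (hpos : ∀ x ∈ M, 0 < x)
    (hlast : 2 ≤ M.getLast!) (hn : 2 ≤ n) (h : memI1 M n s ∨ memI2 M n s) : 0 ≤ s ∧ s ≤ 1 := by
  have h1 := cfQ_mem_unit (l := M.dropLast ++ [M.getLast! - 1, 2]) (by
    intro a ha
    simp only [List.mem_append, List.mem_cons, List.not_mem_nil, or_false] at ha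
    rcases ha with ha | rfl | rfl
    · exact hpos a (List.mem_of_mem_dropLast ha)
    · omega
    · omega)
  have h2 := cfQ_mem_unit (l := M ++ [2 * n - 2]) (by
    intro a ha
    simp only [List.mem_append, List.mem_cons, List.not_mem_nil, or_false] at ha
    rcases ha with ha | rfl
    · exact hpos a ha
    · omega)
  unfold memI1 memI2 at h
  split_ifs at h <;> rcases h with ⟨h3, h4⟩ | ⟨h3, h4⟩ <;> constructor <;> linarith

lemma prod_map_mk_singleton {α ι : Type} (f : ι → α × Bool) (l : List ι) :
    (l.map fun i => FreeGroup.mk [f i]).prod = FreeGroup.mk (l.map f) := by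
  induction l with
  | nil => rfl
  | cons a l ih => rw [List.map_cons, List.prod_cons, ih, FreeGroup.mul_mk]; rfl

lemma mk_map_range_mul {α : Type} {f : ℕ → α × Bool} {k : ℕ} (hf : ∀ i, f (k + i) = f i) (n : ℕ) :
    FreeGroup.mk ((List.range (n * k)).map f) = FreeGroup.mk ((List.range k).map f) ^ n := by
  induction n with
  | zero => simp [FreeGroup.one_eq_mk]
  | succ n ih =>
    rw [add_mul, one_mul, add_comm, List.range_add, List.map_append, ← FreeGroup.mul_mk, pow_succ',
      ← ih, List.map_map]
    congr 2
    exact List.map_congr_left fun i _ => hf i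

lemma gen_zpow_eq {s : ℚ} (hs : 0 ≤ s) (i : ℕ) :
    gen i ^ ((-1 : ℤ) ^ (⌊(i : ℚ) * s⌋.toNat)) =
      FreeGroup.mk [lett s.den (i : ZMod 2) (s.num * i)] := by
  have h1 : ⌊(i : ℚ) * s⌋ = s.num * i / s.den := by
    rw [← Rat.floor_intCast_div_natCast]
    congr 1
    nth_rewrite 1 [← Rat.num_div_den s]
    push_cast
    ring
  have h2 : 0 ≤ s.num * i / s.den := by
    have := Rat.num_nonneg.2 hs
    positivity
  have h3 : (⟨i % 2, Nat.mod_lt _ (by norm_num)⟩ : Fin 2) = (i : ZMod 2) := by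
    apply Fin.ext
    exact (ZMod.val_natCast 2 i).symm
  rw [h1]
  obtain ⟨k, hk⟩ := Int.eq_ofNat_of_zero_le h2
  unfold gen lett
  rw [hk, h3]
  rcases Nat.even_or_odd k with h | h
  · have : (2 : ℤ) ∣ k := by exact_mod_cast h.two_dvd
    simp [h.neg_one_pow, this, FreeGroup.of]
  · have : ¬ (2 : ℤ) ∣ k := by
      have := h.not_two_dvd_nat
      exact_mod_cast this
    simp [h.neg_one_pow, this, FreeGroup.of, FreeGroup.inv_mk, FreeGroup.invRev]

/-- The product of the conjugates of words by words, as a word. -/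
def conjWord {α : Type} (gs : List (List (α × Bool) × List (α × Bool))) : List (α × Bool) :=
  gs.flatMap fun x => x.1 ++ x.2 ++ FreeGroup.invRev x.1

lemma exists_conjWord {α : Type} [DecidableEq α] {R : List (α × Bool)} {v : FreeGroup α}
    (hv : v ∈ Subgroup.normalClosure {FreeGroup.mk R}) :
    ∃ gs : List (List (α × Bool) × List (α × Bool)),
      (∀ w ∈ gs.map Prod.snd, w = R ∨ w = FreeGroup.invRev R) ∧ v = FreeGroup.mk (conjWord gs) := by
  induction hv using Subgroup.closure_induction with
  | mem x hx =>
    obtain ⟨a, rfl, ha⟩ := Group.mem_conjugatesOfSet_iff.1 hx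
    obtain ⟨c, rfl⟩ := isConj_iff.1 ha
    refine ⟨[(c.toWord, R)], by simp, ?_⟩
    simp [conjWord, ← FreeGroup.mul_mk, ← FreeGroup.inv_mk, FreeGroup.mk_toWord, mul_assoc]
  | one => exact ⟨[], by simp, rfl⟩
  | mul x y _ _ hx hy =>
    obtain ⟨gs, h1, rfl⟩ := hx
    obtain ⟨gs', h1', rfl⟩ := hy
    refine ⟨gs ++ gs', ?_, by simp [conjWord, FreeGroup.mul_mk]⟩
    intro w hw
    rw [List.map_append, List.mem_append] at hw
    exact hw.elim (h1 w) (h1' w)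
  | inv x _ hx =>
    obtain ⟨gs, h1, rfl⟩ := hx
    clear * - h1
    induction gs with
    | nil => exact ⟨[], by simp, rfl⟩
    | cons x gs ih =>
      obtain ⟨gs', h2, h3⟩ := ih fun w hw => h1 w (List.mem_cons_of_mem _ hw)
      refine ⟨gs' ++ [(x.1, FreeGroup.invRev x.2)], ?_, ?_⟩
      · intro w hw
        rw [List.map_append, List.mem_append] at hw
        rcases hw with hw | hw
        · exact h2 w hw
        · obtain rfl : w = FreeGroup.invRev x.2 := by simpa using hw
          rcases h1 x.2 (by simp) with h | h
          · exact Or.inr (by rw [h])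
          · exact Or.inl (by rw [h, FreeGroup.invRev_invRev])
      · simp only [conjWord, List.flatMap_cons, List.flatMap_append, List.flatMap_nil,
          ← FreeGroup.mul_mk, ← FreeGroup.inv_mk, List.append_nil] at h3 ⊢
        rw [mul_inv_rev, h3]
        group

lemma Sph.conjWord {gs : List (List (Fin 2 × Bool) × List (Fin 2 × Bool))} :
    ∀ {u : List (Fin 2 × Bool)} {ws : List (List (Fin 2 × Bool))},
      Sph ((u ++ conjWord gs) :: ws) → Sph (u :: (gs.map Prod.snd ++ ws)) := by
  induction gs with
  | nil => intro u ws h; simpa [Heckoid.conjWord] using h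
  | cons x gs ih =>
    intro u ws h
    have h1 := h.comm
    rw [Heckoid.conjWord, List.flatMap_cons, List.append_assoc _ _ u] at h1
    have h2 := (h1.split.zip_conj _).perm (List.Perm.swap _ _ _)
    refine (ih h2.comm).perm (List.Perm.cons _ ?_)
    rw [List.map_cons, List.cons_append]
    exact List.perm_middle

lemma Slopes.not_isConj {M : List ℕ} {m n : ℕ} {r s s' : ℚ} (hlen : 2 ≤ M.length)
    (hpos : ∀ x ∈ M, 0 < x) (hlast : 2 ≤ M.getLast!) (hm : M.head? = some m) (hn : 2 ≤ n)
    (hr : r = cfQ M) (hm2 : 2 ≤ m) (hne : s ≠ s')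
    (hs : memI1 M n s ∨ memI2 M n s) (hs' : memI1 M n s' ∨ memI2 M n s') {x : F}
    (hx : x = uWord s' ∨ x = (uWord s')⁻¹) :
    ¬ IsConj (heckQ r n (uWord s)) (heckQ r n x) := by
  intro h
  set t : Fin 3 → ℚ := ![r, s, s'] with ht
  have ht01 : ∀ c, 0 ≤ t c ∧ t c ≤ 1 := by
    intro c
    fin_cases c
    · change 0 ≤ r ∧ r ≤ 1
      rw [hr]
      exact cfQ_mem_unit hpos
    · exact mem_unit_of_mem hpos hlast hn hs
    · exact mem_unit_of_mem hpos hlast hn hs'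
  obtain ⟨pp, pm, Jp, Jm, g⟩ := exists_slopes hlen hpos hlast hm hn hm2 (t := t) hr hne (by
    intro c hc
    fin_cases c
    · exact (hc rfl).elim
    · exact hs
    · exact hs')
  set Q : Fin 3 → ℤ := fun c => (t c).num
  set p : Fin 3 → ℤ := fun c => ((t c).den : ℤ)
  set len : Fin 3 → ℕ := fun c => if c = 0 then n * (2 * (t c).den) else 2 * (t c).den
  have hp : ∀ c, 0 < p c := fun c => Int.natCast_pos.2 (t c).pos
  have hlen2 : ∀ c, 2 * p c ∣ len c := by
    intro c
    simp only [len]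
    split_ifs
    · exact ⟨n, by push_cast; ring⟩
    · exact ⟨1, by push_cast; ring⟩
  have hu : ∀ c, uWord (t c) = FreeGroup.mk
      ((List.range (2 * (t c).den)).map fun i : ℕ => lett (p c) i (Q c * i)) := by
    intro c
    rw [uWord, ← prod_map_mk_singleton]
    exact congrArg _ (List.map_congr_left fun i _ => gen_zpow_eq (ht01 c).1 i)
  have hw1 : ∀ c, c ≠ 0 → uWord (t c) = FreeGroup.mk (faceWord Q p len (c, 0)) := by
    intro c hc
    simp [hu, faceWord, len, hc]
  have hw0 : uWord (t 0) ^ n = FreeGroup.mk (faceWord Q p len (0, 0)) := by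
    have := mk_map_range_mul (f := fun i : ℕ => lett (p 0) i (Q 0 * i)) (k := 2 * (t 0).den)
      (fun i => by
        have e : ((2 * (t 0).den + i : ℕ) : ZMod 2) = i := by
          push_cast
          rw [show (2 : ZMod 2) = 0 from rfl, zero_mul, zero_add]
        rw [e]
        exact lett_congr (hp 0) ⟨Q 0, by push_cast; ring⟩ _) n
    rw [hu, ← this]
    simp [faceWord, len]
  have hinv := fun c => invRev_faceWord (Q := Q) hp hlen2 c
  obtain ⟨e, he⟩ : ∃ e : ℕ, x⁻¹ = FreeGroup.mk (faceWord Q p len (2, e)) := by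
    have h2 := hw1 2 (by decide)
    rcases hx with rfl | rfl
    · refine ⟨1, ?_⟩
      rw [← hinv, ← FreeGroup.inv_mk, ← h2]
      rfl
    · refine ⟨0, ?_⟩
      rw [← h2, inv_inv]
      rfl
  obtain ⟨c, hc⟩ := isConj_iff.1 h
  obtain ⟨c, rfl⟩ := QuotientGroup.mk'_surjective _ c
  have hmem : x⁻¹ * (c * uWord s * c⁻¹) ∈ heckN r n := by
    refine QuotientGroup.eq.1 ?_
    exact hc.symm
  have hmem' := inv_mem hmem
  rw [heckN, show uWord r = uWord (t 0) from rfl, hw0] at hmem'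
  obtain ⟨gs, h1, h2⟩ := exists_conjWord hmem'
  obtain ⟨es, hes⟩ : ∃ es : List ℕ, es.map (fun e => faceWord Q p len (0, e)) = gs.map Prod.snd := by
    rw [← Set.mem_range, Set.range_list_map]
    intro w hw
    rcases h1 w hw with rfl | rfl
    · exact ⟨0, rfl⟩
    · exact ⟨1, (hinv 0).symm⟩
  have h3 : FreeGroup.mk (faceWord Q p len (2, e) ++
      conjWord ((c.toWord, faceWord Q p len (1, 0)) :: gs)) = 1 := by
    rw [conjWord, List.flatMap_cons, ← conjWord]
    simp only [← FreeGroup.mul_mk, ← FreeGroup.inv_mk]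
    rw [← h2, ← he, ← hw1 1 (by decide), FreeGroup.mk_toWord]
    show x⁻¹ * (c * uWord s * c⁻¹ * _) = 1
    group
  have h4 := (Sph.init h3).conjWord
  refine g.not_sph (len := len) hp (fun c => Rat.num_nonneg.2 (ht01 c).1)
    (fun c => by simpa using num_mul_le (a := 1) one_pos (by simpa using (ht01 c).2)) ?_ ?_ _
    ((2, e) :: (1, 0) :: es.map fun e => (0, e)) le_rfl ?_ ?_ ?_
  · simp only [len, p, if_true]; push_cast; ring
  · intro c hc
    simp [len, p, hc]
  · rw [List.append_nil, List.map_cons, ← hes] at h4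
    simpa [Function.comp_def] using h4
  · simp [Function.comp_def, List.count_replicate, List.map_const']
  · simp [Function.comp_def, List.count_replicate, List.map_const']

end Heckoid

namespace Heckoid

/-- Lemma 3.8: if `m ≥ 2`, `r ≠ [m,2]`, and `s ≠ s'` in `I₁(r;n) ∪ I₂(r;n)` are
such that `u_s` is conjugate in `Heck(r;n)` to `u_{s'}^{±1}`, then `u_{s̃}` is
conjugate in `Heck(r̃;n)` to `u_{s̃'}` or to `u_{s̃'}^{-1}`, where `r̃`, `s̃`,
`s̃'` are the derived rationals (with `Ls`, `Ls'` the continued fraction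
expansions of `s`, `s'`). -/
theorem statement14
    (M : List ℕ) (m n : ℕ) (r : ℚ)
    (hMlen : 2 ≤ M.length) (hMpos : ∀ x ∈ M, 0 < x) (hMlast : 2 ≤ M.getLast!)
    (hm : M.head? = some m) (hn : 2 ≤ n) (hr : r = cfQ M)
    (hm2 : 2 ≤ m) (hrm2 : r ≠ cfQ [m, 2])
    (s s' : ℚ) (hss' : s ≠ s')
    (hs : memI1 M n s ∨ memI2 M n s) (hs' : memI1 M n s' ∨ memI2 M n s')
    (hconj : IsConj (heckQ r n (uWord s)) (heckQ r n (uWord s')) ∨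
      IsConj (heckQ r n (uWord s)) ((heckQ r n (uWord s'))⁻¹))
    (Ls Ls' : List ℕ) (hLs : IsCFExp s Ls) (hLs' : IsCFExp s' Ls') :
    IsConj (heckQ (cfQ (deriveCF M)) n (uWord (cfQ (deriveCF Ls))))
        (heckQ (cfQ (deriveCF M)) n (uWord (cfQ (deriveCF Ls')))) ∨
      IsConj (heckQ (cfQ (deriveCF M)) n (uWord (cfQ (deriveCF Ls))))
        ((heckQ (cfQ (deriveCF M)) n (uWord (cfQ (deriveCF Ls'))))⁻¹) := by
  rcases hconj with h | h
  · exact (Slopes.not_isConj hMlen hMpos hMlast hm hn hr hm2 hss' hs hs' (Or.inl rfl) h).elim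
  · rw [← map_inv] at h
    exact (Slopes.not_isConj hMlen hMpos hMlast hm hn hr hm2 hss' hs hs' (Or.inr rfl) h).elim

end Heckoid
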